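/- Fix a non-zero linear form q_1 on ℂ^M, M ≥ 8, and consider the affine space q_1 + 𝒫^{sing} of polynomials f = q_1 + q_2 + ... + q_M (q_i homogeneous of degree i). Let 𝒫_i (i = 1, 2, 3) be the closure of the set of such polynomials violating condition (R1.i), and c_i = codim(𝒫_i ⊂ q_1 + 𝒫^{sing}). Then min{c_1, c_2, c_3} = c_2 = (M−6)(M−5)/2. -/

import Mathlib

/-!
Shared elementary framework: the Zariski topology on a complex vector space,
dimension of subsets (topological Krull dimension), rank of quadratic forms,
and the space 𝒫^sing of polynomials `f = q₂ + q₃ + ⋯ + q_M`.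
-/

noncomputable section

open MvPolynomial

/-- A polynomial function on a complex vector space: a polynomial expression in
finitely many linear functionals. -/
def IsPolyFun {E : Type*} [AddCommGroup E] [Module ℂ E] (g : E → ℂ) : Prop :=
  ∃ (n : ℕ) (φ : E →ₗ[ℂ] (Fin n → ℂ)) (p : MvPolynomial (Fin n) ℂ),
    ∀ v, g v = MvPolynomial.eval (φ v) p

/-- Zariski-closed subsets of a complex vector space: common zero loci of families
of polynomial functions. -/
def IsZClosed {E : Type*} [AddCommGroup E] [Module ℂ E] (A : Set E) : Prop :=
  ∃ G : Set (E → ℂ), (∀ g ∈ G, IsPolyFun g) ∧ A = {v | ∀ g ∈ G, g v = 0}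

/-- The Zariski topology on a complex vector space. -/
def zariskiTopology (E : Type*) [AddCommGroup E] [Module ℂ E] : TopologicalSpace E :=
  TopologicalSpace.generateFrom {U | IsZClosed Uᶜ}

/-- A subset is Zariski open. -/
def IsZOpen {E : Type*} [AddCommGroup E] [Module ℂ E] (A : Set E) : Prop :=
  @IsOpen E (zariskiTopology E) A

/-- The dimension of a subset of a complex vector space: the topological Krull
dimension in the induced Zariski topology. -/
def zdim {E : Type*} [AddCommGroup E] [Module ℂ E] (A : Set E) : WithBot ℕ∞ :=
  @topologicalKrullDim A (TopologicalSpace.induced Subtype.val (zariskiTopology E))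

/-- The Zariski closure of a subset of a complex vector space. -/
def zclosure {E : Type*} [AddCommGroup E] [Module ℂ E] (A : Set E) : Set E :=
  @closure E (zariskiTopology E) A

/-- The rank of the quadratic form `q` on a subset `A ⊆ ℂ^n`: the least number of
squares of linear forms expressing `q` on `A` (over `ℂ` this is the rank of the
restriction of `q`). -/
def rankOn {n : ℕ} (q : MvPolynomial (Fin n) ℂ) (A : Set (Fin n → ℂ)) : ℕ :=
  sInf {r : ℕ | ∃ l : Fin r → ((Fin n → ℂ) →ₗ[ℂ] ℂ),
    ∀ z ∈ A, MvPolynomial.eval z q = ∑ i, l i z ^ 2}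

/-- The space 𝒫^sing of polynomials `f = q₂ + q₃ + ⋯ + q_M` in `M` variables:
polynomials of total degree at most `M` whose homogeneous components of degree 0
and 1 vanish. -/
def Psing (M : ℕ) : Submodule ℂ (MvPolynomial (Fin M) ℂ) :=
  (MvPolynomial.restrictTotalDegree (Fin M) ℂ M) ⊓
    (LinearMap.ker (MvPolynomial.homogeneousComponent 0) ⊓
     LinearMap.ker (MvPolynomial.homogeneousComponent 1))

/-- `C` is an irreducible component of `Z` (with respect to the Zariski topology):
a maximal irreducible subset of `Z`. -/
def IsIrredCompOf {E : Type*} [AddCommGroup E] [Module ℂ E] (C Z : Set E) : Prop :=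
  C ⊆ Z ∧ @IsIrreducible E (zariskiTopology E) C ∧
    ∀ C' : Set E, C ⊆ C' → C' ⊆ Z → @IsIrreducible E (zariskiTopology E) C' → C' = C

/-- Condition (R1.1) for `f = q₂ + ⋯ + q_M` and the linear form `q₁`:
the sequence `q₁, q₂, …, q_{M−1}` is regular in `𝒪_{o,ℙ}`, i.e. the system
`q₁ = q₂ = ⋯ = q_{M−1} = 0` defines a one-dimensional subset (a finite set of lines
through the origin). -/
def CondR11 {M : ℕ} (q₁ f : MvPolynomial (Fin M) ℂ) : Prop :=
  zdim {z : Fin M → ℂ | MvPolynomial.eval z q₁ = 0 ∧ ∀ i ∈ Finset.Icc 2 (M - 1),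
    MvPolynomial.eval z (MvPolynomial.homogeneousComponent i f) = 0} ≤ 1

/-- Condition (R1.2): the quadratic form `q₂` restricted to the tangent hyperplane
`{q₁ = 0}` has rank at least 6, and the linear span of every irreducible component
of the closed set `{q₁ = q₂ = q₃ = 0} ⊆ ℂ^M` is the hyperplane `{q₁ = 0}`. -/
def CondR12 {M : ℕ} (q₁ f : MvPolynomial (Fin M) ℂ) : Prop :=
  6 ≤ rankOn (MvPolynomial.homogeneousComponent 2 f)
        {z : Fin M → ℂ | MvPolynomial.eval z q₁ = 0} ∧
  ∀ C : Set (Fin M → ℂ),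
    IsIrredCompOf C {z : Fin M → ℂ | MvPolynomial.eval z q₁ = 0 ∧
        MvPolynomial.eval z (MvPolynomial.homogeneousComponent 2 f) = 0 ∧
        MvPolynomial.eval z (MvPolynomial.homogeneousComponent 3 f) = 0} →
      (Submodule.span ℂ C : Set (Fin M → ℂ))
        = {z : Fin M → ℂ | MvPolynomial.eval z q₁ = 0}

/-- Condition (R1.3): for every hyperplane `P ∋ o` different from the tangent
hyperplane `T_oF = {q₁ = 0}`, the scheme-theoretic intersection of `P`, `{q₁ = 0}`,
the quadric `{q₂ = 0}` and `F = {q₁ + f = 0}` is irreducible and reduced, i.e. the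
ideal generated by the corresponding equations is prime. -/
def CondR13 {M : ℕ} (q₁ f : MvPolynomial (Fin M) ℂ) : Prop :=
  ∀ p : MvPolynomial (Fin M) ℂ, p.IsHomogeneous 1 →
    p ∉ Submodule.span ℂ ({q₁} : Set (MvPolynomial (Fin M) ℂ)) →
    (Ideal.span ({p, q₁, MvPolynomial.homogeneousComponent 2 f, q₁ + f} :
        Set (MvPolynomial (Fin M) ℂ))).IsPrime

open Topology

/-! ### Zariski topology and vanishing ideals -/

theorem eval_bind₁ {R σ τ : Type*} [CommSemiring R] (x : τ → R) (g : σ → MvPolynomial τ R)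
    (p : MvPolynomial σ R) : eval x (bind₁ g p) = eval (fun i => eval x (g i)) p := by
  induction p using MvPolynomial.induction_on with
  | C a => simp
  | add p q hp hq => simp [hp, hq]
  | mul_X p i hp => simp [hp]

theorem isIrreducible_preimage_val {X : Type*} [TopologicalSpace X] {Y C : Set X}
    (hC : IsIrreducible C) (hCY : C ⊆ Y) : IsIrreducible (Subtype.val ⁻¹' C : Set Y) := by
  obtain ⟨⟨x, hx⟩, h⟩ := hC
  refine ⟨⟨⟨x, hCY hx⟩, hx⟩, ?_⟩
  intro u v hu hv hu' hv'
  obtain ⟨u, hu2, rfl⟩ := isOpen_induced_iff.1 hu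
  obtain ⟨v, hv2, rfl⟩ := isOpen_induced_iff.1 hv
  obtain ⟨a, ha, ha'⟩ := hu'
  obtain ⟨b, hb, hb'⟩ := hv'
  obtain ⟨c, hc, hc'⟩ := h u v hu2 hv2 ⟨a, ha, ha'⟩ ⟨b, hb, hb'⟩
  exact ⟨⟨c, hCY hc⟩, hc, hc'⟩

section ZariskiBasics

variable {E : Type*} [AddCommGroup E] [Module ℂ E] {σ : Type*}

/-- The vanishing ideal of a subset of a vector space, in the coordinates `e`. -/
def coordIdeal (e : E ≃ₗ[ℂ] (σ → ℂ)) (S : Set E) : Ideal (MvPolynomial σ ℂ) :=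
  vanishingIdeal ℂ (e '' S)

theorem mem_coordIdeal {e : E ≃ₗ[ℂ] (σ → ℂ)} {S : Set E} {p : MvPolynomial σ ℂ} :
    p ∈ coordIdeal e S ↔ ∀ s ∈ S, eval (e s) p = 0 := by
  simp [coordIdeal, mem_vanishingIdeal_iff, coe_aeval_eq_eval]

theorem coordIdeal_anti (e : E ≃ₗ[ℂ] (σ → ℂ)) {S T : Set E} (h : S ⊆ T) :
    coordIdeal e T ≤ coordIdeal e S := fun _ hp =>
  mem_coordIdeal.2 fun s hs => mem_coordIdeal.1 hp s (h hs)

variable [Finite σ]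

theorem isPolyFun_eval (e : E ≃ₗ[ℂ] (σ → ℂ)) (p : MvPolynomial σ ℂ) :
    IsPolyFun fun v => eval (e v) p := by
  obtain ⟨n, ⟨r⟩⟩ := Finite.exists_equiv_fin σ
  obtain ⟨φ, hφ⟩ : ∃ φ : E →ₗ[ℂ] (Fin n → ℂ), ∀ v i, φ v i = e v (r.symm i) :=
    ⟨LinearMap.pi fun i => (LinearMap.proj (r.symm i)).comp e.toLinearMap, fun v i => rfl⟩
  refine ⟨n, φ, rename r p, ?_⟩
  intro v
  rw [eval_rename]
  have : φ v ∘ r = e v := by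
    ext i
    simp [hφ]
  rw [this]

theorem IsPolyFun.exists_eval {g : E → ℂ} (hg : IsPolyFun g) (e : E ≃ₗ[ℂ] (σ → ℂ)) :
    ∃ p : MvPolynomial σ ℂ, ∀ v, g v = eval (e v) p := by
  classical
  obtain ⟨n, φ, p, h⟩ := hg
  have := Fintype.ofFinite σ
  refine ⟨bind₁ (fun i => ∑ j, C (φ (e.symm (Pi.single j 1)) i) * X j) p, fun v => ?_⟩
  rw [h, eval_bind₁]
  congr 2
  ext i
  have hv : v = ∑ j, e v j • e.symm (Pi.single j 1) := by
    apply e.injective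
    simp only [map_sum, map_smul, LinearEquiv.apply_symm_apply]
    ext k
    simp [Finset.sum_apply, Pi.single_apply]
  conv_lhs => rw [hv]
  simp [mul_comm]

theorem isClosed_zariski_iff (e : E ≃ₗ[ℂ] (σ → ℂ)) {A : Set E} :
    IsClosed[zariskiTopology E] A ↔
      ∃ I : Ideal (MvPolynomial σ ℂ), A = {v | ∀ p ∈ I, eval (e v) p = 0} := by
  constructor
  · intro h
    have h1 : IsOpen[zariskiTopology E] Aᶜ := (@isOpen_compl_iff E A (zariskiTopology E)).2 h
    have key : ∀ U : Set E, TopologicalSpace.GenerateOpen {U | IsZClosed Uᶜ} U →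
        ∃ I : Ideal (MvPolynomial σ ℂ), Uᶜ = {v | ∀ p ∈ I, eval (e v) p = 0} := by
      intro U hU
      induction hU with
      | basic U hU =>
        obtain ⟨G, hG, hU⟩ := hU
        refine ⟨Ideal.span {p | ∃ g ∈ G, ∀ v, g v = eval (e v) p}, ?_⟩
        rw [hU]
        ext v
        simp only [Set.mem_ofPred_eq]
        constructor
        · intro hv p hp
          have : Ideal.span {p | ∃ g ∈ G, ∀ v, g v = eval (e v) p} ≤ RingHom.ker (eval (e v)) := by
            rw [Ideal.span_le]
            rintro p ⟨g, hg, hp⟩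
            simp only [SetLike.mem_coe, RingHom.mem_ker]
            rw [← hp, hv g hg]
          exact this hp
        · intro hv g hg
          obtain ⟨p, hp⟩ := (hG g hg).exists_eval e
          rw [hp]
          exact hv p (Ideal.subset_span ⟨g, hg, hp⟩)
      | univ => exact ⟨⊤, by
          ext v; simp only [Set.compl_univ, Set.mem_empty_iff_false, false_iff, Set.mem_ofPred_eq]
          intro h; simpa using h 1 trivial⟩
      | inter U V _ _ hU hV =>
        obtain ⟨I, hI⟩ := hU
        obtain ⟨J, hJ⟩ := hV
        refine ⟨I * J, ?_⟩
        rw [Set.compl_inter, hI, hJ]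
        ext v
        simp only [Set.mem_union, Set.mem_ofPred_eq]
        constructor
        · rintro (h | h) p hp
          · exact h p (Ideal.mul_le_left hp)
          · exact h p (Ideal.mul_le_right hp)
        · intro h
          by_contra! hc
          obtain ⟨⟨p, hp, hp'⟩, q, hq, hq'⟩ := hc
          have := h _ (Ideal.mul_mem_mul hp hq)
          rw [map_mul] at this
          exact (mul_ne_zero hp' hq') this
      | sUnion T _ ih =>
        refine ⟨coordIdeal e (⋃₀ T)ᶜ, ?_⟩
        apply subset_antisymm
        · intro v hv p hp
          exact mem_coordIdeal.1 hp v hv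
        · intro v hv hvT
          obtain ⟨U, hU, hvU⟩ := hvT
          obtain ⟨I, hI⟩ := ih U hU
          have h2 : v ∈ Uᶜ := by
            rw [hI]
            intro p hp
            apply hv
            rw [mem_coordIdeal]
            intro s hs
            have h3 : s ∈ Uᶜ := fun hsU => hs ⟨U, hU, hsU⟩
            rw [hI] at h3
            exact h3 p hp
          exact h2 hvU
    obtain ⟨I, hI⟩ := key _ h1
    exact ⟨I, by rw [← hI, compl_compl]⟩
  · rintro ⟨I, rfl⟩
    rw [← @isOpen_compl_iff E _ (zariskiTopology E)]
    refine TopologicalSpace.GenerateOpen.basic _ ?_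
    refine ⟨{g | ∃ p ∈ I, g = fun v => eval (e v) p}, ?_, ?_⟩
    · rintro g ⟨p, -, rfl⟩
      exact isPolyFun_eval e p
    · rw [compl_compl]
      ext v
      simp only [Set.mem_ofPred_eq]
      exact ⟨fun h g ⟨p, hp, hg⟩ => by rw [hg]; exact h p hp, fun h p hp => h _ ⟨p, hp, rfl⟩⟩

theorem zclosure_eq (e : E ≃ₗ[ℂ] (σ → ℂ)) (S : Set E) :
    zclosure S = {v | ∀ p ∈ coordIdeal e S, eval (e v) p = 0} := by
  letI := zariskiTopology E
  apply subset_antisymm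
  · apply closure_minimal
    · intro s hs p hp
      exact mem_coordIdeal.1 hp s hs
    · exact (isClosed_zariski_iff e).2 ⟨_, rfl⟩
  · obtain ⟨I, hI⟩ := (isClosed_zariski_iff e).1 (isClosed_closure (s := S))
    intro v hv
    change v ∈ closure S
    rw [hI]
    intro p hp
    apply hv
    rw [mem_coordIdeal]
    intro s hs
    have : s ∈ closure S := subset_closure hs
    rw [hI] at this
    exact this p hp

theorem coordIdeal_zclosure (e : E ≃ₗ[ℂ] (σ → ℂ)) (S : Set E) :
    coordIdeal e (zclosure S) = coordIdeal e S := by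
  rw [zclosure_eq e]
  ext p
  rw [mem_coordIdeal]
  refine ⟨fun h => mem_coordIdeal.2 fun s hs => h s fun q hq => mem_coordIdeal.1 hq s hs,
    fun h s hs => hs p h⟩

theorem coordIdeal_isPrime (e : E ≃ₗ[ℂ] (σ → ℂ)) {S : Set E}
    (h : @IsIrreducible E (zariskiTopology E) S) : (coordIdeal e S).IsPrime := by
  letI := zariskiTopology E
  obtain ⟨⟨s, hs⟩, h⟩ := h
  rw [Ideal.isPrime_iff]
  constructor
  · rw [Ideal.ne_top_iff_one]
    intro h1
    simpa using mem_coordIdeal.1 h1 s hs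
  · intro p q hpq
    have hcl : ∀ p : MvPolynomial σ ℂ, IsClosed {v : E | eval (e v) p = 0} := fun p =>
      (isClosed_zariski_iff e).2 ⟨Ideal.span {p}, by
        ext v
        have key : ∀ I : Ideal (MvPolynomial σ ℂ), (∀ p ∈ I, eval (e v) p = 0) ↔
            I ≤ RingHom.ker (eval (e v)) := fun I => Iff.rfl
        simp only [Set.mem_ofPred_eq]
        rw [key, Ideal.span_le]
        simp⟩
    rw [isPreirreducible_iff_isClosed_union_isClosed] at h
    have := h _ _ (hcl p) (hcl q) (by
      intro s hs
      have := mem_coordIdeal.1 hpq s hs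
      simpa using this)
    rcases this with h | h
    · exact Or.inl (mem_coordIdeal.2 fun s hs => h hs)
    · exact Or.inr (mem_coordIdeal.2 fun s hs => h hs)

theorem coordIdeal_zeros (e : E ≃ₗ[ℂ] (σ → ℂ)) (P : Ideal (MvPolynomial σ ℂ)) [hP : P.IsPrime] :
    coordIdeal e {v | ∀ p ∈ P, eval (e v) p = 0} = P := by
  have := IsPrime.vanishingIdeal_zeroLocus (K := ℂ) P
  conv_rhs => rw [← this]
  ext p
  rw [mem_coordIdeal, mem_vanishingIdeal_iff]
  constructor
  · intro h x hx
    have := h (e.symm x) (by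
      intro q hq
      have := hx q hq
      simpa [coe_aeval_eq_eval] using this)
    simpa [coe_aeval_eq_eval] using this
  · intro h s hs
    have := h (e s) (by
      intro q hq
      simpa [coe_aeval_eq_eval] using hs q hq)
    simpa [coe_aeval_eq_eval] using this

theorem isIrreducible_zeros (e : E ≃ₗ[ℂ] (σ → ℂ)) (P : Ideal (MvPolynomial σ ℂ)) [hP : P.IsPrime] :
    @IsIrreducible E (zariskiTopology E) {v | ∀ p ∈ P, eval (e v) p = 0} := by
  letI := zariskiTopology E
  have hI := coordIdeal_zeros e P
  constructor
  · by_contra h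
    rw [Set.not_nonempty_iff_eq_empty] at h
    rw [h] at hI
    apply hP.ne_top
    rw [← hI, eq_top_iff]
    intro p _
    simp [mem_coordIdeal]
  · rw [isPreirreducible_iff_isClosed_union_isClosed]
    intro Z W hZ hW hZW
    obtain ⟨I, rfl⟩ := (isClosed_zariski_iff e).1 hZ
    obtain ⟨J, rfl⟩ := (isClosed_zariski_iff e).1 hW
    have hIJ : I * J ≤ P := by
      rw [← hI, Ideal.mul_le]
      intro p hp q hq
      rw [mem_coordIdeal]
      intro s hs
      rw [map_mul]
      rcases hZW hs with h | h
      · rw [h p hp, zero_mul]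
      · rw [h q hq, mul_zero]
    rcases hP.mul_le.1 hIJ with h | h
    · exact Or.inl fun v hv p hp => hv p (h hp)
    · exact Or.inr fun v hv p hp => hv p (h hp)

theorem zdim_le_ringKrullDim (e : E ≃ₗ[ℂ] (σ → ℂ)) (A : Set E) :
    zdim A ≤ ringKrullDim (MvPolynomial σ ℂ ⧸ coordIdeal e A) := by
  letI := zariskiTopology E
  rw [ringKrullDim_quotient, ← Order.krullDim_orderDual]
  change Order.krullDim (TopologicalSpace.IrreducibleCloseds A) ≤ _
  let F : TopologicalSpace.IrreducibleCloseds A →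
      (PrimeSpectrum.zeroLocus (coordIdeal e A : Set (MvPolynomial σ ℂ)))ᵒᵈ := fun C =>
    OrderDual.toDual ⟨⟨coordIdeal e (Subtype.val '' (C : Set A)), coordIdeal_isPrime e
      (C.isIrreducible.image _ continuous_subtype_val.continuousOn)⟩,
      coordIdeal_anti e (by rintro _ ⟨x, -, rfl⟩; exact x.2)⟩
  refine Order.krullDim_le_of_strictMono F ?_
  intro C D hCD
  have hle : coordIdeal e (Subtype.val '' (D : Set A)) ≤ coordIdeal e (Subtype.val '' (C : Set A)) :=
    coordIdeal_anti e (Set.image_mono hCD.le)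
  refine lt_of_le_not_ge hle ?_
  intro hge
  have hge : coordIdeal e (Subtype.val '' (C : Set A)) ≤ coordIdeal e (Subtype.val '' (D : Set A)) :=
    hge
  apply hCD.not_ge
  intro x hx
  have h1 : (x : E) ∈ zclosure (Subtype.val '' (C : Set A)) := by
    rw [zclosure_eq e]
    intro p hp
    exact mem_coordIdeal.1 (hge hp) x ⟨x, hx, rfl⟩
  have h2 : x ∈ closure (C : Set A) := by
    rw [Topology.IsInducing.subtypeVal.closure_eq_preimage_closure_image]
    exact h1
  rwa [C.isClosed.closure_eq] at h2

theorem exists_irreducibleCloseds_zeros (e : E ≃ₗ[ℂ] (σ → ℂ)) (Z : Set E)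
    (P : Ideal (MvPolynomial σ ℂ)) (hP : P.IsPrime) (h : {v | ∀ p ∈ P, eval (e v) p = 0} ⊆ Z) :
    ∃ C : @TopologicalSpace.IrreducibleCloseds Z
      (TopologicalSpace.induced Subtype.val (zariskiTopology E)),
      ∀ v : Z, v ∈ @TopologicalSpace.IrreducibleCloseds.carrier Z
        (TopologicalSpace.induced Subtype.val (zariskiTopology E)) C ↔ ∀ p ∈ P, eval (e v) p = 0 := by
  let _ := zariskiTopology E
  exact ⟨⟨_, isIrreducible_preimage_val (isIrreducible_zeros e P) h,
    ((isClosed_zariski_iff e).2 ⟨P, rfl⟩).preimage continuous_subtype_val⟩, fun v => Iff.rfl⟩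

theorem ringKrullDim_le_zdim (e : E ≃ₗ[ℂ] (σ → ℂ)) (I : Ideal (MvPolynomial σ ℂ)) (Z : Set E)
    (hsub : ∀ P : Ideal (MvPolynomial σ ℂ), P.IsPrime → I ≤ P →
      {v | ∀ p ∈ P, eval (e v) p = 0} ⊆ Z) :
    ringKrullDim (MvPolynomial σ ℂ ⧸ I) ≤ zdim Z := by
  rw [ringKrullDim_quotient, ← Order.krullDim_orderDual]
  have hF : ∀ P : (PrimeSpectrum.zeroLocus (I : Set (MvPolynomial σ ℂ)))ᵒᵈ, _ := fun P =>
    exists_irreducibleCloseds_zeros e Z (OrderDual.ofDual P).1.asIdeal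
      (OrderDual.ofDual P).1.isPrime (hsub _ (OrderDual.ofDual P).1.isPrime (OrderDual.ofDual P).2)
  choose F hF using hF
  unfold zdim topologicalKrullDim
  refine Order.krullDim_le_of_strictMono F ?_
  intro P Q hPQ
  have hle : @TopologicalSpace.IrreducibleCloseds.carrier Z
        (TopologicalSpace.induced Subtype.val (zariskiTopology E)) (F P) ⊆
      @TopologicalSpace.IrreducibleCloseds.carrier Z
        (TopologicalSpace.induced Subtype.val (zariskiTopology E)) (F Q) := by
    intro v hv
    rw [hF] at hv ⊢
    intro p hp
    exact hv p (hPQ.le hp)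
  refine lt_of_le_not_ge hle ?_
  intro hge
  apply hPQ.not_ge
  change (OrderDual.ofDual P).1.asIdeal ≤ (OrderDual.ofDual Q).1.asIdeal
  rw [← coordIdeal_zeros e (OrderDual.ofDual P).1.asIdeal,
    ← coordIdeal_zeros e (OrderDual.ofDual Q).1.asIdeal]
  refine coordIdeal_anti e ?_
  intro v hv
  have h2 := hsub _ (OrderDual.ofDual Q).1.isPrime (OrderDual.ofDual Q).2 hv
  exact (hF P ⟨v, h2⟩).1 (hge ((hF Q ⟨v, h2⟩).2 hv))

theorem ringKrullDim_le_zdim_zclosure (e : E ≃ₗ[ℂ] (σ → ℂ)) (S : Set E) :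
    ringKrullDim (MvPolynomial σ ℂ ⧸ coordIdeal e S) ≤ zdim (zclosure S) := by
  refine ringKrullDim_le_zdim e _ _ fun P _ hP v hv => ?_
  rw [zclosure_eq e]
  exact fun p hp => hv p (hP hp)

theorem zdim_zclosure_eq (e : E ≃ₗ[ℂ] (σ → ℂ)) (S : Set E) :
    zdim (zclosure S) = ringKrullDim (MvPolynomial σ ℂ ⧸ coordIdeal e S) := by
  refine le_antisymm ?_ (ringKrullDim_le_zdim_zclosure e S)
  rw [← coordIdeal_zclosure e S]
  exact zdim_le_ringKrullDim e _

end ZariskiBasics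

/-! ### Krull dimension and integral extensions -/

theorem ringKrullDim_le_of_isIntegral {R S : Type*} [CommRing R] [CommRing S] (f : R →+* S)
    (hf : f.IsIntegral) : ringKrullDim S ≤ ringKrullDim R := by
  algebraize [f]
  have : Algebra.IsIntegral R S := ⟨hf⟩
  refine Order.krullDim_le_of_strictMono (PrimeSpectrum.comap f) ?_
  intro P Q hPQ
  exact Ideal.IsIntegral.comap_lt_comap (R := R) (I := P.asIdeal) (J := Q.asIdeal) hPQ

theorem ringKrullDim_le_of_isIntegral_of_injective {R S : Type*} [CommRing R] [CommRing S]
    [IsDomain S] (f : R →+* S) (hf : f.IsIntegral) (hinj : Function.Injective f) :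
    ringKrullDim R ≤ ringKrullDim S := by
  algebraize [f]
  have : Algebra.IsIntegral R S := ⟨hf⟩
  have key : ∀ n (p : LTSeries (PrimeSpectrum R)), p.length = n →
      ∃ q : LTSeries (PrimeSpectrum S), q.length = n ∧ PrimeSpectrum.comap f q.last = p.last := by
    intro n
    induction n with
    | zero =>
      intro p _
      obtain ⟨Q, hQ, hQp⟩ := Ideal.exists_ideal_over_prime_of_isIntegral_of_isDomain
        (S := S) p.last.asIdeal (by
          have : RingHom.ker (algebraMap R S) = ⊥ := (RingHom.injective_iff_ker_eq_bot f).1 hinj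
          rw [this]; exact bot_le)
      exact ⟨RelSeries.singleton _ ⟨Q, hQ⟩, rfl, PrimeSpectrum.ext hQp⟩
    | succ n ih =>
      intro p hp
      obtain ⟨q, hq, hql⟩ := ih p.eraseLast (by simp [hp])
      have hlt : p.eraseLast.last < p.last := p.eraseLast_last_rel_last (by omega)
      obtain ⟨Q, hQq, hQ, hQp⟩ := Ideal.exists_ideal_over_prime_of_isIntegral_of_isPrime
        (S := S) p.last.asIdeal q.last.asIdeal (by
          have : (PrimeSpectrum.comap f q.last).asIdeal ≤ p.last.asIdeal := by
            rw [hql]; exact hlt.le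
          exact this)
      have h2 : PrimeSpectrum.comap f ⟨Q, hQ⟩ = p.last := PrimeSpectrum.ext hQp
      have hlt2 : q.last < ⟨Q, hQ⟩ := by
        refine lt_of_le_of_ne hQq ?_
        intro h
        rw [h, h2] at hql
        exact hlt.ne hql.symm
      refine ⟨q.snoc ⟨Q, hQ⟩ hlt2, by simp [hq], ?_⟩
      rw [RelSeries.last_snoc, h2]
  refine iSup_le fun p => ?_
  obtain ⟨q, hq, -⟩ := key p.length p rfl
  rw [← hq]
  exact Order.LTSeries.length_le_krullDim q

theorem ringKrullDim_mvPolynomial_field (k : Type*) [Field k] (n : ℕ) :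
    ringKrullDim (MvPolynomial (Fin n) k) = n := by
  simp

theorem ringKrullDim_quotient_inf_le {R : Type*} [CommRing R] (I J : Ideal R) (d : WithBot ℕ∞)
    (hI : ringKrullDim (R ⧸ I) ≤ d) (hJ : ringKrullDim (R ⧸ J) ≤ d) :
    ringKrullDim (R ⧸ I ⊓ J) ≤ d := by
  rw [ringKrullDim_quotient] at *
  refine iSup_le fun p => ?_
  have hhead : I ⊓ J ≤ p.head.1.asIdeal := p.head.2
  have key : ∀ K : Ideal R, K ≤ p.head.1.asIdeal →
      Order.krullDim (PrimeSpectrum.zeroLocus (K : Set R)) ≤ d → (p.length : WithBot ℕ∞) ≤ d := by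
    intro K hK hd
    refine le_trans ?_ hd
    have hp : ∀ i, K ≤ (p i).1.asIdeal := fun i => hK.trans (p.head_le i)
    let q : LTSeries (PrimeSpectrum.zeroLocus (K : Set R)) :=
      ⟨p.length, fun i => ⟨(p i).1, hp i⟩, fun i => p.step i⟩
    exact Order.LTSeries.length_le_krullDim q
  rcases (p.head.1.isPrime.inf_le).1 hhead with h | h
  · exact key I h hI
  · exact key J h hJ

/-- If a domain that is finitely generated over a field contains a polynomial ring in `n`
variables then its dimension is at least `n`. -/
theorem natCast_le_ringKrullDim_of_injective {k : Type} [Field k] {A : Type} [CommRing A]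
    [Algebra k A] [Algebra.FiniteType k A] {τ : Type} [Fintype τ]
    (φ : MvPolynomial τ k →ₐ[k] A) (hφ : Function.Injective φ) :
    (Fintype.card τ : WithBot ℕ∞) ≤ ringKrullDim A := by
  have hbot : (⊥ : Ideal (MvPolynomial τ k)) ∈
      (Ideal.comap (φ : MvPolynomial τ k →+* A) ⊥).minimalPrimes := by
    have : Ideal.comap (φ : MvPolynomial τ k →+* A) ⊥ = ⊥ :=
      (RingHom.injective_iff_ker_eq_bot (φ : MvPolynomial τ k →+* A)).1 hφ
    rw [this]
    change (⊥ : Ideal (MvPolynomial τ k)) ∈ minimalPrimes (MvPolynomial τ k)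
    rw [IsDomain.minimalPrimes_eq_singleton_bot]
    rfl
  obtain ⟨Q, hQ, hQ2⟩ := Ideal.exists_minimalPrimes_comap_eq _ _ hbot
  have hQp : Q.IsPrime := hQ.1.1
  refine le_trans ?_ (ringKrullDim_quotient_le Q)
  obtain ⟨s, g, hg, hgi⟩ := exists_integral_inj_algHom_of_fg k (A ⧸ Q)
  have h1 := ringKrullDim_le_of_isIntegral_of_injective (g : MvPolynomial (Fin s) k →+* A ⧸ Q) hgi hg
  rw [ringKrullDim_mvPolynomial_field] at h1
  refine le_trans ?_ h1
  have h2 : Function.Injective ((Ideal.Quotient.mkₐ k Q).comp φ) := by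
    rw [injective_iff_map_eq_zero]
    intro p hp
    have : φ p ∈ Q := Ideal.Quotient.eq_zero_iff_mem.1 hp
    have h3 : p ∈ Ideal.comap (φ : MvPolynomial τ k →+* A) Q := this
    rw [hQ2] at h3
    simpa using h3
  have h3 := trdeg_le_of_injective _ h2
  have h4 : Algebra.trdeg k (A ⧸ Q) = s := by
    algebraize [(g : MvPolynomial (Fin s) k →+* A ⧸ Q)]
    have : IsScalarTower k (MvPolynomial (Fin s) k) (A ⧸ Q) := .of_algebraMap_eq' (by
      ext x; exact (g.commutes x).symm)
    have : Algebra.IsIntegral (MvPolynomial (Fin s) k) (A ⧸ Q) := ⟨hgi⟩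
    have : FaithfulSMul (MvPolynomial (Fin s) k) (A ⧸ Q) := by
      rw [faithfulSMul_iff_algebraMap_injective]
      exact hg
    rw [← trdeg_add_eq k (MvPolynomial (Fin s) k) (A := A ⧸ Q), trdeg_eq_zero (R := MvPolynomial (Fin s) k) (A := A ⧸ Q), MvPolynomial.trdeg_of_isDomain]
    simp
  rw [h4, MvPolynomial.trdeg_of_isDomain] at h3
  have : Fintype.card τ ≤ s := by simpa using h3
  exact_mod_cast this

/-! ### Bounding the codimension of a locus -/

theorem aeval_eq_eval_apply {R σ : Type*} [CommSemiring R] (x : σ → R) (p : MvPolynomial σ R) :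
    aeval x p = eval x p := by
  rw [← coe_aeval_eq_eval]; rfl

section Codim

variable {V : Type} [AddCommGroup V] [Module ℂ V]

/-- The Zariski closure of `S` has codimension at least `c`. -/
def HasCodimGE (S : Set V) (c : ℕ) : Prop :=
  zdim (zclosure S) + (c : ℕ∞) ≤ ((Module.finrank ℂ V : ℕ∞) : WithBot ℕ∞)

/-- A quotient of a polynomial ring that is integral over a polynomial ring in at most `d`
variables. -/
def IsIntegralOverVars {J : Type} (I : Ideal (MvPolynomial J ℂ)) (d : ℕ) : Prop :=
  ∃ e ≤ d, ∃ g : MvPolynomial (Fin e) ℂ →ₐ[ℂ] MvPolynomial J ℂ ⧸ I, g.IsIntegral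

theorem exists_linearEquiv_sum [FiniteDimensional ℂ V] {J : Type} [Fintype J]
    (ρ : V →ₗ[ℂ] (J → ℂ)) (hρ : Function.Surjective ρ) :
    ∃ (k : ℕ) (e : V ≃ₗ[ℂ] (Fin k ⊕ J → ℂ)), k + Fintype.card J = Module.finrank ℂ V ∧
      ∀ v j, e v (Sum.inr j) = ρ v j := by
  obtain ⟨s, hs⟩ := ρ.exists_rightInverse_of_surjective (LinearMap.range_eq_top.2 hρ)
  have hs' : ∀ x, ρ (s x) = x := fun x => LinearMap.congr_fun hs x
  let b := Module.finBasis ℂ (LinearMap.ker ρ)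
  let g : V →ₗ[ℂ] LinearMap.ker ρ :=
    LinearMap.codRestrict _ (LinearMap.id - s ∘ₗ ρ) (fun v => by simp [hs'])
  let φ : V →ₗ[ℂ] (Fin (Module.finrank ℂ (LinearMap.ker ρ)) ⊕ J → ℂ) :=
    LinearMap.pi (Sum.elim
      (fun i => (LinearMap.proj i) ∘ₗ b.equivFun.toLinearMap ∘ₗ g)
      (fun j => (LinearMap.proj j) ∘ₗ ρ))
  have hinj : Function.Injective φ := by
    rw [← LinearMap.ker_eq_bot, LinearMap.ker_eq_bot']
    intro v hv
    have h1 : ρ v = 0 := by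
      ext j
      exact congrFun hv (Sum.inr j)
    have h2 : g v = 0 := by
      apply b.equivFun.injective
      ext i
      rw [map_zero]
      exact congrFun hv (Sum.inl i)
    have h3 : v - s (ρ v) = 0 := congrArg Subtype.val h2
    simpa [h1] using h3
  have hdim : Module.finrank ℂ V =
      Module.finrank ℂ (Fin (Module.finrank ℂ (LinearMap.ker ρ)) ⊕ J → ℂ) := by
    rw [← ρ.finrank_range_add_finrank_ker, LinearMap.range_eq_top.2 hρ, finrank_top]
    simp [add_comm]
  refine ⟨_, LinearEquiv.ofInjectiveOfFinrankEq φ hinj hdim, ?_, fun v j => ?_⟩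
  · rw [hdim]; simp
  · rfl

theorem hasCodimGE_of_preimage [FiniteDimensional ℂ V] {J : Type} [Fintype J]
    (ρ : V →ₗ[ℂ] (J → ℂ)) (hρ : Function.Surjective ρ) {S : Set V} {T : Set (J → ℂ)}
    (hST : ∀ v ∈ S, ρ v ∈ T) {d c : ℕ} (hT : IsIntegralOverVars (vanishingIdeal ℂ T) d)
    (hdc : d + c ≤ Fintype.card J) : HasCodimGE S c := by
  obtain ⟨k, e, hk, he⟩ := exists_linearEquiv_sum ρ hρ
  obtain ⟨r, hr, g, hg⟩ := hT
  rw [HasCodimGE, zdim_zclosure_eq e S]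
  have hle : vanishingIdeal ℂ T ≤ Ideal.comap (rename (Sum.inr : J → Fin k ⊕ J) :
      MvPolynomial J ℂ →ₐ[ℂ] MvPolynomial (Fin k ⊕ J) ℂ) (coordIdeal e S) := by
    intro p hp
    rw [Ideal.mem_comap, mem_coordIdeal]
    intro v hv
    rw [eval_rename]
    have h1 := (mem_vanishingIdeal_iff.1 hp) _ (hST v hv)
    rw [aeval_eq_eval_apply] at h1
    rwa [show e v ∘ Sum.inr = ρ v from _root_.funext (he v)]
  let h : MvPolynomial J ℂ ⧸ vanishingIdeal ℂ T →ₐ[ℂ]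
      MvPolynomial (Fin k ⊕ J) ℂ ⧸ coordIdeal e S := Ideal.quotientMapₐ _ _ hle
  let G : MvPolynomial (Fin k ⊕ Fin r) ℂ →ₐ[ℂ] MvPolynomial (Fin k ⊕ J) ℂ ⧸ coordIdeal e S :=
    aeval (Sum.elim (fun i => Ideal.Quotient.mkₐ ℂ _ (X (Sum.inl i))) (fun i => h (g (X i))))
  have hGg : ∀ p, G (rename Sum.inr p) = h (g p) := by
    intro p
    have : (G.comp (rename Sum.inr)) = h.comp g := by
      ext i
      simp [G]
    exact AlgHom.congr_fun this p
  have h_integral : (G : MvPolynomial (Fin k ⊕ Fin r) ℂ →+*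
      MvPolynomial (Fin k ⊕ J) ℂ ⧸ coordIdeal e S).IsIntegral := by
    intro y
    obtain ⟨p, rfl⟩ := Ideal.Quotient.mk_surjective y
    induction p using MvPolynomial.induction_on with
    | C a =>
      have : G (C a) = Ideal.Quotient.mk (coordIdeal e S) (C a) := G.commutes a
      rw [← this]
      exact RingHom.isIntegralElem_map _
    | add p q hp hq =>
      rw [map_add]; exact RingHom.IsIntegralElem.add _ hp hq
    | mul_X p i hp =>
      rw [map_mul]
      refine RingHom.IsIntegralElem.mul _ hp ?_
      rcases i with i | j
      · have : G (X (Sum.inl i)) = Ideal.Quotient.mk (coordIdeal e S) (X (Sum.inl i)) := by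
          simp [G]
        rw [← this]
        exact RingHom.isIntegralElem_map _
      · obtain ⟨P, hP, hP2⟩ := hg (Ideal.Quotient.mk _ (X j))
        refine ⟨P.map (rename (Sum.inr : Fin r → Fin k ⊕ Fin r)).toRingHom, hP.map _, ?_⟩
        have hcomp : (G : MvPolynomial (Fin k ⊕ Fin r) ℂ →+* _).comp
            (rename (Sum.inr : Fin r → Fin k ⊕ Fin r)).toRingHom =
              (h : MvPolynomial J ℂ ⧸ vanishingIdeal ℂ T →+* MvPolynomial (Fin k ⊕ J) ℂ ⧸ coordIdeal e S).comp
                (g : MvPolynomial (Fin r) ℂ →+* MvPolynomial J ℂ ⧸ vanishingIdeal ℂ T) :=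
          RingHom.ext fun p => hGg p
        have hx : Ideal.Quotient.mk (coordIdeal e S) (X (Sum.inr j)) =
            h (Ideal.Quotient.mk _ (X j)) := by
          simp [h]
        rw [Polynomial.eval₂_map, hcomp, hx]
        have := Polynomial.hom_eval₂ P (g : MvPolynomial (Fin r) ℂ →+* MvPolynomial J ℂ ⧸ vanishingIdeal ℂ T)
          (h : MvPolynomial J ℂ ⧸ vanishingIdeal ℂ T →+* MvPolynomial (Fin k ⊕ J) ℂ ⧸ coordIdeal e S)
          (Ideal.Quotient.mk _ (X j))
        refine this.symm.trans ?_
        erw [hP2, map_zero]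
  have h1 := ringKrullDim_le_of_isIntegral _ h_integral
  have h2 : ringKrullDim (MvPolynomial (Fin k ⊕ Fin r) ℂ) = ((k + r : ℕ) : WithBot ℕ∞) := by
    rw [← ringKrullDim_mvPolynomial_field ℂ (k + r)]
    exact ringKrullDim_eq_of_ringEquiv (renameEquiv ℂ finSumFinEquiv).toRingEquiv
  rw [h2] at h1
  rw [← hk]
  refine (add_le_add_left h1 _).trans ?_
  have : (k + r) + c ≤ k + Fintype.card J := by omega
  exact_mod_cast this

theorem zdim_zclosure_mono [FiniteDimensional ℂ V] {S T : Set V} (hST : S ⊆ T) :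
    zdim (zclosure S) ≤ zdim (zclosure T) := by
  let e := (Module.finBasis ℂ V).equivFun
  rw [zdim_zclosure_eq e, zdim_zclosure_eq e]
  exact ringKrullDim_le_of_surjective (Ideal.Quotient.factor (coordIdeal_anti e hST))
    (Ideal.Quotient.factor_surjective _)

theorem HasCodimGE.mono [FiniteDimensional ℂ V] {S T : Set V} {c : ℕ} (hT : HasCodimGE T c)
    (hST : S ⊆ T) : HasCodimGE S c :=
  (add_le_add_left (zdim_zclosure_mono hST) _).trans hT

theorem withBot_add_natCast_le_iff (a : WithBot ℕ∞) (c N : ℕ) (hc : c ≤ N) :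
    a + ((c : ℕ∞) : WithBot ℕ∞) ≤ ((N : ℕ∞) : WithBot ℕ∞) ↔ a ≤ ((N - c : ℕ) : WithBot ℕ∞) := by
  induction a with
  | bot => simp
  | coe a =>
    induction a with
    | top => 
      constructor
      · intro h
        exfalso
        have h2 : (⊤ : ℕ∞) + (c : ℕ∞) ≤ (N : ℕ∞) := by exact_mod_cast h
        simp at h2
      · intro h
        exfalso
        have h2 : (⊤ : ℕ∞) ≤ ((N - c : ℕ) : ℕ∞) := WithBot.coe_le_coe.1 h
        exact absurd h2 (by simp)
    | coe a => 
      have : a + c ≤ N ↔ a ≤ N - c := by omega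
      have h1 : ((a : ℕ∞) : WithBot ℕ∞) + ((c : ℕ∞) : WithBot ℕ∞) ≤ ((N : ℕ∞) : WithBot ℕ∞) ↔
          a + c ≤ N := by exact_mod_cast Iff.rfl
      have h2 : ((a : ℕ∞) : WithBot ℕ∞) ≤ ((N - c : ℕ) : WithBot ℕ∞) ↔ a ≤ N - c := by
        rw [← Nat.cast_le (α := ℕ∞)]
        exact WithBot.coe_le_coe
      rw [h1, h2, this]

theorem HasCodimGE.union [FiniteDimensional ℂ V] {S T : Set V} {c : ℕ}
    (hc : c ≤ Module.finrank ℂ V) (hS : HasCodimGE S c)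
    (hT : HasCodimGE T c) : HasCodimGE (S ∪ T) c := by
  let e := (Module.finBasis ℂ V).equivFun
  rw [HasCodimGE, zdim_zclosure_eq e, withBot_add_natCast_le_iff _ _ _ hc] at *
  have : coordIdeal e (S ∪ T) = coordIdeal e S ⊓ coordIdeal e T := by
    ext p
    simp only [Submodule.mem_inf, mem_coordIdeal, Set.mem_union, or_imp, forall_and]
  rw [this]
  exact ringKrullDim_quotient_inf_le _ _ _ hS hT

theorem hasCodimGE_empty [FiniteDimensional ℂ V] (c : ℕ) : HasCodimGE (∅ : Set V) c := by
  let e := (Module.finBasis ℂ V).equivFun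
  rw [HasCodimGE, zdim_zclosure_eq e]
  have : coordIdeal e (∅ : Set V) = ⊤ := by
    ext p; simp [mem_coordIdeal]
  rw [this]
  have : Subsingleton (MvPolynomial (Fin (Module.finrank ℂ V)) ℂ ⧸
    (⊤ : Ideal (MvPolynomial (Fin (Module.finrank ℂ V)) ℂ))) := Ideal.Quotient.subsingleton_iff.2 rfl
  simp [ringKrullDim_eq_bot_of_subsingleton]

theorem HasCodimGE.iUnion [FiniteDimensional ℂ V] {ι : Type*} [Finite ι] {S : ι → Set V} {c : ℕ}
    (hc : c ≤ Module.finrank ℂ V) (h : ∀ i, HasCodimGE (S i) c) : HasCodimGE (⋃ i, S i) c := by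
  have : ∀ F : Set ι, F.Finite → HasCodimGE (⋃ i ∈ F, S i) c := by
    intro F hF
    induction F, hF using Set.Finite.induction_on with
    | empty => simpa using hasCodimGE_empty c
    | insert _ _ ih =>
      rw [Set.biUnion_insert]
      exact (h _).union hc ih
  simpa using this Set.univ Set.finite_univ

/-- The image of a polynomial map from an affine space of dimension `|P|`. -/
theorem isIntegralOverVars_range {P J : Type} [Fintype P] [Finite J]
    (Φ : J → MvPolynomial P ℂ) :
    IsIntegralOverVars (vanishingIdeal ℂ (Set.range fun v : P → ℂ => fun j => eval v (Φ j)))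
      (Fintype.card P) := by
  set I := vanishingIdeal ℂ (Set.range fun v : P → ℂ => fun j => eval v (Φ j)) with hI
  obtain ⟨φ, hφ⟩ : ∃ φ : MvPolynomial J ℂ →ₐ[ℂ] MvPolynomial P ℂ, φ = aeval Φ := ⟨_, rfl⟩
  have hker : ∀ p, p ∈ I ↔ φ p = 0 := by
    intro p
    rw [hI, mem_vanishingIdeal_iff, hφ]
    constructor
    · intro h
      apply MvPolynomial.funext
      intro v
      have := h _ ⟨v, rfl⟩
      rw [aeval_eq_eval_apply] at this
      rw [map_zero, ← this]
      exact eval_bind₁ _ _ _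
    · rintro h _ ⟨v, rfl⟩
      rw [aeval_eq_eval_apply]
      refine (eval_bind₁ v Φ p).symm.trans ?_
      change eval v (aeval Φ p) = 0
      rw [h, map_zero]
  obtain ⟨ψ, hψ⟩ : ∃ ψ : MvPolynomial J ℂ ⧸ I →ₐ[ℂ] MvPolynomial P ℂ,
      ∀ p, ψ (Ideal.Quotient.mk I p) = φ p :=
    ⟨Ideal.Quotient.liftₐ I φ (fun p hp => (hker p).1 hp), fun p => rfl⟩
  have hψi : Function.Injective ψ := by
    rw [injective_iff_map_eq_zero]
    intro y
    obtain ⟨p, rfl⟩ := Ideal.Quotient.mk_surjective y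
    intro h
    rw [hψ, ← hker] at h
    exact Ideal.Quotient.eq_zero_iff_mem.2 h
  have : Nontrivial (MvPolynomial J ℂ ⧸ I) := ψ.toRingHom.domain_nontrivial
  obtain ⟨s, g, hg, hgi⟩ := exists_integral_inj_algHom_of_fg ℂ (MvPolynomial J ℂ ⧸ I)
  refine ⟨s, ?_, g, hgi⟩
  have h3 := trdeg_le_of_injective (ψ.comp g) (hψi.comp hg)
  rw [MvPolynomial.trdeg_of_isDomain, MvPolynomial.trdeg_of_isDomain] at h3
  simpa using h3

theorem hasCodimGE_of_param [FiniteDimensional ℂ V] {J P : Type} [Fintype J] [Fintype P]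
    (ρ : V →ₗ[ℂ] (J → ℂ)) (hρ : Function.Surjective ρ) {S : Set V}
    (Φ : J → MvPolynomial P ℂ) (hS : ∀ v ∈ S, ∃ w : P → ℂ, ∀ j, ρ v j = eval w (Φ j)) {c : ℕ}
    (hc : Fintype.card P + c ≤ Fintype.card J) : HasCodimGE S c := by
  refine hasCodimGE_of_preimage ρ hρ (fun v hv => ?_) (isIntegralOverVars_range Φ) hc
  obtain ⟨w, hw⟩ := hS v hv
  exact ⟨w, by ext j; exact (hw j).symm⟩

/-- A lower bound on the dimension: `S` dominates an affine space of dimension `|J|`. -/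
theorem natCast_card_le_zdim_zclosure [FiniteDimensional ℂ V] {J : Type} [Fintype J]
    (π : V →ₗ[ℂ] (J → ℂ)) (S : Set V) (δ : MvPolynomial J ℂ) (hδ : δ ≠ 0)
    (h : ∀ w : J → ℂ, eval w δ ≠ 0 → ∃ s ∈ S, π s = w) :
    ((Fintype.card J : ℕ∞) : WithBot ℕ∞) ≤ zdim (zclosure S) := by
  let b := Module.finBasis ℂ V
  let e := b.equivFun
  rw [zdim_zclosure_eq e]
  let φ₀ : MvPolynomial J ℂ →ₐ[ℂ] MvPolynomial (Fin (Module.finrank ℂ V)) ℂ :=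
    aeval fun j => ∑ i, C (π (b i) j) * X i
  have hφ₀ : ∀ p v, eval (e v) (φ₀ p) = eval (π v) p := by
    intro p v
    refine (eval_bind₁ (e v) _ p).trans ?_
    congr 2
    ext j
    conv_rhs => rw [← b.sum_equivFun v, map_sum]
    simp [e, mul_comm]
  refine natCast_le_ringKrullDim_of_injective
    ((Ideal.Quotient.mkₐ ℂ (coordIdeal e S)).comp φ₀) ?_
  rw [injective_iff_map_eq_zero]
  intro p hp
  have hp' : φ₀ p ∈ coordIdeal e S := Ideal.Quotient.eq_zero_iff_mem.1 hp
  rw [mem_coordIdeal] at hp'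
  have : p * δ = 0 := by
    apply MvPolynomial.funext
    intro w
    rw [map_mul, map_zero]
    by_cases hw : eval w δ = 0
    · rw [hw, mul_zero]
    · obtain ⟨s, hs, rfl⟩ := h w hw
      rw [← hφ₀, hp' s hs, zero_mul]
  exact (mul_eq_zero.1 this).resolve_right hδ

end Codim

/-! ### Algebraic independence over the rationals inside the complex numbers -/

/-- The algebraic matroid of `ℂ` over `ℚ`. -/
abbrev algMat : Matroid ℂ := AlgebraicIndependent.matroid ℚ ℂ

/-- The relative algebraic closure in `ℂ` of the field generated by `S`. -/
def acl (S : Set ℂ) : IntermediateField ℚ ℂ :=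
  (algebraicClosure (IntermediateField.adjoin ℚ S) ℂ).restrictScalars ℚ

theorem mem_acl_iff_isAlgebraic {S : Set ℂ} {x : ℂ} :
    x ∈ acl S ↔ IsAlgebraic (IntermediateField.adjoin ℚ S) x := mem_algebraicClosure_iff

theorem mem_acl_iff {S : Set ℂ} {x : ℂ} : x ∈ acl S ↔ x ∈ algMat.closure S := by
  rw [AlgebraicIndependent.matroid_closure_eq, mem_acl_iff_isAlgebraic, SetLike.mem_coe,
    Subalgebra.mem_algebraicClosure]
  open IntermediateField.algebraAdjoinAdjoin in
  exact (IsFractionRing.isAlgebraic_iff (Algebra.adjoin ℚ S) (IntermediateField.adjoin ℚ S) ℂ).symm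

theorem coe_acl (S : Set ℂ) : (acl S : Set ℂ) = algMat.closure S := by
  ext x; exact mem_acl_iff

instance (S : Set ℂ) : IsAlgClosed (acl S) :=
  (inferInstance : IsAlgClosure (IntermediateField.adjoin ℚ S)
    (algebraicClosure (IntermediateField.adjoin ℚ S) ℂ)).isAlgClosed

theorem subset_acl (S : Set ℂ) : S ⊆ acl S := by
  rw [coe_acl]
  exact algMat.subset_closure S (Set.subset_univ _)

theorem acl_mono {S T : Set ℂ} (h : S ⊆ T) : acl S ≤ acl T := by
  intro x
  rw [mem_acl_iff, mem_acl_iff]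
  exact fun hx => algMat.closure_subset_closure h hx

theorem acl_le_iff {S T : Set ℂ} : acl S ≤ acl T ↔ S ⊆ acl T := by
  constructor
  · intro h
    exact (subset_acl S).trans h
  · intro h x
    rw [coe_acl] at h
    rw [mem_acl_iff, mem_acl_iff]
    exact fun hx => algMat.closure_subset_closure_of_subset_closure h hx

theorem eRk_le_of_subset_acl {S T : Set ℂ} (h : S ⊆ acl T) : algMat.eRk S ≤ algMat.eRk T := by
  rw [← algMat.eRk_closure_eq T, ← coe_acl]
  exact algMat.eRk_mono h

theorem acl_countable {S : Set ℂ} (hS : S.Countable) : (acl S : Set ℂ).Countable := by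
  have h1 : Countable (IntermediateField.adjoin ℚ S) := by
    have := IntermediateField.cardinalMk_adjoin_le ℚ S
    rw [← Cardinal.mk_le_aleph0_iff]
    refine this.trans ?_
    have h2 : Cardinal.mk S ≤ Cardinal.aleph0 := Cardinal.le_aleph0_iff_set_countable.2 hS
    simp [h2]
  have := Algebraic.countable (IntermediateField.adjoin ℚ S) ℂ
  exact this.mono fun x hx => mem_acl_iff_isAlgebraic.1 hx

theorem exists_algebraicIndependent {R : Type} [CommRing R] [Nontrivial R] [Algebra R ℂ]
    [FaithfulSMul R ℂ] [Countable R] (s : ℕ) : ∃ y : Fin s → ℂ, AlgebraicIndependent R y := by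
  obtain ⟨t, ht⟩ := exists_isTranscendenceBasis R ℂ
  have h := IsAlgClosed.cardinal_eq_cardinal_transcendence_basis_of_aleph0_lt' _ ht
    (Cardinal.mk_le_aleph0_iff.2 inferInstance) (by rw [Cardinal.mk_complex]; exact Cardinal.aleph0_lt_continuum)
  have hinf : Infinite t := by
    rw [Cardinal.infinite_iff, ← h, Cardinal.mk_complex]
    exact Cardinal.aleph0_le_continuum
  exact ⟨_, ht.1.comp _ ((Fin.valEmbedding.trans (Infinite.natEmbedding t)).injective)⟩

theorem eRk_range_of_algebraicIndependent {s : ℕ} {y : Fin s → ℂ} (hy : AlgebraicIndependent ℚ y) :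
    algMat.eRk (Set.range y) = s := by
  have h1 : algMat.Indep (Set.range y) := hy.to_subtype_range
  rw [h1.eRk_eq_encard, ← Set.image_univ, hy.injective.encard_image, Set.encard_univ]
  simp

theorem aeval_mem_acl {J : Type*} (a : J → ℂ) (p : MvPolynomial J ℚ) :
    aeval a p ∈ acl (Set.range a) := by
  induction p using MvPolynomial.induction_on with
  | C r => rw [aeval_C]; exact (acl _).algebraMap_mem r
  | add p q hp hq => rw [map_add]; exact add_mem hp hq
  | mul_X p i hp => 
    rw [map_mul, aeval_X]
    exact mul_mem hp (subset_acl _ ⟨i, rfl⟩)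

theorem exists_ringHom_extension_of_isDomain {R B K : Type*} [CommRing R] [IsDomain R] [CommRing B]
    [IsDomain B] [Field K] [IsAlgClosed K] (f : R →+* B) (hf : f.IsIntegral)
    (hinj : Function.Injective f) (h : R →+* K) (hh : Function.Injective h) :
    ∃ ψ : B →+* K, ψ.comp f = h := by
  let := f.toAlgebra
  let := h.toAlgebra
  have : Algebra.IsIntegral R B := ⟨hf⟩
  have : Module.IsTorsionFree R B := Module.isTorsionFree_iff_algebraMap_injective.2 hinj
  have : Module.IsTorsionFree R K := Module.isTorsionFree_iff_algebraMap_injective.2 hh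
  let ψ : B →ₐ[R] K := IsAlgClosed.lift
  exact ⟨ψ.toRingHom, RingHom.ext fun r => ψ.commutes r⟩

theorem exists_ringHom_extension {R B K : Type*} [CommRing R] [IsDomain R] [CommRing B]
    [Field K] [IsAlgClosed K] (f : R →+* B) (hf : f.IsIntegral)
    (hinj : Function.Injective f) (h : R →+* K) (hh : Function.Injective h) :
    ∃ ψ : B →+* K, ψ.comp f = h := by
  let := f.toAlgebra
  have : Algebra.IsIntegral R B := ⟨hf⟩
  obtain ⟨Q, -, hQ, hQp⟩ := Ideal.exists_ideal_over_prime_of_isIntegral (R := R) (S := B) ⊥ ⊥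
    ((RingHom.injective_iff_ker_eq_bot f).1 hinj).le
  obtain ⟨ψ, hψ⟩ := exists_ringHom_extension_of_isDomain ((Ideal.Quotient.mk Q).comp f)
    (hf.trans _ _ (RingHom.isIntegral_of_surjective _ Ideal.Quotient.mk_surjective)) (by
      rw [injective_iff_map_eq_zero]
      intro p hp
      have h1 : f p ∈ Q := Ideal.Quotient.eq_zero_iff_mem.1 hp
      have h2 : p ∈ Ideal.comap (algebraMap R B) Q := h1
      rw [hQp] at h2
      simpa using h2) h hh
  exact ⟨ψ.comp (Ideal.Quotient.mk Q), hψ⟩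

/-- A complex affine variety defined over `ℚ` all of whose points have transcendence degree at
most `d` is finite over an affine space of dimension at most `d`. -/
theorem isIntegralOverVars_of_eRk_le {J : Type} [Finite J] (T : Set (J → ℂ)) (d : ℕ)
    (h : ∀ a ∈ zeroLocus ℂ (vanishingIdeal ℚ T), algMat.eRk (Set.range a) ≤ d) :
    IsIntegralOverVars (vanishingIdeal ℂ T) d := by
  rcases T.eq_empty_or_nonempty with rfl | ⟨t, ht⟩
  · refine ⟨0, Nat.zero_le _, aeval finZeroElim, ?_⟩
    rw [vanishingIdeal_empty]
    have : Subsingleton (MvPolynomial J ℂ ⧸ (⊤ : Ideal (MvPolynomial J ℂ))) :=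
      Ideal.Quotient.subsingleton_iff.2 rfl
    intro x
    exact ⟨1, Polynomial.monic_one, Subsingleton.elim _ _⟩
  set I := vanishingIdeal ℚ T with hI
  have hIne : I ≠ ⊤ := by
    intro hI1
    have : (1 : MvPolynomial J ℚ) ∈ I := hI1 ▸ Submodule.mem_top
    have := (mem_vanishingIdeal_iff.1 this) t ht
    simp at this
  have : Nontrivial (MvPolynomial J ℚ ⧸ I) := Ideal.Quotient.nontrivial_iff.2 hIne
  obtain ⟨s, g, hg, hgi⟩ := exists_integral_inj_algHom_of_fg ℚ (MvPolynomial J ℚ ⧸ I)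
  have hs : s ≤ d := by
    obtain ⟨y, hy⟩ := exists_algebraicIndependent (R := ℚ) s
    obtain ⟨ψ, hψ⟩ := exists_ringHom_extension (g : MvPolynomial (Fin s) ℚ →+* MvPolynomial J ℚ ⧸ I)
      hgi hg (aeval y : MvPolynomial (Fin s) ℚ →ₐ[ℚ] ℂ).toRingHom hy
    let θ : MvPolynomial J ℚ →+* ℂ := ψ.comp (Ideal.Quotient.mk I)
    let a : J → ℂ := fun j => θ (X j)
    have hθ : ∀ p, aeval a p = θ p := by
      intro p
      have : (aeval a : MvPolynomial J ℚ →ₐ[ℚ] ℂ).toRingHom = θ := by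
        apply MvPolynomial.ringHom_ext
        · intro r
          exact (RingHom.congr_fun (Subsingleton.elim (RingHom.comp (aeval a : MvPolynomial J ℚ →ₐ[ℚ] ℂ).toRingHom C) (θ.comp C)) r)
        · intro i; simp [a]
      exact RingHom.congr_fun this p
    have ha : a ∈ zeroLocus ℂ I := by
      intro p hp
      rw [hθ]
      simp only [θ, RingHom.comp_apply, Ideal.Quotient.eq_zero_iff_mem.2 hp, map_zero]
    have hy2 : Set.range y ⊆ acl (Set.range a) := by
      rintro _ ⟨i, rfl⟩
      obtain ⟨p, hp⟩ := Ideal.Quotient.mk_surjective (g (X i))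
      have : y i = aeval a p := by
        rw [hθ]
        have h1 := RingHom.congr_fun hψ (X i)
        change y i = ψ (Ideal.Quotient.mk I p)
        rw [hp]
        refine Eq.trans ?_ h1.symm
        exact (aeval_X (R := ℚ) y i).symm
      rw [this]
      exact aeval_mem_acl a p
    have h1 := (eRk_le_of_subset_acl hy2).trans (h a ha)
    rw [eRk_range_of_algebraicIndependent hy] at h1
    exact_mod_cast h1
  have hle : I ≤ Ideal.comap (MvPolynomial.map (algebraMap ℚ ℂ)) (vanishingIdeal ℂ T) := by
    intro p hp
    rw [Ideal.mem_comap, mem_vanishingIdeal_iff]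
    intro x hx
    have := (mem_vanishingIdeal_iff.1 hp) x hx
    rwa [aeval_map_algebraMap]
  obtain ⟨β, hβ⟩ : ∃ β : MvPolynomial J ℚ ⧸ I →+* MvPolynomial J ℂ ⧸ vanishingIdeal ℂ T,
      ∀ p, β (Ideal.Quotient.mk I p) = Ideal.Quotient.mk _ (MvPolynomial.map (algebraMap ℚ ℂ) p) :=
    ⟨Ideal.quotientMap _ _ hle, fun p => rfl⟩
  let G : MvPolynomial (Fin s) ℂ →ₐ[ℂ] MvPolynomial J ℂ ⧸ vanishingIdeal ℂ T :=
    aeval fun i => β (g (X i))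
  have hGg : ((G : MvPolynomial (Fin s) ℂ →+* MvPolynomial J ℂ ⧸ vanishingIdeal ℂ T).comp
      (MvPolynomial.map (algebraMap ℚ ℂ))) =
        β.comp (g : MvPolynomial (Fin s) ℚ →+* MvPolynomial J ℚ ⧸ I) := by
    apply MvPolynomial.ringHom_ext
    · intro r
      exact (RingHom.congr_fun (Subsingleton.elim (RingHom.comp (((G : MvPolynomial (Fin s) ℂ →+* MvPolynomial J ℂ ⧸ vanishingIdeal ℂ T).comp
      (MvPolynomial.map (algebraMap ℚ ℂ)))) C) (RingHom.comp (β.comp (g : MvPolynomial (Fin s) ℚ →+* MvPolynomial J ℚ ⧸ I)) C)) r)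
    · intro i
      simp [G]
  refine ⟨s, hs, G, ?_⟩
  intro y
  obtain ⟨p, rfl⟩ := Ideal.Quotient.mk_surjective y
  induction p using MvPolynomial.induction_on with
  | C a =>
    have : G (C a) = Ideal.Quotient.mk _ (C a) := G.commutes a
    rw [← this]
    exact RingHom.isIntegralElem_map _
  | add p q hp hq =>
    rw [map_add]; exact RingHom.IsIntegralElem.add _ hp hq
  | mul_X p j hp =>
    rw [map_mul]
    refine RingHom.IsIntegralElem.mul _ hp ?_
    obtain ⟨P, hP, hP2⟩ := hgi (Ideal.Quotient.mk _ (X j))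
    refine ⟨P.map (MvPolynomial.map (algebraMap ℚ ℂ)), hP.map _, ?_⟩
    have hx : Ideal.Quotient.mk (vanishingIdeal ℂ T) (X j) = β (Ideal.Quotient.mk _ (X j)) := by
      rw [hβ, map_X]
    rw [Polynomial.eval₂_map]
    erw [hGg]
    rw [hx]
    have := Polynomial.hom_eval₂ P (g : MvPolynomial (Fin s) ℚ →+* MvPolynomial J ℚ ⧸ I) β
      (Ideal.Quotient.mk _ (X j))
    refine this.symm.trans ?_
    erw [hP2, map_zero]

section LinearSubstitution

theorem exists_eq_single_of_degree_eq_one {σ : Type*} {m : σ →₀ ℕ} (hm : m.degree = 1) :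
    ∃ i, m = Finsupp.single i 1 := by
  classical
  have hm0 : m ≠ 0 := by rintro rfl; simp at hm
  obtain ⟨i, hi⟩ := Finsupp.ne_iff.1 hm0
  rw [Finsupp.coe_zero, Pi.zero_apply] at hi
  have hle : Finsupp.single i 1 ≤ m := by
    rw [Finsupp.single_le_iff]; omega
  refine ⟨i, ?_⟩
  have h := tsub_add_cancel_of_le hle
  have h2 := congrArg Finsupp.degree h
  rw [map_add, Finsupp.degree_single, hm] at h2
  have h3 : (m - Finsupp.single i 1).degree = 0 := by omega
  rw [Finsupp.degree_eq_zero_iff] at h3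
  rw [h3, zero_add] at h
  exact h.symm

theorem MvPolynomial.IsHomogeneous.eq_sum_of_one {σ : Type*} [Fintype σ]
    {f : MvPolynomial σ ℂ} (hf : f.IsHomogeneous 1) :
    f = ∑ i, C (coeff (Finsupp.single i 1) f) * X i := by
  classical
  ext m
  rw [coeff_sum]
  simp only [coeff_C_mul, coeff_X, mul_ite, mul_one, mul_zero]
  by_cases hm : m.degree = 1
  · obtain ⟨j, rfl⟩ := exists_eq_single_of_degree_eq_one hm
    rw [Finset.sum_eq_single j]
    · simp
    · intro b _ hb
      rw [if_neg]
      intro h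
      exact hb (Finsupp.single_left_injective one_ne_zero h)
    · simp
  · rw [hf.coeff_eq_zero hm, eq_comm]
    refine Finset.sum_eq_zero fun i _ => if_neg ?_
    rintro rfl
    exact hm (by simp)

/-- An algebra homomorphism of polynomial rings is linear when it sends variables to
linear forms. -/
def IsLinearSubst {σ τ : Type*} (φ : MvPolynomial σ ℂ →ₐ[ℂ] MvPolynomial τ ℂ) : Prop :=
  ∀ i, (φ (X i)).IsHomogeneous 1

namespace IsLinearSubst

variable {σ τ υ : Type*} {φ : MvPolynomial σ ℂ →ₐ[ℂ] MvPolynomial τ ℂ}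
  {ψ : MvPolynomial τ ℂ →ₐ[ℂ] MvPolynomial υ ℂ}

theorem isHomogeneous (hφ : IsLinearSubst φ) {f : MvPolynomial σ ℂ} {d : ℕ}
    (hf : f.IsHomogeneous d) : (φ f).IsHomogeneous d := by
  have h := hf.aeval (fun i => φ (X i)) (n := 1) hφ
  have hu : aeval (fun i => φ (X i)) = φ := (aeval_unique φ).symm
  rw [hu] at h
  simpa using h

theorem comp (hψ : IsLinearSubst ψ) (hφ : IsLinearSubst φ) : IsLinearSubst (ψ.comp φ) :=
  fun i => hψ.isHomogeneous (hφ i)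

theorem homogeneousComponent (hφ : IsLinearSubst φ) (d : ℕ) (f : MvPolynomial σ ℂ) :
    MvPolynomial.homogeneousComponent d (φ f) = φ (MvPolynomial.homogeneousComponent d f) := by
  classical
  conv_lhs => rw [← sum_homogeneousComponent f, map_sum, map_sum]
  rw [Finset.sum_congr rfl fun i _ => homogeneousComponent_of_mem
    ((mem_homogeneousSubmodule i _).2
      (hφ.isHomogeneous (homogeneousComponent_isHomogeneous i f)))]
  by_cases hd : d ∈ Finset.range (f.totalDegree + 1)
  · rw [Finset.sum_eq_single d]
    · simp
    · intro b _ hb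
      exact if_neg (Ne.symm hb)
    · intro h; exact absurd hd h
  · rw [homogeneousComponent_eq_zero d f (by simpa using hd), map_zero]
    refine Finset.sum_eq_zero fun i hi => if_neg ?_
    rintro rfl; exact hd hi

theorem totalDegree_le (hφ : IsLinearSubst φ) (f : MvPolynomial σ ℂ) :
    (φ f).totalDegree ≤ f.totalDegree := by
  conv_lhs => rw [← sum_homogeneousComponent f, map_sum]
  refine (totalDegree_finsetSum _ _).trans (Finset.sup_le fun i hi => ?_)
  refine (hφ.isHomogeneous (homogeneousComponent_isHomogeneous i f)).totalDegree_le.trans ?_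
  simpa [Nat.lt_succ_iff] using hi

theorem eval_apply (φ : MvPolynomial σ ℂ →ₐ[ℂ] MvPolynomial τ ℂ) (z : τ → ℂ)
    (f : MvPolynomial σ ℂ) : eval z (φ f) = eval (fun i => eval z (φ (X i))) f := by
  have : ((aeval z : MvPolynomial τ ℂ →ₐ[ℂ] ℂ).comp φ) = aeval (fun i => eval z (φ (X i))) := by
    ext i
    simp [aeval_eq_eval_apply]
  simpa [aeval_eq_eval_apply] using congrArg (fun g => g f) this

end IsLinearSubst

theorem isHomogeneous_sum_C_mul_X {σ : Type*} [Fintype σ] (c : σ → ℂ) :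
    (∑ j, C (c j) * X j : MvPolynomial σ ℂ).IsHomogeneous 1 :=
  IsHomogeneous.sum _ _ _ fun j _ => by
    have := (isHomogeneous_C σ (c j)).mul (isHomogeneous_X ℂ j)
    rwa [zero_add] at this

/-- The polynomial functions on a hyperplane form a polynomial ring in one variable less. -/
theorem exists_hyperplane_restriction {k : ℕ} {l : MvPolynomial (Fin (k + 1)) ℂ}
    (hl : l.IsHomogeneous 1) (hl0 : l ≠ 0) :
    ∃ (ι : MvPolynomial (Fin (k + 1)) ℂ →ₐ[ℂ] MvPolynomial (Fin k) ℂ)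
      (σ : MvPolynomial (Fin k) ℂ →ₐ[ℂ] MvPolynomial (Fin (k + 1)) ℂ),
      IsLinearSubst ι ∧ IsLinearSubst σ ∧ (∀ f, ι (σ f) = f) ∧
        RingHom.ker ι = Ideal.span {l} := by
  classical
  set c : Fin (k + 1) → ℂ := fun i => coeff (Finsupp.single i 1) l with hc
  have hlc : l = ∑ i, C (c i) * X i := hl.eq_sum_of_one
  obtain ⟨p, hp⟩ : ∃ i, c i ≠ 0 := by
    by_contra! h
    exact hl0 (by rw [hlc]; simp [h])
  obtain ⟨ι, hιp, hιs⟩ : ∃ ι : MvPolynomial (Fin (k + 1)) ℂ →ₐ[ℂ] MvPolynomial (Fin k) ℂ,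
      ι (X p) = -∑ j, C ((c p)⁻¹ * c (p.succAbove j)) * X j ∧
      ∀ j, ι (X (p.succAbove j)) = X j :=
    ⟨aeval (p.insertNth (-∑ j, C ((c p)⁻¹ * c (p.succAbove j)) * X j :
      MvPolynomial (Fin k) ℂ) X), by simp, by simp⟩
  obtain ⟨σ, hσX⟩ : ∃ σ : MvPolynomial (Fin k) ℂ →ₐ[ℂ] MvPolynomial (Fin (k + 1)) ℂ,
      ∀ j, σ (X j) = X (p.succAbove j) := ⟨aeval fun j => X (p.succAbove j), by simp⟩
  have hισ : ∀ f, ι (σ f) = f := by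
    intro f
    have : ι.comp σ = AlgHom.id ℂ _ := by
      ext j; simp [hσX, hιs]
    exact congrArg (fun g => g f) this
  refine ⟨ι, σ, ?_, ?_, hισ, ?_⟩
  · intro i
    obtain rfl | ⟨j, rfl⟩ := Fin.eq_self_or_eq_succAbove p i
    · rw [hιp]
      exact (isHomogeneous_sum_C_mul_X _).neg
    · rw [hιs]; exact isHomogeneous_X ℂ j
  · intro i
    rw [hσX]; exact isHomogeneous_X ℂ _
  · apply le_antisymm
    · intro f hf
      have hC : ∀ a : ℂ, σ (C a) = C a := fun a => by
        rw [← algebraMap_eq, AlgHom.commutes, algebraMap_eq]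
      have hιC : ∀ a : ℂ, ι (C a) = C a := fun a => by
        rw [← algebraMap_eq, AlgHom.commutes, algebraMap_eq]
      have hX : ∀ i, X i - σ (ι (X i)) ∈ Ideal.span {l} := by
        intro i
        obtain h | ⟨j, rfl⟩ := Fin.eq_self_or_eq_succAbove p i
        · rw [h, hιp, Ideal.mem_span_singleton]
          refine ⟨C ((c p)⁻¹), ?_⟩
          have h1 : (C (c p)⁻¹ : MvPolynomial (Fin (k + 1)) ℂ) * C (c p) = 1 := by
            rw [← C_mul, inv_mul_cancel₀ hp, C_1]
          rw [hlc, Fin.sum_univ_succAbove _ p, mul_comm _ (C _), mul_add, ← mul_assoc, h1, one_mul,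
            map_neg, map_sum, sub_neg_eq_add, Finset.mul_sum]
          congr 1
          refine Finset.sum_congr rfl fun j _ => ?_
          rw [map_mul, hσX, hC, C_mul, mul_assoc]
        · rw [hιs, hσX, sub_self]; exact zero_mem _
      have key : ∀ f, f - σ (ι f) ∈ Ideal.span {l} := by
        intro f
        induction f using MvPolynomial.induction_on with
        | C a => rw [hιC, hC, sub_self]; exact zero_mem _
        | add f g hf hg =>
          rw [map_add, map_add, add_sub_add_comm]
          exact add_mem hf hg
        | mul_X f i hf =>
          rw [map_mul, map_mul]
          have := add_mem (Ideal.mul_mem_right (X i) _ hf) (Ideal.mul_mem_left _ (σ (ι f)) (hX i))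
          convert this using 1
          ring
      have := key f
      rwa [(RingHom.mem_ker).1 hf, map_zero, sub_zero] at this
    · rw [Ideal.span_singleton_le_iff_mem, RingHom.mem_ker]
      conv_lhs => rw [hlc, Fin.sum_univ_succAbove _ p, map_add, map_mul, map_sum, hιp]
      have : ∀ (a : ℂ), ι (C a) = C a := fun a => by
        rw [← algebraMap_eq, AlgHom.commutes, algebraMap_eq]
      simp only [map_mul, hιs, this, mul_neg, Finset.mul_sum]
      rw [neg_add_eq_sub, sub_eq_zero]
      refine Finset.sum_congr rfl fun j _ => ?_
      rw [← mul_assoc, ← C_mul, ← C_mul, ← mul_assoc, mul_inv_cancel₀ hp, one_mul]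

end LinearSubstitution

section CoefficientMap

/-- The exponents of the monomials of degree between `a` and `b`. -/
def monos (σ : Type*) [Finite σ] (a b : ℕ) : Finset (σ →₀ ℕ) :=
  (Finsupp.finite_of_degree_le (σ := σ) b).toFinset.filter fun m => a ≤ m.degree

theorem mem_monos {σ : Type*} [Finite σ] {a b : ℕ} {m : σ →₀ ℕ} :
    m ∈ monos σ a b ↔ a ≤ m.degree ∧ m.degree ≤ b := by
  simp [monos, and_comm]

theorem card_monos_self (k d : ℕ) (hk : k ≠ 0) : (monos (Fin k) d d).card = (k + d - 1).choose d := by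
  classical
  have h := Finset.card_finsuppAntidiag_nat_eq_choose (s := (Finset.univ : Finset (Fin k))) d
  rw [Finset.card_univ, Fintype.card_fin] at h
  rw [← h]
  congr 1
  ext m
  rw [mem_monos, Finset.mem_finsuppAntidiag, Finsupp.degree_eq_sum]
  constructor
  · rintro ⟨h1, h2⟩; exact ⟨le_antisymm h2 h1, Finset.subset_univ _⟩
  · rintro ⟨h1, -⟩; exact ⟨h1.ge, h1.le⟩

/-- The polynomial with prescribed coefficients at a finite set of exponents. -/
def polyOf {σ : Type*} {R : Type*} [CommSemiring R] (s : Finset (σ →₀ ℕ)) (w : s → R) :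
    MvPolynomial σ R :=
  ∑ j : s, monomial (j : σ →₀ ℕ) (w j)

theorem coeff_polyOf {σ R : Type*} [CommSemiring R] (s : Finset (σ →₀ ℕ)) (w : s → R) (j : s) :
    coeff (j : σ →₀ ℕ) (polyOf s w) = w j := by
  classical
  rw [polyOf, coeff_sum, Finset.sum_eq_single j]
  · simp
  · intro b _ hb
    rw [coeff_monomial, if_neg fun h => hb (Subtype.ext h)]
  · simp

theorem coeff_polyOf_of_notMem {σ R : Type*} [CommSemiring R] (s : Finset (σ →₀ ℕ)) (w : s → R)
    {m : σ →₀ ℕ} (hm : m ∉ s) : coeff m (polyOf s w) = 0 := by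
  classical
  rw [polyOf, coeff_sum]
  refine Finset.sum_eq_zero fun j _ => ?_
  rw [coeff_monomial, if_neg]
  rintro rfl; exact hm j.2

theorem polyOf_coeff {σ R : Type*} [CommSemiring R] {s : Finset (σ →₀ ℕ)} {f : MvPolynomial σ R}
    (hf : ∀ m, m ∉ s → coeff m f = 0) : polyOf s (fun j => coeff j f) = f := by
  ext m
  by_cases hm : m ∈ s
  · exact coeff_polyOf s _ ⟨m, hm⟩
  · rw [coeff_polyOf_of_notMem s _ hm, hf m hm]

theorem mem_Psing {M : ℕ} {f : MvPolynomial (Fin M) ℂ} :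
    f ∈ Psing M ↔ ∀ m, m ∉ monos (Fin M) 2 M → coeff m f = 0 := by
  classical
  simp only [Psing, Submodule.mem_inf, mem_restrictTotalDegree, LinearMap.mem_ker, mem_monos]
  constructor
  · rintro ⟨h1, h2, h3⟩ m hm
    by_contra hne
    have hle : m.degree ≤ M := (le_totalDegree (mem_support_iff.2 hne)).trans h1
    have hlt : m.degree < 2 := by
      by_contra h
      exact hm ⟨by omega, hle⟩
    have hh : coeff m (homogeneousComponent m.degree f) = coeff m f := by
      rw [coeff_homogeneousComponent, if_pos rfl]
    interval_cases m.degree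
    · rw [h2, coeff_zero] at hh; exact hne hh.symm
    · rw [h3, coeff_zero] at hh; exact hne hh.symm
  · intro h
    refine ⟨?_, ?_, ?_⟩
    · refine Finset.sup_le fun m hm => ?_
      change m.degree ≤ M
      by_contra hlt
      exact (mem_support_iff.1 hm) (h m fun h' => hlt h'.2)
    · ext m
      rw [coeff_homogeneousComponent, coeff_zero]
      split_ifs with hm
      · exact h m (by omega)
      · rfl
    · ext m
      rw [coeff_homogeneousComponent, coeff_zero]
      split_ifs with hm
      · exact h m (by omega)
      · rfl

theorem IsLinearSubst.coeff_eq_zero {σ τ : Type*} [Finite σ] [Finite τ]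
    {φ : MvPolynomial σ ℂ →ₐ[ℂ] MvPolynomial τ ℂ} (hφ : IsLinearSubst φ) {a b : ℕ}
    {f : MvPolynomial σ ℂ} (hf : ∀ m, m ∉ monos σ a b → coeff m f = 0) {m : τ →₀ ℕ}
    (hm : m ∉ monos τ a b) : coeff m (φ f) = 0 := by
  classical
  have : coeff m (φ f) = coeff m (MvPolynomial.homogeneousComponent m.degree (φ f)) := by
    rw [coeff_homogeneousComponent, if_pos rfl]
  rw [this, hφ.homogeneousComponent]
  have h0 : MvPolynomial.homogeneousComponent m.degree f = 0 := by
    ext m'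
    rw [coeff_homogeneousComponent, coeff_zero]
    split_ifs with h
    · refine hf m' ?_
      rw [mem_monos] at hm ⊢
      rwa [h]
    · rfl
  rw [h0, map_zero, coeff_zero]

/-- `ι` and `σ` exhibit a polynomial ring as the quotient by the linear form `l`. -/
structure IsHyperplaneRestriction {k : ℕ} (l : MvPolynomial (Fin (k + 1)) ℂ)
    (ι : MvPolynomial (Fin (k + 1)) ℂ →ₐ[ℂ] MvPolynomial (Fin k) ℂ)
    (σ : MvPolynomial (Fin k) ℂ →ₐ[ℂ] MvPolynomial (Fin (k + 1)) ℂ) : Prop where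
  linear : IsLinearSubst ι
  linear_section : IsLinearSubst σ
  right_inv : ∀ f, ι (σ f) = f
  ker_eq : RingHom.ker ι = Ideal.span {l}

theorem exists_isHyperplaneRestriction {k : ℕ} {l : MvPolynomial (Fin (k + 1)) ℂ}
    (hl : l.IsHomogeneous 1) (hl0 : l ≠ 0) : ∃ ι σ, IsHyperplaneRestriction l ι σ := by
  obtain ⟨ι, σ, h1, h2, h3, h4⟩ := exists_hyperplane_restriction hl hl0
  exact ⟨ι, σ, h1, h2, h3, h4⟩

instance (M : ℕ) : FiniteDimensional ℂ (Psing M) := by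
  have : Module.Finite ℂ (restrictTotalDegree (Fin M) ℂ M) := by infer_instance
  exact Submodule.finiteDimensional_of_le (inf_le_left : Psing M ≤ _)

/-- The coefficients of the restriction to a hyperplane. -/
def coeffMap {n : ℕ} (ι : MvPolynomial (Fin (n + 1)) ℂ →ₐ[ℂ] MvPolynomial (Fin n) ℂ) :
    Psing (n + 1) →ₗ[ℂ] (monos (Fin n) 2 (n + 1) → ℂ) :=
  LinearMap.pi fun j => (lcoeff ℂ (j : Fin n →₀ ℕ)).comp (ι.toLinearMap.comp (Psing (n + 1)).subtype)

@[simp] theorem coeffMap_apply {n : ℕ}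
    (ι : MvPolynomial (Fin (n + 1)) ℂ →ₐ[ℂ] MvPolynomial (Fin n) ℂ) (f : Psing (n + 1))
    (j : monos (Fin n) 2 (n + 1)) :
    coeffMap ι f j = coeff (j : Fin n →₀ ℕ) (ι (f : MvPolynomial (Fin (n + 1)) ℂ)) := rfl

theorem coeffMap_surjective {n : ℕ} {l : MvPolynomial (Fin (n + 1)) ℂ}
    {ι : MvPolynomial (Fin (n + 1)) ℂ →ₐ[ℂ] MvPolynomial (Fin n) ℂ}
    {σ : MvPolynomial (Fin n) ℂ →ₐ[ℂ] MvPolynomial (Fin (n + 1)) ℂ}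
    (h : IsHyperplaneRestriction l ι σ) : Function.Surjective (coeffMap ι) := by
  intro w
  refine ⟨⟨σ (polyOf _ w), mem_Psing.2 fun m hm => ?_⟩, ?_⟩
  · exact h.linear_section.coeff_eq_zero (fun m hm => coeff_polyOf_of_notMem _ w hm) hm
  · ext j
    simp only [coeffMap_apply]
    rw [h.right_inv, coeff_polyOf]

theorem coeff_restriction_eq_zero {n : ℕ}
    {ι : MvPolynomial (Fin (n + 1)) ℂ →ₐ[ℂ] MvPolynomial (Fin n) ℂ} (hι : IsLinearSubst ι)
    (f : Psing (n + 1)) {m : Fin n →₀ ℕ} (hm : m ∉ monos (Fin n) 2 (n + 1)) :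
    coeff m (ι (f : MvPolynomial (Fin (n + 1)) ℂ)) = 0 :=
  hι.coeff_eq_zero (mem_Psing.1 f.2) hm

end CoefficientMap

section QuadraticForms

/-- The substitution dual to a linear map. -/
def substOf {κ l : Type*} [Fintype κ] [DecidableEq κ] (L : (κ → ℂ) →ₗ[ℂ] (l → ℂ)) :
    MvPolynomial l ℂ →ₐ[ℂ] MvPolynomial κ ℂ :=
  aeval fun i => ∑ j, C (L (Pi.single j 1) i) * X j

theorem isLinearSubst_substOf {κ l : Type*} [Fintype κ] [DecidableEq κ]
    (L : (κ → ℂ) →ₗ[ℂ] (l → ℂ)) : IsLinearSubst (substOf L) := by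
  intro i
  rw [substOf, aeval_X]
  exact isHomogeneous_sum_C_mul_X _

theorem eval_substOf {κ l : Type*} [Fintype κ] [DecidableEq κ] (L : (κ → ℂ) →ₗ[ℂ] (l → ℂ))
    (z : κ → ℂ) (f : MvPolynomial l ℂ) : eval z (substOf L f) = eval (L z) f := by
  rw [IsLinearSubst.eval_apply]
  congr 2
  funext i
  rw [substOf, aeval_X, map_sum]
  have hz : z = ∑ j, z j • (Pi.single j 1 : κ → ℂ) := pi_eq_sum_univ' z
  conv_rhs => rw [hz]
  rw [map_sum, Finset.sum_apply]
  refine Finset.sum_congr rfl fun j _ => ?_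
  simp [mul_comm]

theorem exists_eq_single_add_single_of_degree_eq_two {σ : Type*} {m : σ →₀ ℕ} (hm : m.degree = 2) :
    ∃ i j, m = Finsupp.single i 1 + Finsupp.single j 1 := by
  classical
  have hm0 : m ≠ 0 := by rintro rfl; simp at hm
  obtain ⟨i, hi⟩ := Finsupp.ne_iff.1 hm0
  rw [Finsupp.coe_zero, Pi.zero_apply] at hi
  have hle : Finsupp.single i 1 ≤ m := by
    rw [Finsupp.single_le_iff]; omega
  have h := tsub_add_cancel_of_le hle
  have h2 := congrArg Finsupp.degree h
  rw [map_add, Finsupp.degree_single, hm] at h2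
  obtain ⟨j, hj⟩ := exists_eq_single_of_degree_eq_one
    (show (m - Finsupp.single i 1).degree = 1 by omega)
  exact ⟨j, i, by rw [← hj, h]⟩

theorem exists_quadraticForm {k : ℕ} {Q : MvPolynomial (Fin k) ℂ} (hQ : Q.IsHomogeneous 2) :
    ∃ q : QuadraticForm ℂ (Fin k → ℂ), ∀ z, q z = eval z Q := by
  classical
  have : ∀ m : Q.support, ∃ q : QuadraticForm ℂ (Fin k → ℂ), ∀ z,
      q z = eval z (monomial (m : Fin k →₀ ℕ) (coeff m Q)) := by
    rintro ⟨m, hm⟩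
    have hd : m.degree = 2 := by
      by_contra h
      exact mem_support_iff.1 hm (hQ.coeff_eq_zero h)
    obtain ⟨i, j, h⟩ := exists_eq_single_add_single_of_degree_eq_two hd
    refine ⟨coeff m Q • QuadraticMap.linMulLin (LinearMap.proj i) (LinearMap.proj j), fun z => ?_⟩
    have : (m.prod fun n e => z n ^ e) = z i * z j := by
      rw [h, Finsupp.prod_add_index' (by simp) (by intros; rw [pow_add])]
      simp
    rw [eval_monomial]
    simp [this]
  choose q hq using this
  refine ⟨∑ m : Q.support, q m, fun z => ?_⟩
  conv_rhs => rw [Q.as_sum, map_sum, ← Finset.sum_coe_sort]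
  rw [sum_apply]
  exact Finset.sum_congr rfl fun m _ => hq m z

theorem exists_diagonalisation {k : ℕ} {Q : MvPolynomial (Fin k) ℂ} (hQ : Q.IsHomogeneous 2) :
    ∃ (τ τ' : MvPolynomial (Fin k) ℂ →ₐ[ℂ] MvPolynomial (Fin k) ℂ) (w : Fin k → ℂ),
      IsLinearSubst τ ∧ IsLinearSubst τ' ∧ (∀ f, τ (τ' f) = f) ∧ (∀ f, τ' (τ f) = f) ∧
      τ Q = ∑ i, C (w i) * X i ^ 2 := by
  obtain ⟨q, hq⟩ := exists_quadraticForm hQ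
  have h := QuadraticForm.equivalent_weightedSumSquares q
  rw [Module.finrank_fin_fun] at h
  obtain ⟨w, ⟨e⟩⟩ := h
  have he : ∀ z, QuadraticMap.weightedSumSquares ℂ w (e z) = q z := e.map_app
  refine ⟨substOf e.toLinearEquiv.symm.toLinearMap, substOf e.toLinearEquiv.toLinearMap, w,
    isLinearSubst_substOf _, isLinearSubst_substOf _, fun f => ?_, fun f => ?_, ?_⟩
  · refine MvPolynomial.funext fun z => ?_
    rw [eval_substOf, eval_substOf]; simp
  · refine MvPolynomial.funext fun z => ?_
    rw [eval_substOf, eval_substOf]; simp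
  · refine MvPolynomial.funext fun z => ?_
    rw [eval_substOf, ← hq, ← he]
    have : e (e.toLinearEquiv.symm z) = z := e.toLinearEquiv.apply_symm_apply z
    simp [this, QuadraticMap.weightedSumSquares_apply, pow_two]

/-- `Q` is a sum of `r` squares of linear forms. -/
def RankLE {k : ℕ} (Q : MvPolynomial (Fin k) ℂ) (r : ℕ) : Prop :=
  ∃ l : Fin r → MvPolynomial (Fin k) ℂ, (∀ i, (l i).IsHomogeneous 1) ∧ Q = ∑ i, l i ^ 2

theorem RankLE.map {k k' r : ℕ} {Q : MvPolynomial (Fin k) ℂ} (h : RankLE Q r)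
    {φ : MvPolynomial (Fin k) ℂ →ₐ[ℂ] MvPolynomial (Fin k') ℂ} (hφ : IsLinearSubst φ) :
    RankLE (φ Q) r := by
  obtain ⟨l, hl, rfl⟩ := h
  exact ⟨fun i => φ (l i), fun i => hφ.isHomogeneous (hl i), by simp⟩

theorem RankLE.add {k r s : ℕ} {P Q : MvPolynomial (Fin k) ℂ} (hP : RankLE P r) (hQ : RankLE Q s) :
    RankLE (P + Q) (r + s) := by
  obtain ⟨l, hl, rfl⟩ := hP
  obtain ⟨l', hl', rfl⟩ := hQ
  refine ⟨Fin.append l l', fun i => ?_, by simp [Fin.sum_univ_add]⟩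
  induction i using Fin.addCases with
  | left i => simpa using hl i
  | right i => simpa using hl' i

theorem rankLE_zero {k : ℕ} (r : ℕ) : RankLE (0 : MvPolynomial (Fin k) ℂ) r :=
  ⟨fun _ => 0, fun _ => isHomogeneous_zero _ _ _, by simp⟩

theorem RankLE.mono {k r s : ℕ} {Q : MvPolynomial (Fin k) ℂ} (hQ : RankLE Q r) (h : r ≤ s) :
    RankLE Q s := by
  have := hQ.add (rankLE_zero (s - r))
  rwa [add_zero, Nat.add_sub_cancel' h] at this

theorem rankLE_one_smul_sq {k : ℕ} {l : MvPolynomial (Fin k) ℂ} (hl : l.IsHomogeneous 1) (a : ℂ) :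
    RankLE (C a * l ^ 2) 1 := by
  obtain ⟨b, hb⟩ := IsAlgClosed.exists_pow_nat_eq a (n := 2) (by norm_num)
  refine ⟨fun _ => C b * l, fun _ => ?_, ?_⟩
  · have := (isHomogeneous_C (Fin k) b).mul hl
    rwa [zero_add] at this
  · simp [mul_pow, ← C_pow, hb]

theorem rankLE_sum_smul_sq {k : ℕ} {ι : Type*} (s : Finset ι) (l : ι → MvPolynomial (Fin k) ℂ)
    (hl : ∀ i, (l i).IsHomogeneous 1) (a : ι → ℂ) :
    RankLE (∑ i ∈ s, C (a i) * l i ^ 2) s.card := by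
  classical
  induction s using Finset.induction_on with
  | empty => exact rankLE_zero 0
  | insert i s hi ih =>
    rw [Finset.sum_insert hi, Finset.card_insert_of_notMem hi, add_comm s.card]
    exact (rankLE_one_smul_sq (hl i) (a i)).add ih

theorem rankLE_two_mul {k : ℕ} {l l' : MvPolynomial (Fin k) ℂ} (hl : l.IsHomogeneous 1)
    (hl' : l'.IsHomogeneous 1) : RankLE (l * l') 2 := by
  have h1 := rankLE_one_smul_sq (hl.add hl') (1 / 4)
  have h2 := rankLE_one_smul_sq (hl.sub hl') (-1 / 4)
  have := h1.add h2
  convert this using 1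
  have h4 : (4 : MvPolynomial (Fin k) ℂ) = C 4 := (map_ofNat C 4).symm
  have e1 : (C (1/4 : ℂ) : MvPolynomial (Fin k) ℂ) * 4 = 1 := by
    rw [h4, ← C_mul]; norm_num
  have e2 : (C (-1/4 : ℂ) : MvPolynomial (Fin k) ℂ) = - C (1/4) := by
    rw [← C_neg]; norm_num
  rw [e2]
  linear_combination (-(l * l')) * e1

theorem MvPolynomial.IsHomogeneous.rankLE {k : ℕ} {Q : MvPolynomial (Fin k) ℂ}
    (hQ : Q.IsHomogeneous 2) : RankLE Q k := by
  obtain ⟨τ, τ', w, h1, h2, h3, h4, h5⟩ := exists_diagonalisation hQ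
  have := (rankLE_sum_smul_sq Finset.univ (fun i : Fin k => X i) (fun i => isHomogeneous_X ℂ i)
    w).map h2
  rw [← h5, h4] at this
  simpa using this

theorem RankLE.isHomogeneous {k r : ℕ} {Q : MvPolynomial (Fin k) ℂ} (h : RankLE Q r) :
    Q.IsHomogeneous 2 := by
  obtain ⟨l, hl, rfl⟩ := h
  exact IsHomogeneous.sum _ _ _ fun i _ => (hl i).pow 2

end QuadraticForms

section LowRank

variable {n : ℕ} {q₁ : MvPolynomial (Fin (n + 1)) ℂ}
  {ι : MvPolynomial (Fin (n + 1)) ℂ →ₐ[ℂ] MvPolynomial (Fin n) ℂ}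
  {σ : MvPolynomial (Fin n) ℂ →ₐ[ℂ] MvPolynomial (Fin (n + 1)) ℂ}

theorem IsHyperplaneRestriction.apply_self (h : IsHyperplaneRestriction q₁ ι σ) : ι q₁ = 0 := by
  have : q₁ ∈ RingHom.ker ι := by rw [h.ker_eq]; exact Ideal.mem_span_singleton_self _
  exact this

theorem IsHyperplaneRestriction.eval_section_apply (h : IsHyperplaneRestriction q₁ ι σ)
    {z : Fin (n + 1) → ℂ} (hz : eval z q₁ = 0) (f : MvPolynomial (Fin (n + 1)) ℂ) :
    eval z (σ (ι f)) = eval z f := by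
  have : f - σ (ι f) ∈ RingHom.ker ι := by
    rw [RingHom.mem_ker, map_sub, h.right_inv, sub_self]
  rw [h.ker_eq, Ideal.mem_span_singleton] at this
  obtain ⟨g, hg⟩ := this
  have := congrArg (eval z) hg
  rw [map_sub, map_mul, hz, zero_mul, sub_eq_zero] at this
  exact this.symm

theorem IsHyperplaneRestriction.eval_point_eq_zero (h : IsHyperplaneRestriction q₁ ι σ)
    (z : Fin n → ℂ) : eval (fun i => eval z (ι (X i))) q₁ = 0 := by
  rw [← IsLinearSubst.eval_apply, h.apply_self, map_zero]

theorem rankLE_of_eval (h : IsHyperplaneRestriction q₁ ι σ) {f : MvPolynomial (Fin (n + 1)) ℂ}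
    {r : ℕ} {l : Fin r → ((Fin (n + 1) → ℂ) →ₗ[ℂ] ℂ)}
    (hl : ∀ z ∈ {z : Fin (n + 1) → ℂ | eval z q₁ = 0}, eval z f = ∑ i, l i z ^ 2) :
    RankLE (ι f) r := by
  refine ⟨fun i => ι (substOf (LinearMap.pi fun _ : Fin 1 => l i) (X 0)), fun i =>
    h.linear.isHomogeneous (isLinearSubst_substOf _ 0), ?_⟩
  refine MvPolynomial.funext fun z => ?_
  rw [IsLinearSubst.eval_apply, hl _ (h.eval_point_eq_zero z), map_sum]
  refine Finset.sum_congr rfl fun i _ => ?_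
  rw [map_pow, IsLinearSubst.eval_apply, eval_substOf]
  simp

theorem RankLE.exists_eval (h : IsHyperplaneRestriction q₁ ι σ) {f : MvPolynomial (Fin (n + 1)) ℂ}
    {r : ℕ} (hr : RankLE (ι f) r) :
    ∃ l : Fin r → ((Fin (n + 1) → ℂ) →ₗ[ℂ] ℂ), 
      ∀ z ∈ {z : Fin (n + 1) → ℂ | eval z q₁ = 0}, eval z f = ∑ i, l i z ^ 2 := by
  obtain ⟨l, hl, hf⟩ := hr
  refine ⟨fun i => ∑ j, coeff (Finsupp.single j 1) (σ (l i)) • LinearMap.proj j, fun z hz => ?_⟩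
  rw [← h.eval_section_apply hz, hf, map_sum, map_sum]
  refine Finset.sum_congr rfl fun i _ => ?_
  rw [map_pow, map_pow]
  congr 1
  rw [(h.linear_section.isHomogeneous (hl i)).eq_sum_of_one]
  simp

theorem rankOn_le_iff (h : IsHyperplaneRestriction q₁ ι σ) {f : MvPolynomial (Fin (n + 1)) ℂ}
    (hf : f.IsHomogeneous 2) (r : ℕ) :
    rankOn f {z : Fin (n + 1) → ℂ | eval z q₁ = 0} ≤ r ↔ RankLE (ι f) r := by
  constructor
  · intro hr
    have hne : {r : ℕ | ∃ l : Fin r → ((Fin (n + 1) → ℂ) →ₗ[ℂ] ℂ),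
        ∀ z ∈ {z : Fin (n + 1) → ℂ | eval z q₁ = 0}, eval z f = ∑ i, l i z ^ 2}.Nonempty :=
      ⟨n, (h.linear.isHomogeneous hf).rankLE.exists_eval h⟩
    obtain ⟨l, hl⟩ := Nat.sInf_mem hne
    exact (rankLE_of_eval h hl).mono hr
  · intro hr
    exact Nat.sInf_le (hr.exists_eval h)

theorem hasCodimGE_of_generic (h : IsHyperplaneRestriction q₁ ι σ) {P : Type} [Fintype P]
    (G : MvPolynomial (Fin n) (MvPolynomial P ℂ)) {S : Set (Psing (n + 1))} {c : ℕ}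
    (hS : ∀ f ∈ S, ∃ w : P → ℂ, ∀ j ∈ monos (Fin n) 2 (n + 1),
      coeff j (ι (f : MvPolynomial (Fin (n + 1)) ℂ)) = coeff j (map (eval w) G))
    (hc : Fintype.card P + c ≤ (monos (Fin n) 2 (n + 1)).card) : HasCodimGE S c := by
  refine hasCodimGE_of_param (coeffMap ι) (coeffMap_surjective h) (fun j => coeff j G)
    (fun f hf => ?_) (by rwa [Fintype.card_coe])
  obtain ⟨w, hw⟩ := hS f hf
  refine ⟨w, fun j => ?_⟩
  rw [coeffMap_apply, hw _ j.2, coeff_map]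

theorem map_polyOf {σ R S : Type*} [CommSemiring R] [CommSemiring S] (φ : R →+* S)
    (s : Finset (σ →₀ ℕ)) (w : s → R) : map φ (polyOf s w) = polyOf s fun j => φ (w j) := by
  simp [polyOf, map_monomial]

theorem card_monos_add {τ : Type*} [Finite τ] {a b c : ℕ} (hab : a ≤ b) (hbc : b ≤ c) :
    (monos τ a c).card = (monos τ a b).card + (monos τ (b + 1) c).card := by
  classical
  rw [← Finset.card_union_of_disjoint]
  · congr 1
    ext m
    simp only [Finset.mem_union, mem_monos]
    omega
  · rw [Finset.disjoint_left]
    intro m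
    simp only [mem_monos]
    omega

theorem exists_spanning_columns {K ι : Type*} [Field K] [Fintype ι] {r : ℕ} (v : ι → Fin r → K)
    (hr : r ≤ Fintype.card ι) :
    ∃ s : Finset ι, s.card = r ∧ ∃ B : s → ι → K, (∀ j, v j = ∑ a, B a j • v a) ∧
      (∀ a, B a a = 1) ∧ ∀ a b : s, a ≠ b → B a b = 0 := by
  classical
  obtain ⟨b, -, -, hb3⟩ := exists_linearIndepOn_extension (K := K) (v := v)
    (s := (∅ : Set ι)) (t := Set.univ) (linearIndepOn_empty _ _) (Set.empty_subset _)
  obtain ⟨b', rfl⟩ := b.toFinite.exists_finset_coe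
  have hcard : b'.card ≤ r := by
    have h := hb3.2.fintype_card_le_finrank
    simpa using h
  obtain ⟨s, hs1, hs2⟩ := Finset.exists_superset_card_eq hcard hr
  have hspan : ∀ j, ∃ c : s → K, v j = ∑ a, c a • v a := by
    intro j
    have h1 : v j ∈ Submodule.span K (Set.range fun a : s => v a) := by
      refine Submodule.span_mono ?_ (hb3.1 (Set.mem_image_of_mem v (Set.mem_univ j)))
      rintro _ ⟨a, ha, rfl⟩
      exact ⟨⟨a, hs1 ha⟩, rfl⟩
    obtain ⟨c, hc⟩ := (Submodule.mem_span_range_iff_exists_fun K).1 h1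
    exact ⟨c, hc.symm⟩
  choose c hc using hspan
  refine ⟨s, hs2, fun a j => if hj : j ∈ s then (if a = ⟨j, hj⟩ then 1 else 0) else c j a,
    fun j => ?_, fun a => by simp, fun a b hab => by simp [hab]⟩
  by_cases hj : j ∈ s
  · simp [hj]
  · simpa [hj] using hc j

theorem MvPolynomial.IsHomogeneous.polyOf_monos {τ : Type*} [Finite τ] {d : ℕ}
    {Q : MvPolynomial τ ℂ} (hQ : Q.IsHomogeneous d) :
    polyOf (monos τ d d) (fun j => coeff j Q) = Q :=
  polyOf_coeff fun m hm => hQ.coeff_eq_zero fun h => hm (mem_monos.2 ⟨h.ge, h.le⟩)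

/-- A form of rank at most `r` is a quadratic form in `r` general linear forms. -/
theorem RankLE.exists_normal_form {r : ℕ} {Q : MvPolynomial (Fin n) ℂ} (hQ : RankLE Q r)
    (hr : r ≤ n) : ∃ s : Finset (Fin n), s.card = r ∧ ∃ (B : s → ↥(sᶜ) → ℂ) (w : monos s 2 2 → ℂ),
      Q = bind₁ (fun a : s => X (a : Fin n) + ∑ j : ↥(sᶜ), C (B a j) * X (j : Fin n))
        (polyOf (monos s 2 2) w) := by
  classical
  obtain ⟨l, hl, rfl⟩ := hQ
  obtain ⟨s, hs, B, hB1, hB2, hB3⟩ := exists_spanning_columns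
    (fun (j : Fin n) (i : Fin r) => coeff (Finsupp.single j 1) (l i)) (by simpa using hr)
  refine ⟨s, hs, fun a j => B a j, fun m => coeff m (∑ i, (∑ a : s,
    C (coeff (Finsupp.single (a : Fin n) 1) (l i)) * X a) ^ 2), ?_⟩
  rw [MvPolynomial.IsHomogeneous.polyOf_monos
    (IsHomogeneous.sum _ _ _ fun i _ => (isHomogeneous_sum_C_mul_X _).pow 2), map_sum]
  refine Finset.sum_congr rfl fun i _ => ?_
  rw [map_pow, map_sum]
  congr 1
  have hy : ∀ a : s, (X (a : Fin n) + ∑ j : ↥(sᶜ), C (B a j) * X (j : Fin n) :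
      MvPolynomial (Fin n) ℂ) = ∑ j, C (B a j) * X j := by
    intro a
    have hs' : ∑ j ∈ s, (C (B a j) * X j : MvPolynomial (Fin n) ℂ) = X (a : Fin n) := by
     rw [Finset.sum_eq_single (a : Fin n)]
     · simp [hB2]
     · intro b hb hba
       have := hB3 a ⟨b, hb⟩ (fun h => hba (by rw [h]))
       simp only at this
       rw [this]; simp
     · intro h; exact absurd a.2 h
    rw [← Finset.sum_add_sum_compl s, Finset.sum_coe_sort (sᶜ) (fun j => C (B a j) * X j), hs']
  conv_lhs => rw [(hl i).eq_sum_of_one]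
  simp only [map_mul, bind₁_X_right, bind₁_C_right, hy, Finset.mul_sum]
  rw [Finset.sum_comm]
  refine Finset.sum_congr rfl fun j _ => ?_
  have := congrFun (hB1 j) i
  simp only [Finset.sum_apply, Pi.smul_apply, smul_eq_mul] at this
  rw [this, map_sum, Finset.sum_mul]
  refine Finset.sum_congr rfl fun a _ => ?_
  rw [C_mul]; ring

theorem le_finrank_Psing (h : IsHyperplaneRestriction q₁ ι σ) (hn : 5 ≤ n) :
    (n - 5) * (n - 4) / 2 ≤ Module.finrank ℂ (Psing (n + 1)) := by
  have h1 := LinearMap.finrank_le_finrank_of_surjective (f := coeffMap ι) (coeffMap_surjective h)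
  rw [Module.finrank_fintype_fun_eq_card, Fintype.card_coe,
    card_monos_add (b := 2) le_rfl (by omega), card_monos_self _ _ (by omega),
    show n + 2 - 1 = n + 1 from rfl, Nat.choose_two_right, Nat.add_sub_cancel] at h1
  have h2 : (n - 5) * (n - 4) / 2 ≤ (n + 1) * n / 2 :=
    Nat.div_le_div_right (Nat.mul_le_mul (by omega) (by omega))
  omega

theorem hasCodimGE_rankLE (h : IsHyperplaneRestriction q₁ ι σ) (hn : 5 ≤ n) :
    HasCodimGE {f : Psing (n + 1) |
      RankLE (homogeneousComponent 2 (ι (f : MvPolynomial (Fin (n + 1)) ℂ))) 5}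
      ((n - 5) * (n - 4) / 2) := by
  classical
  have hcard : (monos (Fin n) 2 (n + 1)).card
      = n * (n + 1) / 2 + (monos (Fin n) 3 (n + 1)).card := by
    rw [card_monos_add (b := 2) le_rfl (by omega), card_monos_self _ _ (by omega),
      show n + 2 - 1 = n + 1 from rfl, Nat.choose_two_right, Nat.add_sub_cancel, mul_comm]
  have hnum : 15 + 5 * (n - 5) + (n - 5) * (n - 4) / 2 = n * (n + 1) / 2 := by
    obtain ⟨k, rfl⟩ := Nat.exists_eq_add_of_le hn
    have e1 : 5 + k - 5 = k := by omega
    have e2 : 5 + k - 4 = k + 1 := by omega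
    rw [e1, e2]
    have : (5 + k) * (5 + k + 1) = k * (k + 1) + 2 * (15 + 5 * k) := by ring
    rw [this, Nat.add_mul_div_left _ _ (by norm_num)]
    omega
  obtain ⟨T, hT⟩ : ∃ T : Finset (Fin n) → Set (Psing (n + 1)), ∀ s f, f ∈ T s ↔
    ∃ (B : ↥s → ↥(sᶜ) → ℂ) (w : monos s 2 2 → ℂ),
      homogeneousComponent 2 (ι (f : MvPolynomial (Fin (n + 1)) ℂ)) =
        bind₁ (fun a : ↥s => X (a : Fin n) + ∑ j : ↥(sᶜ), C (B a j) * X (j : Fin n))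
        (polyOf (monos s 2 2) w) := ⟨fun s => {f | _}, fun s f => Iff.rfl⟩
  refine HasCodimGE.mono (T := ⋃ s : {s : Finset (Fin n) // s.card = 5}, T s)
    (HasCodimGE.iUnion (le_finrank_Psing h hn) ?_) ?_
  · rintro ⟨s, hs⟩
    refine hasCodimGE_of_generic h
      (P := monos s 2 2 ⊕ (s × ↥(sᶜ)) ⊕ monos (Fin n) 3 (n + 1))
      (bind₁ (fun a : s => X (a : Fin n) + ∑ j : ↥(sᶜ), C (X (Sum.inr (Sum.inl (a, j)))) *
        X (j : Fin n)) (polyOf (monos s 2 2) fun m => X (Sum.inl m)) +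
        polyOf (monos (Fin n) 3 (n + 1)) fun m => X (Sum.inr (Sum.inr m))) ?_ ?_
    · intro f hf
      obtain ⟨B, w, hf⟩ := (hT _ _).1 hf
      refine ⟨Sum.elim w (Sum.elim (fun p => B p.1 p.2)
        fun m => coeff m (ι (f : MvPolynomial (Fin (n + 1)) ℂ))), fun j hj => ?_⟩
      rw [map_add, coeff_add, map_bind₁, map_polyOf, map_polyOf]
      simp only [map_add, map_X, map_sum, map_mul, map_C, eval_X, Sum.elim_inl, Sum.elim_inr]
      rw [← hf, coeff_homogeneousComponent]
      by_cases hj3 : j ∈ monos (Fin n) 3 (n + 1)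
      · rw [coeff_polyOf _ _ ⟨j, hj3⟩, if_neg, zero_add]
        rw [mem_monos] at hj3; omega
      · rw [coeff_polyOf_of_notMem _ _ hj3, if_pos, add_zero]
        rw [mem_monos] at hj3 hj; omega
    · rw [Fintype.card_sum, Fintype.card_sum, Fintype.card_prod, Fintype.card_coe, Fintype.card_coe,
        Fintype.card_coe, Fintype.card_coe, Finset.card_compl, hs, Fintype.card_fin, hcard]
      have : (monos s 2 2).card = 15 := by
        have e : s ≃ Fin 5 := Fintype.equivFinOfCardEq (by simpa using hs)
        rw [show 15 = (monos (Fin 5) 2 2).card by rw [card_monos_self _ _ (by norm_num)]; rfl]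
        refine Finset.card_equiv (Finsupp.domCongr e).toEquiv fun m => ?_
        rw [mem_monos, mem_monos]
        have : ((Finsupp.domCongr e).toEquiv m).degree = m.degree := by
          rw [Finsupp.degree_eq_sum, Finsupp.degree_eq_sum, ← e.sum_comp]
          simp
        rw [this]
      rw [this]
      omega
  · intro f hf
    obtain ⟨s, hs, B, w, hw⟩ := RankLE.exists_normal_form hf hn
    exact Set.mem_iUnion.2 ⟨⟨s, hs⟩, (hT _ _).2 ⟨B, w, hw⟩⟩

end LowRank

section LowerBound

/-- The quadratic form of a matrix. -/
def quadOf {τ : Type*} [Fintype τ] (N : Matrix τ τ ℂ) : MvPolynomial τ ℂ :=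
  ∑ p, ∑ q, C (N p q) * (X p * X q)

theorem quadOf_isHomogeneous {τ : Type*} [Fintype τ] (N : Matrix τ τ ℂ) :
    (quadOf N).IsHomogeneous 2 :=
  IsHomogeneous.sum _ _ _ fun p _ => IsHomogeneous.sum _ _ _ fun q _ => by
    have := (isHomogeneous_C τ (N p q)).mul ((isHomogeneous_X ℂ p).mul (isHomogeneous_X ℂ q))
    rwa [zero_add] at this

theorem quadOf_eq_sum {τ : Type*} [Fintype τ] (N : Matrix τ τ ℂ) :
    quadOf N = ∑ p, ∑ q, monomial (Finsupp.single p 1 + Finsupp.single q 1) (N p q) := by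
  refine Finset.sum_congr rfl fun p _ => Finset.sum_congr rfl fun q _ => ?_
  rw [X, X, monomial_mul, C_mul_monomial, mul_one, mul_one]

theorem single_add_single_eq_iff {τ : Type*} {a b c d : τ} :
    (Finsupp.single a 1 + Finsupp.single b 1 : τ →₀ ℕ) = Finsupp.single c 1 + Finsupp.single d 1 ↔
      (a = c ∧ b = d) ∨ (a = d ∧ b = c) := by
  classical
  constructor
  · intro h
    have h1 := DFunLike.congr_fun h a
    have h2 := DFunLike.congr_fun h b
    simp only [Finsupp.add_apply, Finsupp.single_apply] at h1 h2
    grind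
  · rintro (⟨rfl, rfl⟩ | ⟨rfl, rfl⟩)
    · rfl
    · rw [add_comm]

theorem coeff_quadOf_of_ne {τ : Type*} [Fintype τ] [DecidableEq τ] (N : Matrix τ τ ℂ) {a b : τ}
    (hab : a ≠ b) : coeff (Finsupp.single a 1 + Finsupp.single b 1) (quadOf N) = N a b + N b a := by
  rw [quadOf_eq_sum]
  simp only [coeff_sum, coeff_monomial, single_add_single_eq_iff]
  have : ∀ p q, (if (p = a ∧ q = b) ∨ (p = b ∧ q = a) then N p q else 0)
      = (if p = a then if q = b then N p q else 0 else 0)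
        + (if p = b then if q = a then N p q else 0 else 0) := by
    intro p q
    split_ifs <;> simp_all
  simp [this, Finset.sum_add_distrib]

theorem coeff_quadOf_self {τ : Type*} [Fintype τ] [DecidableEq τ] (N : Matrix τ τ ℂ) (a : τ) :
    coeff (Finsupp.single a 1 + Finsupp.single a 1) (quadOf N) = N a a := by
  rw [quadOf_eq_sum]
  simp only [coeff_sum, coeff_monomial, single_add_single_eq_iff, or_self]
  have : ∀ p q, (if (p = a ∧ q = a) then N p q else 0)
      = (if p = a then if q = a then N p q else 0 else 0) := by
    intro p q
    split_ifs <;> simp_all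
  simp [this]

theorem eval_quadOf {τ : Type*} [Fintype τ] (N : Matrix τ τ ℂ) (z : τ → ℂ) :
    eval z (quadOf N) = z ⬝ᵥ N.mulVec z := by
  simp only [quadOf, map_sum, map_mul, eval_C, eval_X, dotProduct, Matrix.mulVec, Finset.mul_sum]
  refine Finset.sum_congr rfl fun p _ => Finset.sum_congr rfl fun q _ => ?_
  ring

theorem rankLE_quadOf {k n : ℕ} (D : Matrix (Fin k) (Fin k) ℂ) (A : Matrix (Fin k) (Fin n) ℂ) :
    RankLE (quadOf (A.transpose * D * A)) k := by
  have h := (quadOf_isHomogeneous D).rankLE.map (φ := aeval fun a => ∑ q, C (A a q) * X q)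
    (fun i => by rw [aeval_X]; exact isHomogeneous_sum_C_mul_X _)
  convert h using 1
  refine MvPolynomial.funext fun z => ?_
  rw [IsLinearSubst.eval_apply, eval_quadOf, eval_quadOf]
  have : (fun i => eval z (aeval (fun a => ∑ q, C (A a q) * X q) (X i : MvPolynomial (Fin k) ℂ)))
      = A.mulVec z := by
    funext i
    simp [Matrix.mulVec, dotProduct]
  rw [this, ← Matrix.mulVec_mulVec, ← Matrix.mulVec_mulVec, Matrix.dotProduct_mulVec,
    Matrix.vecMul_transpose]

/-- Symmetric matrix entries of a quadratic form with given coefficients, on the first rows. -/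
def halfCoeff {n k : ℕ} (i : Fin k → Fin n) (w : (Fin n →₀ ℕ) → ℂ) : Matrix (Fin k) (Fin n) ℂ :=
  fun a q => (if i a = q then 1 else 1 / 2) * w (Finsupp.single (i a) 1 + Finsupp.single q 1)

theorem exists_rankLE_extension {n k : ℕ} (i : Fin k → Fin n) (hi : Function.Injective i)
    (w : (Fin n →₀ ℕ) → ℂ) (hdet : ((halfCoeff i w).submatrix id i).det ≠ 0) :
    ∃ Q : MvPolynomial (Fin n) ℂ, RankLE Q k ∧ ∀ a q,
      coeff (Finsupp.single (i a) 1 + Finsupp.single q 1) Q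
        = w (Finsupp.single (i a) 1 + Finsupp.single q 1) := by
  set A := halfCoeff i w with hA
  set S := A.submatrix id i with hS
  have hSu : IsUnit S.det := isUnit_iff_ne_zero.2 hdet
  have hSs : S.transpose = S := by
    ext a b
    simp only [hS, hA, Matrix.transpose_apply, Matrix.submatrix_apply, halfCoeff, id]
    rw [add_comm]
    by_cases h : i a = i b
    · simp [h]
    · rw [if_neg h, if_neg (Ne.symm h)]
  refine ⟨_, rankLE_quadOf S⁻¹ A, fun a q => ?_⟩
  set N := A.transpose * S⁻¹ * A with hN
  have h1 : ∀ a q, N (i a) q = A a q := by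
    intro a q
    have e1 : N.submatrix i id = S.transpose * S⁻¹ * A := by
      rw [hN, hS]
      ext a q; simp [Matrix.mul_apply]
    have : (N.submatrix i id) a q = A a q := by
      rw [e1, hSs, Matrix.mul_nonsing_inv _ hSu, Matrix.one_mul]
    exact this
  have h2 : N.transpose = N := by
    rw [hN]
    simp only [Matrix.transpose_mul, Matrix.transpose_transpose, Matrix.transpose_nonsing_inv, hSs,
      Matrix.mul_assoc]
  have h3 : ∀ a q, N q (i a) = A a q := fun a q => by
    rw [← h1, ← Matrix.transpose_apply N, h2]
  by_cases haq : i a = q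
  · subst haq
    rw [coeff_quadOf_self, h1, hA, halfCoeff, if_pos rfl, one_mul]
  · rw [coeff_quadOf_of_ne _ haq, h1, h3, hA, halfCoeff, if_neg haq]
    ring

end LowerBound

section RankLocus

variable {r : ℕ} {q₁ : MvPolynomial (Fin (5 + r + 1)) ℂ}
  {ι : MvPolynomial (Fin (5 + r + 1)) ℂ →ₐ[ℂ] MvPolynomial (Fin (5 + r)) ℂ}
  {σ : MvPolynomial (Fin (5 + r)) ℂ →ₐ[ℂ] MvPolynomial (Fin (5 + r + 1)) ℂ}

open Classical in
/-- Exponents of degree at least three, or quadratic and involving one of the first five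
variables. -/
def freeMonos (r : ℕ) : Finset (Fin (5 + r) →₀ ℕ) :=
  (monos (Fin (5 + r)) 2 (5 + r + 1)).filter fun m => 3 ≤ m.degree ∨
    ∃ (a : Fin 5) (q : Fin (5 + r)), m = Finsupp.single (Fin.castAdd r a) 1 + Finsupp.single q 1

theorem single_add_single_mem_freeMonos (a : Fin 5) (q : Fin (5 + r)) :
    Finsupp.single (Fin.castAdd r a) 1 + Finsupp.single q 1 ∈ freeMonos r := by
  refine Finset.mem_filter.2 ⟨mem_monos.2 ?_, Or.inr ⟨a, q, rfl⟩⟩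
  simp only [map_add, Finsupp.degree_single]
  omega

theorem card_monos_le_card_freeMonos (hr : r ≠ 0) :
    (monos (Fin (5 + r)) 2 (5 + r + 1)).card ≤ (freeMonos r).card + r * (r + 1) / 2 := by
  classical
  have h1 : (monos (Fin r) 2 2).card = r * (r + 1) / 2 := by
    rw [card_monos_self _ _ hr, show r + 2 - 1 = r + 1 from rfl, Nat.choose_two_right,
      Nat.add_sub_cancel, mul_comm]
  rw [← h1, ← Nat.sub_le_iff_le_add', freeMonos]
  have h2 := Finset.card_filter_add_card_filter_not (s := monos (Fin (5 + r)) 2 (5 + r + 1))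
    (fun m => 3 ≤ m.degree ∨
    ∃ (a : Fin 5) (q : Fin (5 + r)), m = Finsupp.single (Fin.castAdd r a) 1 + Finsupp.single q 1)
  refine (Nat.sub_le_iff_le_add'.2 h2.ge).trans ?_
  refine (Finset.card_le_card (t := (monos (Fin r) 2 2).image
    (Finsupp.mapDomain (Fin.natAdd 5))) ?_).trans Finset.card_image_le
  intro m hm
  rw [Finset.mem_filter, mem_monos, not_or] at hm
  obtain ⟨p, q, rfl⟩ := exists_eq_single_add_single_of_degree_eq_two (m := m) (by omega)
  obtain ⟨p', rfl⟩ | ⟨p', rfl⟩ : (∃ a, p = Fin.castAdd r a) ∨ ∃ b, p = Fin.natAdd 5 b := by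
    induction p using Fin.addCases <;> simp
  · exact absurd ⟨p', q, rfl⟩ hm.2.2
  obtain ⟨q', rfl⟩ | ⟨q', rfl⟩ : (∃ a, q = Fin.castAdd r a) ∨ ∃ b, q = Fin.natAdd 5 b := by
    induction q using Fin.addCases <;> simp
  · exact absurd ⟨q', Fin.natAdd 5 p', add_comm _ _⟩ hm.2.2
  refine Finset.mem_image.2 ⟨Finsupp.single p' 1 + Finsupp.single q' 1, mem_monos.2 ?_, ?_⟩
  · simp only [map_add, Finsupp.degree_single]; omega
  · rw [Finsupp.mapDomain_add, Finsupp.mapDomain_single, Finsupp.mapDomain_single]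

theorem finrank_le_zdim_rankLE (h : IsHyperplaneRestriction q₁ ι σ) (hr : r ≠ 0) :
    ((Module.finrank ℂ (Psing (5 + r + 1)) : ℕ∞) : WithBot ℕ∞) ≤
      zdim (zclosure {f : Psing (5 + r + 1) |
        RankLE (homogeneousComponent 2 (ι (f : MvPolynomial (Fin (5 + r + 1)) ℂ))) 5})
      + ((r * (r + 1) / 2 : ℕ) : ℕ∞) := by
  classical
  obtain ⟨k, e, hk, he⟩ := exists_linearEquiv_sum (coeffMap ι) (coeffMap_surjective h)
  rw [Fintype.card_coe] at hk
  have hsub : ∀ m ∈ freeMonos r, m ∈ monos (Fin (5 + r)) 2 (5 + r + 1) := fun m hm =>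
    (Finset.mem_filter.1 hm).1
  let π : Psing (5 + r + 1) →ₗ[ℂ] (Fin k ⊕ freeMonos r → ℂ) :=
    (LinearMap.funLeft ℂ ℂ (Sum.map id fun m : freeMonos r => ⟨m.1, hsub m m.2⟩)).comp
      e.toLinearMap
  have hπl : ∀ f i, π f (Sum.inl i) = e f (Sum.inl i) := fun f i => rfl
  have hπr : ∀ f (m : freeMonos r), π f (Sum.inr m)
      = coeff m.1 (ι (f : MvPolynomial (Fin (5 + r + 1)) ℂ)) := fun f m =>
    (he f ⟨m.1, hsub m m.2⟩).trans (coeffMap_apply _ _ _)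
  have hi : Function.Injective (Fin.castAdd r : Fin 5 → Fin (5 + r)) := Fin.castAdd_injective 5 r
  let Δ : Matrix (Fin 5) (Fin 5) (MvPolynomial (Fin k ⊕ freeMonos r) ℂ) := fun a b =>
    C (if a = b then 1 else 1 / 2) * X (Sum.inr ⟨_, single_add_single_mem_freeMonos a (Fin.castAdd r b)⟩)
  have hΔ : ∀ w, eval w Δ.det = Matrix.det fun a b => (if a = b then 1 else 1 / 2) *
      w (Sum.inr ⟨_, single_add_single_mem_freeMonos a (Fin.castAdd r b)⟩) := by
    intro w
    rw [RingHom.map_det]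
    congr 1
    ext a b
    change eval w (Δ a b) = _
    simp only [Δ, map_mul, eval_C, eval_X]
  have hδ : Δ.det ≠ 0 := by
    intro h0
    have := hΔ (Sum.elim (fun _ => 0) fun m => if ∃ a, m.1 = Finsupp.single (Fin.castAdd r a) 1 +
      Finsupp.single (Fin.castAdd r a) 1 then 1 else 0)
    rw [h0, map_zero] at this
    have h1 : (fun a b : Fin 5 => (if a = b then 1 else 1 / 2) *
      (Sum.elim (fun _ : Fin k => (0 : ℂ)) (fun m : freeMonos r =>
        if ∃ a, m.1 = Finsupp.single (Fin.castAdd r a) 1 +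
          Finsupp.single (Fin.castAdd r a) 1 then 1 else 0))
        (Sum.inr ⟨_, single_add_single_mem_freeMonos a (Fin.castAdd r b)⟩))
        = (1 : Matrix (Fin 5) (Fin 5) ℂ) := by
      ext a b
      simp only [Sum.elim_inr, single_add_single_eq_iff, Matrix.one_apply]
      by_cases hab : a = b
      · subst hab
        simp
      · rw [if_neg hab, if_neg hab, if_neg, mul_zero]
        rintro ⟨c, ⟨h1, h2⟩ | ⟨h1, h2⟩⟩ <;> exact hab (hi (h1.trans h2.symm))
    rw [h1, Matrix.det_one] at this
    exact zero_ne_one this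
  have key := natCast_card_le_zdim_zclosure π {f : Psing (5 + r + 1) |
        RankLE (homogeneousComponent 2 (ι (f : MvPolynomial (Fin (5 + r + 1)) ℂ))) 5} _ hδ ?_
  · rw [Fintype.card_sum, Fintype.card_fin, Fintype.card_coe] at key
    refine le_trans ?_ (add_le_add_left key _)
    have := card_monos_le_card_freeMonos hr
    have h2 : Module.finrank ℂ (Psing (5 + r + 1)) ≤ k + (freeMonos r).card + r * (r + 1) / 2 := by
      omega
    exact_mod_cast h2
  intro w hw
  rw [hΔ] at hw
  obtain ⟨w', hw'⟩ : ∃ w' : (Fin (5 + r) →₀ ℕ) → ℂ, ∀ m (hm : m ∈ freeMonos r),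
      w' m = w (Sum.inr ⟨m, hm⟩) :=
    ⟨fun m => if hm : m ∈ freeMonos r then w (Sum.inr ⟨m, hm⟩) else 0, fun m hm => dif_pos hm⟩
  obtain ⟨Q, hQ, hQc⟩ := exists_rankLE_extension _ hi w' (by
    refine ne_of_eq_of_ne (congrArg Matrix.det ?_) hw
    ext a b
    simp only [Matrix.submatrix_apply, halfCoeff, id, hi.eq_iff]
    rw [hw' _ (single_add_single_mem_freeMonos a (Fin.castAdd r b))])
  have hQ2 := hQ.isHomogeneous
  set R := polyOf (monos (Fin (5 + r)) 3 (5 + r + 1)) (fun m => w' m) with hR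
  have hF : ∀ m ∉ monos (Fin (5 + r)) 2 (5 + r + 1), coeff m (Q + R) = 0 := by
    intro m hm
    rw [coeff_add, hQ2.coeff_eq_zero, hR, coeff_polyOf_of_notMem, add_zero]
    · intro h3; rw [mem_monos] at h3 hm; omega
    · intro h3; rw [mem_monos] at hm; omega
  let f : Psing (5 + r + 1) := e.symm (Sum.elim (fun i => w (Sum.inl i)) fun j => coeff j.1 (Q + R))
  have hf : ι (f : MvPolynomial (Fin (5 + r + 1)) ℂ) = Q + R := by
    ext m
    by_cases hm : m ∈ monos (Fin (5 + r)) 2 (5 + r + 1)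
    · have := he f ⟨m, hm⟩
      rw [LinearEquiv.apply_symm_apply, Sum.elim_inr, coeffMap_apply] at this
      exact this.symm
    · rw [hF m hm, coeff_restriction_eq_zero h.linear f hm]
  refine ⟨f, ?_, ?_⟩
  · change RankLE (homogeneousComponent 2 (ι (f : MvPolynomial (Fin (5 + r + 1)) ℂ))) 5
    have hR0 : homogeneousComponent 2 R = 0 := by
      ext m
      rw [coeff_homogeneousComponent]
      split_ifs with hm
      · rw [hR, coeff_polyOf_of_notMem, coeff_zero]
        rw [mem_monos]; omega
      · rw [coeff_zero]
    rw [hf, map_add, hR0, add_zero, homogeneousComponent_of_mem hQ2, if_pos rfl]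
    exact hQ
  · ext (i | m)
    · rw [hπl, LinearEquiv.apply_symm_apply, Sum.elim_inl]
    · rw [hπr, hf, coeff_add, ← hw' m.1 m.2]
      have hm := Finset.mem_filter.1 m.2
      by_cases h3 : 3 ≤ m.1.degree
      · rw [hQ2.coeff_eq_zero, zero_add, hR]
        · refine (coeff_polyOf _ _ ⟨m.1, ?_⟩)
          have := mem_monos.1 hm.1
          rw [mem_monos]; omega
        · intro h; rw [h] at h3; omega
      · obtain ⟨a, q, haq⟩ := hm.2.resolve_left h3
        rw [hR, coeff_polyOf_of_notMem, add_zero, haq, hQc]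
        rw [mem_monos]; omega

end RankLocus

section Quadratic

theorem homogeneousComponent_mul_of_left {τ R : Type*} [CommRing R] {a : MvPolynomial τ R} {i : ℕ}
    (ha : a.IsHomogeneous i) (b : MvPolynomial τ R) (j : ℕ) :
    homogeneousComponent (i + j) (a * b) = a * homogeneousComponent j b := by
  classical
  letI := gradedAlgebra (σ := τ) (R := R)
  have := DirectSum.coe_decompose_mul_add_of_left_mem (homogeneousSubmodule τ R) (i := i) (j := j)
    (b := b) ((mem_homogeneousSubmodule _ _).2 ha)
  exact (decomposition.decompose'_apply _ _).symm.trans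
    (this.trans (congrArg _ (decomposition.decompose'_apply _ _)))

variable {n : ℕ} {l : MvPolynomial (Fin (n + 1)) ℂ}
  {ι : MvPolynomial (Fin (n + 1)) ℂ →ₐ[ℂ] MvPolynomial (Fin n) ℂ}
  {σ : MvPolynomial (Fin n) ℂ →ₐ[ℂ] MvPolynomial (Fin (n + 1)) ℂ}

theorem IsHyperplaneRestriction.exists_eq_section_add (h : IsHyperplaneRestriction l ι σ)
    (f : MvPolynomial (Fin (n + 1)) ℂ) : ∃ g, f = σ (ι f) + l * g := by
  have : f - σ (ι f) ∈ RingHom.ker ι := by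
    rw [RingHom.mem_ker, map_sub, h.right_inv, sub_self]
  rw [h.ker_eq, Ideal.mem_span_singleton'] at this
  obtain ⟨g, hg⟩ := this
  exact ⟨g, by rw [mul_comm, hg]; ring⟩

theorem RankLE.of_restriction (h : IsHyperplaneRestriction l ι σ) (hl : l.IsHomogeneous 1)
    {f : MvPolynomial (Fin (n + 1)) ℂ} (hf : f.IsHomogeneous 2) {r : ℕ} (hr : RankLE (ι f) r) :
    RankLE f (r + 2) := by
  obtain ⟨g, hg⟩ := h.exists_eq_section_add f
  have hs := hr.map h.linear_section
  have h2 := congrArg (homogeneousComponent 2) hg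
  rw [map_add, homogeneousComponent_of_mem hf, if_pos rfl,
    homogeneousComponent_of_mem hs.isHomogeneous, if_pos rfl,
    homogeneousComponent_mul_of_left (i := 1) (j := 1) hl] at h2
  rw [h2]
  exact hs.add (rankLE_two_mul hl (homogeneousComponent_isHomogeneous _ _))

theorem irreducible_of_not_rankLE {k : ℕ} {Q : MvPolynomial (Fin k) ℂ}
    (hQ : Q.IsHomogeneous 2) (hr : ¬ RankLE Q 2) : Irreducible Q := by
  classical
  have hQ0 : Q ≠ 0 := by
    rintro rfl
    exact hr (by simpa using rankLE_two_mul (isHomogeneous_zero (Fin k) ℂ 1) (isHomogeneous_zero (Fin k) ℂ 1))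
  have hunit : ∀ a : MvPolynomial (Fin k) ℂ, a ≠ 0 → a.totalDegree = 0 → IsUnit a := by
    intro a ha h0
    rw [totalDegree_eq_zero_iff_eq_C] at h0
    rw [h0] at ha ⊢
    exact (isUnit_iff_ne_zero.2 fun h => ha (by rw [h, C_0])).map C
  refine ⟨fun hu => ?_, fun a b hab => ?_⟩
  · have := isUnit_iff_totalDegree_of_isReduced.1 hu
    rw [hQ.totalDegree hQ0] at this
    exact absurd this.2 (by norm_num)
  · have ha : a ≠ 0 := by rintro rfl; simp at hab; exact hQ0 hab
    have hb : b ≠ 0 := by rintro rfl; simp at hab; exact hQ0 hab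
    have hd := totalDegree_mul_of_isDomain ha hb
    rw [← hab, hQ.totalDegree hQ0] at hd
    by_contra! hcon
    have ha0 : a.totalDegree ≠ 0 := fun h => hcon.1 (hunit a ha h)
    have hb0 : b.totalDegree ≠ 0 := fun h => hcon.2 (hunit b hb h)
    have key : ∀ c : MvPolynomial (Fin k) ℂ, c.totalDegree = 1 →
        c = homogeneousComponent 0 c + homogeneousComponent 1 c := by
      intro c hc
      conv_lhs => rw [← sum_homogeneousComponent c, hc]
      rw [Finset.sum_range_succ, Finset.sum_range_one]
    have h2 := congrArg (homogeneousComponent 2) hab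
    rw [homogeneousComponent_of_mem hQ, if_pos rfl, key a (by omega), key b (by omega)] at h2
    refine hr ?_
    have h3 : Q = homogeneousComponent 1 a * homogeneousComponent 1 b := by
      rw [h2, add_mul, map_add, homogeneousComponent_mul_of_left (i := 1) (j := 1)
        (homogeneousComponent_isHomogeneous _ _),
        show (2 : ℕ) = 0 + 2 from rfl, homogeneousComponent_mul_of_left (i := 0) (j := 2)
        (homogeneousComponent_isHomogeneous _ _)]
      rw [map_add, map_add, homogeneousComponent_of_mem (homogeneousComponent_isHomogeneous 0 b),
        homogeneousComponent_of_mem (homogeneousComponent_isHomogeneous 0 b),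
        homogeneousComponent_of_mem (homogeneousComponent_isHomogeneous 1 b),
        homogeneousComponent_of_mem (homogeneousComponent_isHomogeneous 1 b)]
      simp
    rw [h3]
    exact rankLE_two_mul (homogeneousComponent_isHomogeneous _ _)
      (homogeneousComponent_isHomogeneous _ _)

end Quadratic

section Components

variable {n : ℕ} {q₁ : MvPolynomial (Fin (n + 1)) ℂ}
  {ι : MvPolynomial (Fin (n + 1)) ℂ →ₐ[ℂ] MvPolynomial (Fin n) ℂ}
  {σ : MvPolynomial (Fin n) ℂ →ₐ[ℂ] MvPolynomial (Fin (n + 1)) ℂ}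

theorem not_condR12_of_rankLE (h : IsHyperplaneRestriction q₁ ι σ)
    {f : MvPolynomial (Fin (n + 1)) ℂ} (hr : RankLE (homogeneousComponent 2 (ι f)) 5) :
    ¬ CondR12 q₁ f := by
  rintro ⟨h6, -⟩
  rw [h.linear.homogeneousComponent] at hr
  have := (rankOn_le_iff h (homogeneousComponent_isHomogeneous 2 f) 5).2 hr
  omega

theorem exists_isHomogeneous_one_of_span_ne {k : ℕ} {l : MvPolynomial (Fin k) ℂ}
    {C : Set (Fin k → ℂ)} (hC : ∀ z ∈ C, eval z l = 0)
    (hne : (Submodule.span ℂ C : Set (Fin k → ℂ)) ≠ {z | eval z l = 0}) (hl : l.IsHomogeneous 1) :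
    ∃ L : MvPolynomial (Fin k) ℂ, L.IsHomogeneous 1 ∧ (∀ z ∈ C, eval z L = 0) ∧
      L ∉ Ideal.span {l} := by
  have hle : Submodule.span ℂ C ≤ LinearMap.ker (Fintype.linearCombination ℂ
      fun i => coeff (Finsupp.single i 1) l) := by
    rw [Submodule.span_le]
    intro z hz
    have := hC z hz
    rw [hl.eq_sum_of_one] at this
    simpa [Fintype.linearCombination_apply, mul_comm] using this
  have hker : ∀ z, z ∈ LinearMap.ker (Fintype.linearCombination ℂ
      fun i => coeff (Finsupp.single i 1) l) ↔ eval z l = 0 := by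
    intro z
    conv_rhs => rw [hl.eq_sum_of_one]
    simp [Fintype.linearCombination_apply, mul_comm]
  obtain ⟨x, hx, hxC⟩ : ∃ x, eval x l = 0 ∧ x ∉ Submodule.span ℂ C := by
    by_contra! hcon
    exact hne (subset_antisymm (fun z hz => (hker z).1 (hle hz)) hcon)
  obtain ⟨φ, hφx, hφ⟩ := Submodule.exists_le_ker_of_notMem hxC
  have hev : ∀ z, eval z (∑ i, MvPolynomial.C (φ (Pi.single i 1)) * X i) = φ z := by
    intro z
    conv_rhs => rw [LinearMap.pi_apply_eq_sum_univ φ z]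
    simp [mul_comm, Pi.single_apply]
    refine Finset.sum_congr rfl fun i _ => ?_
    congr 2
    funext j
    simp [Pi.single_apply, eq_comm]
  refine ⟨∑ i, MvPolynomial.C (φ (Pi.single i 1)) * X i, isHomogeneous_sum_C_mul_X _,
    fun z hz => ?_, fun hmem => hφx ?_⟩
  · rw [hev]
    exact hφ (Submodule.subset_span hz)
  · obtain ⟨g, hg⟩ := Ideal.mem_span_singleton'.1 hmem
    rw [← hev, ← hg, map_mul, hx, mul_zero]

end Components

section Span

variable {n : ℕ} {q₁ : MvPolynomial (Fin (n + 1)) ℂ}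
  {ι : MvPolynomial (Fin (n + 1)) ℂ →ₐ[ℂ] MvPolynomial (Fin n) ℂ}
  {σ : MvPolynomial (Fin n) ℂ →ₐ[ℂ] MvPolynomial (Fin (n + 1)) ℂ}

theorem coordIdeal_mem_minimalPrimes {k : ℕ} {s : Set (MvPolynomial (Fin k) ℂ)}
    {C : Set (Fin k → ℂ)} (hC : IsIrredCompOf C {z | ∀ p ∈ s, eval z p = 0}) :
    coordIdeal (LinearEquiv.refl ℂ (Fin k → ℂ)) C ∈ (Ideal.span s).minimalPrimes := by
  obtain ⟨hCZ, hirr, hmax⟩ := hC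
  refine ⟨⟨coordIdeal_isPrime _ hirr, Ideal.span_le.2 fun p hp =>
    mem_coordIdeal.2 fun z hz => hCZ hz p hp⟩, ?_⟩
  rintro P ⟨hP, hsP⟩ hle
  have h1 := hmax {v | ∀ p ∈ P, eval (LinearEquiv.refl ℂ (Fin k → ℂ) v) p = 0}
    (fun z hz p hp => mem_coordIdeal.1 (hle hp) z hz)
    (fun z hz p hp => hz p (hsP (Ideal.subset_span hp))) (isIrreducible_zeros _ P)
  rw [← h1, coordIdeal_zeros]

theorem four_le_height (h : IsHyperplaneRestriction q₁ ι σ) (hq : q₁ ≠ 0)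
    {P : Ideal (MvPolynomial (Fin (n + 1)) ℂ)} [P.IsPrime] {L : MvPolynomial (Fin (n + 1)) ℂ}
    {m : ℕ}
    {ι₂ : MvPolynomial (Fin n) ℂ →ₐ[ℂ] MvPolynomial (Fin m) ℂ}
    (hker : RingHom.ker ι₂ = Ideal.span {ι L}) (hsurj : Function.Surjective ι₂)
    (hL : ι L ≠ 0) (hLP : L ∈ P) (hqP : q₁ ∈ P)
    {f₂ f₃ : MvPolynomial (Fin (n + 1)) ℂ} (hirr : Irreducible (ι₂ (ι f₂)))
    (h₂ : f₂ ∈ P) (h₃ : f₃ ∈ P) (hdvd : ¬ ι₂ (ι f₂) ∣ ι₂ (ι f₃)) : 4 ≤ P.height := by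
  let φ : MvPolynomial (Fin (n + 1)) ℂ →+* MvPolynomial (Fin m) ℂ :=
    (ι₂ : MvPolynomial (Fin n) ℂ →+* MvPolynomial (Fin m) ℂ).comp
      (ι : MvPolynomial (Fin (n + 1)) ℂ →+* MvPolynomial (Fin n) ℂ)
  have hsφ : Function.Surjective φ := hsurj.comp fun x => ⟨σ x, h.right_inv x⟩
  have hι : ∀ f, ι f = 0 ↔ f ∈ Ideal.span {q₁} := fun f => by rw [← h.ker_eq]; rfl
  have hι₂ : ∀ f, ι₂ f = 0 ↔ f ∈ Ideal.span {ι L} := fun f => by rw [← hker]; rfl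
  have hqle : ∀ f, ι f = 0 → f ∈ P := fun f hf => by
    obtain ⟨g, rfl⟩ := Ideal.mem_span_singleton'.1 ((hι f).1 hf)
    exact P.mul_mem_left _ hqP
  have hkle : ∀ f, φ f = 0 → f ∈ P := fun f hf => by
    obtain ⟨g, hg⟩ := Ideal.mem_span_singleton'.1 ((hι₂ _).1 hf)
    have : f - σ g * L ∈ P := hqle _ (by rw [map_sub, map_mul, h.right_inv, hg]; exact sub_self _)
    have := P.add_mem this (P.mul_mem_left (σ g) hLP)
    rwa [sub_add_cancel] at this
  have hp1 : (RingHom.ker ι).IsPrime := RingHom.ker_isPrime _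
  have hp2 : (RingHom.ker φ).IsPrime := RingHom.ker_isPrime _
  have hp3' : (Ideal.span {ι₂ (ι f₂)}).IsPrime :=
    (Ideal.span_singleton_prime hirr.ne_zero).2 (UniqueFactorizationMonoid.irreducible_iff_prime.1 hirr)
  have hp3 : ((Ideal.span {ι₂ (ι f₂)}).comap φ).IsPrime := hp3'.comap φ
  have l1 : (⊥ : Ideal (MvPolynomial (Fin (n + 1)) ℂ)) < RingHom.ker ι := by
    rw [bot_lt_iff_ne_bot]
    intro h0
    have : q₁ ∈ RingHom.ker ι := h.apply_self
    rw [h0] at this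
    exact hq (by simpa using this)
  have l2 : RingHom.ker ι < RingHom.ker φ := by
    refine lt_of_le_not_ge (fun f hf => ?_) fun hle => hL (hle ?_)
    · have : ι f = 0 := hf
      change ι₂ (ι f) = 0
      rw [this, map_zero]
    · exact (hι₂ _).2 (Ideal.mem_span_singleton_self _)
  have l3 : RingHom.ker φ < (Ideal.span {ι₂ (ι f₂)}).comap φ := by
    refine lt_of_le_not_ge (fun f hf => ?_) fun hle => hirr.ne_zero (hle ?_)
    · rw [Ideal.mem_comap, RingHom.mem_ker.1 hf]
      exact Ideal.zero_mem _
    · exact Ideal.mem_span_singleton_self _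
  have l4 : (Ideal.span {ι₂ (ι f₂)}).comap φ < P := by
    refine lt_of_le_not_ge (fun f hf => ?_) fun hle => hdvd ?_
    · obtain ⟨g, hg⟩ := Ideal.mem_span_singleton'.1 (Ideal.mem_comap.1 hf)
      obtain ⟨g', rfl⟩ := hsφ g
      have : f - g' * f₂ ∈ P := hkle _ (by rw [map_sub, map_mul, ← hg]; exact sub_self _)
      have := P.add_mem this (P.mul_mem_left g' h₂)
      rwa [sub_add_cancel] at this
    · exact Ideal.mem_span_singleton.1 (Ideal.mem_comap.1 (hle h₃))
  have b1 := Ideal.height_add_one_le_of_lt_of_isPrime l1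
  have b2 := Ideal.height_add_one_le_of_lt_of_isPrime l2
  have b3 := Ideal.height_add_one_le_of_lt_of_isPrime l3
  have b4 := Ideal.height_add_one_le_of_lt_of_isPrime l4
  calc (4 : ℕ∞) = 0 + 1 + 1 + 1 + 1 := by norm_num
    _ ≤ (⊥ : Ideal (MvPolynomial (Fin (n + 1)) ℂ)).height + 1 + 1 + 1 + 1 := by gcongr; exact zero_le
    _ ≤ (RingHom.ker ι).height + 1 + 1 + 1 := by gcongr
    _ ≤ (RingHom.ker φ).height + 1 + 1 := by gcongr
    _ ≤ _ := (by gcongr : _ ≤ ((Ideal.span {ι₂ (ι f₂)}).comap φ).height + 1).trans b4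

theorem exists_cubic_relation (h : IsHyperplaneRestriction q₁ ι σ) (hq : q₁.IsHomogeneous 1)
    (hq0 : q₁ ≠ 0) {f : MvPolynomial (Fin (n + 1)) ℂ} (hf : ¬ CondR12 q₁ f)
    (hr : ¬ RankLE (homogeneousComponent 2 (ι f)) 5) :
    ∃ l L Q : MvPolynomial (Fin n) ℂ, l.IsHomogeneous 1 ∧ L.IsHomogeneous 1 ∧ Q.IsHomogeneous 2 ∧
      homogeneousComponent 3 (ι f) = l * homogeneousComponent 2 (ι f) + L * Q := by
  have h2 := homogeneousComponent_isHomogeneous 2 f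
  have h3 := homogeneousComponent_isHomogeneous 3 f
  have h6 : 6 ≤ rankOn (homogeneousComponent 2 f) {z : Fin (n + 1) → ℂ | eval z q₁ = 0} := by
    by_contra! hlt
    rw [h.linear.homogeneousComponent] at hr
    exact hr ((rankOn_le_iff h h2 5).1 (by omega))
  have hf' : ¬ _ := fun h' => hf ⟨h6, h'⟩
  push Not at hf'
  obtain ⟨C, hC, hne⟩ := hf'
  have hZ : {z : Fin (n + 1) → ℂ | eval z q₁ = 0 ∧ eval z (homogeneousComponent 2 f) = 0 ∧
      eval z (homogeneousComponent 3 f) = 0} = {z | ∀ p ∈ ({q₁, homogeneousComponent 2 f,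
        homogeneousComponent 3 f} : Set (MvPolynomial (Fin (n + 1)) ℂ)), eval z p = 0} := by
    ext z
    simp
  rw [hZ] at hC
  obtain ⟨L, hL, hLC, hLq⟩ := exists_isHomogeneous_one_of_span_ne
    (fun z hz => hC.1 hz q₁ (by simp)) hne hq
  have hP := coordIdeal_mem_minimalPrimes hC
  have hPp := hP.1.1
  have hmem : ∀ p ∈ ({q₁, homogeneousComponent 2 f,
      homogeneousComponent 3 f} : Set (MvPolynomial (Fin (n + 1)) ℂ)),
      p ∈ coordIdeal (LinearEquiv.refl ℂ _) C := fun p hp => hP.1.2 (Ideal.subset_span hp)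
  have hht := Ideal.height_le_card_of_mem_minimalPrimes_span (by simp) hP
  have hιL : ι L ≠ 0 := fun h0 => hLq (by rw [← h.ker_eq]; exact h0)
  have hιLh := h.linear.isHomogeneous hL
  obtain ⟨m, rfl⟩ : ∃ m, n = m + 1 := by
    refine Nat.exists_eq_succ_of_ne_zero ?_
    rintro rfl
    exact hιL (by rw [hιLh.eq_sum_of_one]; simp)
  obtain ⟨ι₂, σ₂, hi₂⟩ := exists_isHyperplaneRestriction hιLh hιL
  have hF2 := h.linear.isHomogeneous h2
  have hF3 := h.linear.isHomogeneous h3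
  have hdvd : ι₂ (ι (homogeneousComponent 2 f)) ∣ ι₂ (ι (homogeneousComponent 3 f)) := by
    by_contra hdvd
    have := four_le_height h hq0 (P := coordIdeal (LinearEquiv.refl ℂ _) C) hi₂.ker_eq
      (fun x => ⟨σ₂ x, hi₂.right_inv x⟩) hιL (mem_coordIdeal.2 hLC) (hmem _ (by simp))
      (irreducible_of_not_rankLE (hi₂.linear.isHomogeneous hF2) fun hr' => hr ?_)
      (hmem _ (by simp)) (hmem _ (by simp)) hdvd
    · have h4 := this.trans hht
      have h5 : ({q₁, homogeneousComponent 2 f,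
        homogeneousComponent 3 f} : Set (MvPolynomial (Fin (m + 1 + 1)) ℂ)).ncard ≤ 3 :=
        (Set.ncard_insert_le _ _).trans (Nat.succ_le_succ ((Set.ncard_insert_le _ _).trans
          (Nat.succ_le_succ (Set.ncard_singleton _).le)))
      have h6 : (4 : ℕ∞) ≤ ((3 : ℕ) : ℕ∞) := h4.trans (Nat.cast_le.2 h5)
      exact absurd h6 (by decide)
    · rw [h.linear.homogeneousComponent]
      exact (RankLE.of_restriction hi₂ hιLh hF2 hr').mono (by norm_num)
  obtain ⟨g, hg⟩ := hdvd
  obtain ⟨a, ha⟩ := hi₂.exists_eq_section_add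
    (ι (homogeneousComponent 3 f) - σ₂ g * ι (homogeneousComponent 2 f))
  rw [map_sub, map_mul, hi₂.right_inv, hg, mul_comm g, sub_self, map_zero, zero_add,
    sub_eq_iff_eq_add] at ha
  refine ⟨homogeneousComponent 1 (σ₂ g), ι L, homogeneousComponent 2 a,
    homogeneousComponent_isHomogeneous _ _, hιLh, homogeneousComponent_isHomogeneous _ _, ?_⟩
  have h3' := congrArg (homogeneousComponent 3) ha
  rw [homogeneousComponent_of_mem hF3, if_pos rfl, map_add, mul_comm (σ₂ g),
    homogeneousComponent_mul_of_left (i := 1) (j := 2) hιLh,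
    homogeneousComponent_mul_of_left (i := 2) (j := 1) hF2] at h3'
  rw [h.linear.homogeneousComponent, h.linear.homogeneousComponent, h3']
  ring

theorem hasCodimGE_cubic_relation (h : IsHyperplaneRestriction q₁ ι σ) (hn : 7 ≤ n) :
    HasCodimGE {f : Psing (n + 1) |
      ∃ l L Q : MvPolynomial (Fin n) ℂ, l.IsHomogeneous 1 ∧ L.IsHomogeneous 1 ∧ Q.IsHomogeneous 2 ∧
      homogeneousComponent 3 (ι (f : MvPolynomial (Fin (n + 1)) ℂ)) =
        l * homogeneousComponent 2 (ι (f : MvPolynomial (Fin (n + 1)) ℂ)) + L * Q}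
      ((n - 5) * (n - 4) / 2) := by
  classical
  refine hasCodimGE_of_generic h
    (P := (Fin n ⊕ Fin n) ⊕ (monos (Fin n) 2 2 ⊕ monos (Fin n) 2 2) ⊕ monos (Fin n) 4 (n + 1))
    (polyOf (monos (Fin n) 2 2) (fun m => X (Sum.inr (Sum.inl (Sum.inl m)))) +
      ((∑ i, C (X (Sum.inl (Sum.inl i))) * X i) *
        polyOf (monos (Fin n) 2 2) (fun m => X (Sum.inr (Sum.inl (Sum.inl m)))) +
      (∑ i, C (X (Sum.inl (Sum.inr i))) * X i) *
        polyOf (monos (Fin n) 2 2) (fun m => X (Sum.inr (Sum.inl (Sum.inr m))))) +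
      polyOf (monos (Fin n) 4 (n + 1)) fun m => X (Sum.inr (Sum.inr m))) ?_ ?_
  · rintro f ⟨l, L, Q, hl, hL, hQ, hlQ⟩
    obtain ⟨F, hF⟩ : ∃ F, F = ι (f : MvPolynomial (Fin (n + 1)) ℂ) := ⟨_, rfl⟩
    rw [← hF] at hlQ ⊢
    refine ⟨Sum.elim (Sum.elim (fun i => coeff (Finsupp.single i 1) l)
      fun i => coeff (Finsupp.single i 1) L) (Sum.elim (Sum.elim
      (fun m => coeff m (homogeneousComponent 2 F)) fun m => coeff m Q) fun m => coeff m F),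
      fun j hj => ?_⟩
    rw [mem_monos] at hj
    simp only [map_add, map_mul, map_polyOf, map_X, map_sum, map_C, eval_X, Sum.elim_inl,
      Sum.elim_inr]
    rw [← hl.eq_sum_of_one, ← hL.eq_sum_of_one,
      polyOf_coeff (f := Q) fun m hm => hQ.coeff_eq_zero fun h2 => hm (by rw [mem_monos]; omega),
      polyOf_coeff (f := homogeneousComponent 2 F) fun m hm =>
        (homogeneousComponent_isHomogeneous 2 F).coeff_eq_zero fun h2 => hm (by rw [mem_monos]; omega),
      ← hlQ, coeff_add, coeff_add, coeff_homogeneousComponent, coeff_homogeneousComponent]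
    by_cases hj4 : j ∈ monos (Fin n) 4 (n + 1)
    · rw [coeff_polyOf _ _ ⟨j, hj4⟩]
      rw [mem_monos] at hj4
      rw [if_neg (by omega), if_neg (by omega), zero_add, zero_add]
    · rw [coeff_polyOf_of_notMem _ _ hj4]
      rw [mem_monos] at hj4
      obtain h2 | h3 : j.degree = 2 ∨ j.degree = 3 := by omega
      · rw [if_pos h2, if_neg (by omega), add_zero, add_zero]
      · rw [if_neg (by omega), if_pos h3, add_zero, zero_add]
  · have c1 : (monos (Fin n) 2 (n + 1)).card = (monos (Fin n) 2 2).card + (monos (Fin n) 3 3).card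
        + (monos (Fin n) 4 (n + 1)).card := by
      rw [card_monos_add (b := 3) (by omega) (by omega), card_monos_add (b := 2) (by omega) (by omega)]
    simp only [Fintype.card_sum, Fintype.card_coe, Fintype.card_fin]
    rw [c1, card_monos_self _ _ (by omega), card_monos_self _ _ (by omega)]
    obtain ⟨k, rfl⟩ := Nat.exists_eq_add_of_le hn
    have e1 : (7 + k - 5) * (7 + k - 4) = (k + 2) * (k + 3) := by congr 1 <;> omega
    have e2 : (7 + k + 2 - 1).choose 2 * 2 = (k + 8) * (k + 7) := by
      rw [show 7 + k + 2 - 1 = k + 8 by omega, Nat.choose_two_right]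
      exact Nat.div_mul_cancel (by
        have := Nat.even_mul_pred_self (k + 8)
        exact this.two_dvd)
    have e3 : (7 + k + 3 - 1).choose 3 * 3 = (7 + k + 2 - 1).choose 2 * (k + 9) := by
      have := Nat.add_one_mul_choose_eq (k + 8) 2
      rw [show 7 + k + 3 - 1 = k + 9 by omega, show 7 + k + 2 - 1 = k + 8 by omega]
      linarith
    rw [e1]
    have e4 : (k + 2) * (k + 3) / 2 * 2 ≤ (k + 2) * (k + 3) := Nat.div_mul_le_self _ _
    nlinarith

end Span

theorem exists_ringHom_extension_of_injective {R B K : Type*} [CommRing R] [CommRing B]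
    [Field K] [IsAlgClosed K] (f : R →+* B) (hf : f.IsIntegral)
    (hinj : Function.Injective f) (h : R →+* K) :
    ∃ ψ : B →+* K, ψ.comp f = h := by
  let := f.toAlgebra
  have : Algebra.IsIntegral R B := ⟨hf⟩
  have hp : (RingHom.ker h).IsPrime := RingHom.ker_isPrime h
  obtain ⟨Q, -, hQ, hQp⟩ := Ideal.exists_ideal_over_prime_of_isIntegral (R := R) (S := B)
    (RingHom.ker h) ⊥ (((RingHom.injective_iff_ker_eq_bot f).1 hinj).le.trans bot_le)
  let g : R ⧸ RingHom.ker h →+* B ⧸ Q := Ideal.quotientMap Q f hQp.ge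
  have hg : g.comp (Ideal.Quotient.mk _) = (Ideal.Quotient.mk Q).comp f :=
    RingHom.ext fun x => (Ideal.quotientMap_mk (H := hQp.ge) : g (Ideal.Quotient.mk _ x) = _)
  obtain ⟨ψ, hψ⟩ := exists_ringHom_extension_of_isDomain g
    (RingHom.IsIntegral.tower_top (Ideal.Quotient.mk _) g (by
      rw [hg]
      exact hf.trans _ _ (RingHom.isIntegral_of_surjective _ Ideal.Quotient.mk_surjective)))
    (Ideal.quotientMap_injective' hQp.le) (RingHom.kerLift h) (RingHom.kerLift_injective h)
  refine ⟨ψ.comp (Ideal.Quotient.mk Q), ?_⟩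
  rw [RingHom.comp_assoc, ← hg, ← RingHom.comp_assoc, hψ]
  exact RingHom.ext fun x => RingHom.kerLift_mk h x

/-- A nonzero coordinate of a point over a field extension survives in a suitable
specialisation over the algebraically closed base field. -/
theorem exists_specialisation {K L ι : Type*} [Field K] [IsAlgClosed K] [Field L] [Algebra K L]
    [Finite ι] (b : ι → L) (i : ι) (hi : b i ≠ 0) :
    ∃ φ : Algebra.adjoin K (Set.range b) →ₐ[K] K,
      φ ⟨b i, Algebra.subset_adjoin ⟨i, rfl⟩⟩ ≠ 0 := by
  let P : Ideal (MvPolynomial ι K) := RingHom.ker (aeval b : MvPolynomial ι K →ₐ[K] L)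
  have hP : P.IsPrime := RingHom.ker_isPrime _
  have hX : X i ∉ vanishingIdeal K (zeroLocus K P) := by
    rw [vanishingIdeal_zeroLocus_eq_radical, hP.radical]
    intro h
    exact hi (by simpa [P] using h)
  obtain ⟨w, hw, hwi⟩ : ∃ w ∈ zeroLocus K P, w i ≠ 0 := by
    by_contra! hcon
    exact hX (mem_vanishingIdeal_iff.2 fun w hw => by simpa using hcon w hw)
  have hr : (aeval b : MvPolynomial ι K →ₐ[K] L).range = Algebra.adjoin K (Set.range b) :=
    (Algebra.adjoin_range_eq_range_aeval K b).symm
  let f : MvPolynomial ι K →ₐ[K] Algebra.adjoin K (Set.range b) :=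
    (aeval b : MvPolynomial ι K →ₐ[K] L).codRestrict _ fun p => hr ▸ AlgHom.mem_range_self _ p
  have hf : Function.Surjective f := by
    rintro ⟨x, hx⟩
    rw [← hr] at hx
    obtain ⟨p, hp⟩ := hx
    exact ⟨p, Subtype.ext hp⟩
  have hk : RingHom.ker f ≤ RingHom.ker (aeval w : MvPolynomial ι K →ₐ[K] K) := by
    intro p hp
    have : p ∈ P := by
      have := congrArg Subtype.val (RingHom.mem_ker.1 hp)
      exact this
    exact hw p this
  let φ := Ideal.Quotient.liftₐ (RingHom.ker f) (aeval w : MvPolynomial ι K →ₐ[K] K) hk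
  refine ⟨φ.comp (Ideal.quotientKerAlgEquivOfSurjective hf).symm.toAlgHom, ?_⟩
  have : (⟨b i, Algebra.subset_adjoin ⟨i, rfl⟩⟩ : Algebra.adjoin K (Set.range b)) = f (X i) :=
    Subtype.ext (by simp [f])
  rw [this]
  have h2 : (Ideal.quotientKerAlgEquivOfSurjective hf).symm (f (X i)) = Ideal.Quotient.mk _ (X i) := by
    rw [AlgEquiv.symm_apply_eq]; rfl
  change φ ((Ideal.quotientKerAlgEquivOfSurjective hf).symm (f (X i))) ≠ 0
  rw [h2]
  have h3 : φ (Ideal.Quotient.mk _ (X i)) = aeval w (X i : MvPolynomial ι K) := rfl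
  rw [h3, aeval_X]
  exact hwi

/-- Linear disjointness of algebraically independent extensions of an algebraically closed
field: a relation with coefficients in `A` specialises. -/
theorem specialisation_eq_zero_of_sum_mul_eq_zero {K A L ι τ : Type*} [Field K] [Field L]
    [IsAlgClosed L] [CommRing A] [Algebra K A] [Algebra A L] [Algebra K L] [IsScalarTower K A L]
    [Fintype ι] (φ : A →ₐ[K] K) (b : ι → A) (y : ι → L) (t : τ → L)
    (ht : AlgebraicIndependent A t)
    (hy : ∀ i, IsAlgebraic (Algebra.adjoin K (Set.range t)) (y i))
    (hy' : LinearIndependent K y) (h : ∑ i, algebraMap A L (b i) * y i = 0) (i : ι) :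
    φ (b i) = 0 := by
  by_contra hφ
  have : Nontrivial A := ⟨⟨b i, 0, fun h => hφ (by rw [h, map_zero])⟩⟩
  letI : Algebra (MvPolynomial τ A) L := (aeval t : MvPolynomial τ A →ₐ[A] L).toRingHom.toAlgebra
  letI : Algebra (MvPolynomial τ K) L := (aeval t : MvPolynomial τ K →ₐ[K] L).toRingHom.toAlgebra
  have hm1 : ∀ p : MvPolynomial τ A, algebraMap (MvPolynomial τ A) L p = aeval t p := fun _ => rfl
  have hm2 : ∀ p : MvPolynomial τ K, algebraMap (MvPolynomial τ K) L p = aeval t p := fun _ => rfl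
  letI : Algebra (MvPolynomial τ K) (MvPolynomial τ A) := (map (algebraMap K A)).toAlgebra
  have hm3 : ∀ p : MvPolynomial τ K, algebraMap (MvPolynomial τ K) (MvPolynomial τ A) p =
    map (algebraMap K A) p := fun _ => rfl
  have : IsScalarTower (MvPolynomial τ K) (MvPolynomial τ A) L :=
    IsScalarTower.of_algebraMap_eq fun p => by
      rw [hm1, hm2, hm3, MvPolynomial.aeval_map_algebraMap]
  have hinjK : Function.Injective (algebraMap (MvPolynomial τ K) L) :=
    ht.restrictScalars (algebraMap K A).injective
  have hya : ∀ i, IsAlgebraic (MvPolynomial τ K) (y i) := fun i => by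
    have hr := Algebra.adjoin_range_eq_range_aeval K t
    have hyi := hy i
    rw [hr] at hyi
    refine IsAlgebraic.of_ringHom_of_comp_eq
      (aeval t : MvPolynomial τ K →ₐ[K] L).rangeRestrict (RingHom.id L) hyi
      (AlgHom.rangeRestrict_surjective _) Function.injective_id (RingHom.ext fun _ => rfl)
  choose r hr0 hri using fun i => (hya i).exists_integral_multiple
  obtain ⟨s, hs⟩ : ∃ s, s = ∏ i, r i := ⟨_, rfl⟩
  have hs0 : s ≠ 0 := hs ▸ Finset.prod_ne_zero_iff.2 fun i _ => hr0 i
  have hsi : ∀ i, IsIntegral (MvPolynomial τ K) (s • y i) := fun i => by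
    classical
    rw [hs, ← Finset.prod_erase_mul _ _ (Finset.mem_univ i), mul_smul]
    exact (hri i).smul _
  let j : MvPolynomial τ A →+* integralClosure (MvPolynomial τ A) L := algebraMap (MvPolynomial τ A) (integralClosure (MvPolynomial τ A) L)
  letI : Algebra (MvPolynomial τ K) (integralClosure (MvPolynomial τ A) L) :=
    (j.comp (map (algebraMap K A))).toAlgebra
  have hm4 : ∀ p : MvPolynomial τ K, algebraMap (MvPolynomial τ K) (integralClosure (MvPolynomial τ A) L) p =
    j (map (algebraMap K A) p) := fun _ => rfl
  have : IsScalarTower (MvPolynomial τ K) (integralClosure (MvPolynomial τ A) L) L :=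
    IsScalarTower.of_algebraMap_eq fun p => by
      rw [hm4, hm2, ← aeval_map_algebraMap A]
      rfl
  have hinjB : Function.Injective j := fun p q hpq =>
    ht (congrArg (Subtype.val : integralClosure (MvPolynomial τ A) L → L) hpq)
  have h_integralB : RingHom.IsIntegral j :=
    fun x => integralClosure.isIntegral (R := MvPolynomial τ A) (A := L) x
  obtain ⟨ψ, hψ⟩ := exists_ringHom_extension_of_injective (K := L) j
    h_integralB hinjB
    (eval₂Hom ((algebraMap K L).comp φ.toRingHom) t)
  have hψ' : ∀ p : MvPolynomial τ A, ψ (j p) =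
      eval₂Hom ((algebraMap K L).comp φ.toRingHom) t p := fun p => by rw [← hψ]; rfl
  have hψK : ∀ p : MvPolynomial τ K, ψ (j (map (algebraMap K A) p)) =
      aeval t p := fun p => by
    rw [hψ', coe_eval₂Hom, eval₂_map, aeval_def]
    congr 1
    exact RingHom.ext fun x => by simp
  let y' : ι → integralClosure (MvPolynomial τ A) L := fun i => ⟨s • y i, (hsi i).tower_top⟩
  have hy'0 : ∑ i, j (C (b i)) * y' i = 0 := by
    apply Subtype.ext
    have : ∀ i, ((j (C (b i)) : integralClosure (MvPolynomial τ A) L) : L) = algebraMap A L (b i) := fun i => by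
      change algebraMap (MvPolynomial τ A) L _ = _
      rw [hm1, aeval_C]
    simp only [AddSubmonoidClass.coe_finsetSum, MulMemClass.coe_mul, this, y']
    simp only [mul_smul_comm, ← Finset.smul_sum, h, smul_zero, ZeroMemClass.coe_zero]
  obtain ⟨z, hz⟩ : ∃ z : integralClosure (MvPolynomial τ A) L, z = ∑ i, algebraMap (MvPolynomial τ A) (integralClosure (MvPolynomial τ A) L)
    (map (algebraMap K A) (C (φ (b i)))) * y' i := ⟨_, rfl⟩
  have hψz : ψ z = 0 := by
    rw [← map_zero ψ, ← hy'0, hz, map_sum, map_sum]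
    refine Finset.sum_congr rfl fun i _ => ?_
    rw [map_mul, map_mul, hψK, hψ', aeval_C, coe_eval₂Hom, eval₂_C]
    rfl
  have hzval : (z : L) = s • ∑ i, φ (b i) • y i := by
    rw [hz, AddSubmonoidClass.coe_finsetSum, Finset.smul_sum]
    refine Finset.sum_congr rfl fun i _ => ?_
    rw [MulMemClass.coe_mul]
    have : ((j (map (algebraMap K A) (C (φ (b i)))) : integralClosure (MvPolynomial τ A) L) : L)
        = algebraMap K L (φ (b i)) := by
      change algebraMap (MvPolynomial τ A) L _ = _
      rw [hm1, map_C, aeval_C, ← IsScalarTower.algebraMap_apply K A L]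
    rw [this]
    simp only [y', mul_smul_comm, Algebra.smul_def (φ _)]
  have hz0 : z ≠ 0 := by
    intro h0
    rw [h0, ZeroMemClass.coe_zero, Algebra.smul_def] at hzval
    rcases mul_eq_zero.1 hzval.symm with h1 | h1
    · exact hs0 (hinjK (by rw [h1, map_zero]))
    · exact hφ (Fintype.linearIndependent_iff.1 hy' _ h1 i)
  have hzint : IsIntegral (MvPolynomial τ K) (z : L) := by
    rw [hzval, Finset.smul_sum]
    refine IsIntegral.sum _ fun i _ => ?_
    have : s • φ (b i) • y i = (C (φ (b i)) : MvPolynomial τ K) • s • y i := by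
      rw [Algebra.smul_def (C _), hm2, aeval_C, ← Algebra.smul_def, Algebra.smul_def s,
        Algebra.smul_def s, mul_smul_comm]
    rw [this]
    exact (hsi i).smul _
  have hzB : IsAlgebraic (MvPolynomial τ K) z := by
    have : IsIntegral (MvPolynomial τ K) z := by
      refine (isIntegral_algHom_iff (IsScalarTower.toAlgHom (MvPolynomial τ K) (integralClosure (MvPolynomial τ A) L) L)
        Subtype.val_injective).1 hzint
    exact this.isAlgebraic
  obtain ⟨p, hp0, w, hw⟩ := hzB.exists_nonzero_dvd (mem_nonZeroDivisors_of_ne_zero hz0)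
  rw [hm4] at hw
  have h3 := congrArg ψ hw
  rw [hψK, map_mul, hψz, zero_mul] at h3
  exact hp0 (hinjK (by rw [hm2, h3, map_zero]))

/-- Linear disjointness of algebraically independent extensions of an algebraically closed
field, in the form of a vanishing criterion. -/
theorem eq_zero_of_sum_mul_eq_zero {K L ι τ : Type*} [Field K] [IsAlgClosed K] [Field L]
    [IsAlgClosed L] [Algebra K L] [Fintype ι] (b y : ι → L) (t : τ → L)
    (ht : AlgebraicIndependent (Algebra.adjoin K (Set.range b)) t)
    (hy : ∀ i, IsAlgebraic (Algebra.adjoin K (Set.range t)) (y i))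
    (hy' : LinearIndependent K y) (h : ∑ i, b i * y i = 0) (i : ι) : b i = 0 := by
  by_contra hi
  obtain ⟨φ, hφ⟩ := exists_specialisation (K := K) b i hi
  exact hφ (specialisation_eq_zero_of_sum_mul_eq_zero φ
    (fun i => ⟨b i, Algebra.subset_adjoin ⟨i, rfl⟩⟩) y t ht hy hy' h i)

/-- Kneser's inequality over an algebraically closed base field. -/
theorem finrank_add_finrank_le_finrank_mul_add_one {K L : Type*} [Field K] [IsAlgClosed K]
    [Field L] [Algebra K L] (r : ℕ) : ∀ (V W : Submodule K L), FiniteDimensional K V →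
    FiniteDimensional K W → V ≠ ⊥ → W ≠ ⊥ → Module.finrank K W ≤ r →
    Module.finrank K V + Module.finrank K W ≤ Module.finrank K ↥(V * W) + 1 := by
  induction r with
  | zero =>
    intro V W _ _ _ hW h
    exact absurd (Submodule.finrank_eq_zero.1 (Nat.le_zero.1 h)) hW
  | succ r ih =>
    intro V W hfV hfW hV hW h
    have hfVW : FiniteDimensional K ↥(V * W) := by
      exact Module.Finite.iff_fg.2 ((Module.Finite.iff_fg.1 hfV).mul (Module.Finite.iff_fg.1 hfW))
    obtain ⟨w₀, hw₀, hw₀0⟩ := Submodule.exists_mem_ne_zero_of_ne_bot hW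
    obtain ⟨v₀, hv₀, hv₀0⟩ := Submodule.exists_mem_ne_zero_of_ne_bot hV
    have hinj : ∀ a : L, a ≠ 0 → Function.Injective (LinearMap.mulLeft K a) := fun a ha =>
      mul_right_injective₀ ha
    by_cases hall : ∀ a ∈ V, W.map (LinearMap.mulLeft K a) ≤ V.map (LinearMap.mulLeft K w₀)
    · have hW1 : Module.finrank K W ≤ 1 := by
        refine finrank_le_one (⟨w₀, hw₀⟩ : W) fun ⟨w, hw⟩ => ?_
        have hend : ∀ a : V, w₀⁻¹ * w * (a : L) ∈ V := fun ⟨a, ha⟩ => by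
          obtain ⟨v, hv, hvw⟩ := hall a ha (Submodule.mem_map_of_mem hw)
          have : w₀ * v = a * w := hvw
          have : w₀⁻¹ * w * a = v := by field_simp; linear_combination -this
          rwa [this]
        let T : Module.End K V :=
          ((LinearMap.mulLeft K (w₀⁻¹ * w)).comp V.subtype).codRestrict V hend
        have : Nontrivial V := Submodule.nontrivial_iff_ne_bot.2 hV
        obtain ⟨c, hc⟩ := Module.End.exists_eigenvalue T
        obtain ⟨v, hv⟩ := hc.exists_hasEigenvector
        have h1 : w₀⁻¹ * w * (v : L) = c • (v : L) := congrArg Subtype.val hv.apply_eq_smul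
        have h2 : (v : L) ≠ 0 := fun h0 => hv.2 (Subtype.ext h0)
        refine ⟨c, Subtype.ext ?_⟩
        change c • w₀ = w
        rw [Algebra.smul_def] at h1 ⊢
        have h3 := mul_right_cancel₀ h2 h1
        rw [← h3]; field_simp
      have : Module.finrank K V ≤ Module.finrank K ↥(V * W) := by
        rw [(Submodule.equivMapOfInjective _ (hinj _ hw₀0) V).finrank_eq]
        refine Submodule.finrank_mono ?_
        rintro _ ⟨v, hv, rfl⟩
        rw [LinearMap.mulLeft_apply, mul_comm w₀ v]
        exact Submodule.mul_mem_mul hv hw₀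
      omega
    · push Not at hall
      obtain ⟨a, ha, haW⟩ := hall
      have ha0 : a ≠ 0 := by
        rintro rfl
        exact haW (by rintro _ ⟨w, -, rfl⟩; simp)
      obtain ⟨V₀, hV₀⟩ : ∃ V₀, V₀ = V.map (LinearMap.mulLeft K w₀) := ⟨_, rfl⟩
      obtain ⟨W₀, hW₀⟩ : ∃ W₀, W₀ = W.map (LinearMap.mulLeft K a) := ⟨_, rfl⟩
      obtain ⟨W', hW'⟩ : ∃ W', W' = W ⊓ V₀.comap (LinearMap.mulLeft K a) := ⟨_, rfl⟩
      have hfV₀ : FiniteDimensional K V₀ := by rw [hV₀]; infer_instance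
      have hfW₀ : FiniteDimensional K W₀ := by rw [hW₀]; infer_instance
      have hfW' : FiniteDimensional K W' := by rw [hW']; infer_instance
      have h1 : Module.finrank K V₀ = Module.finrank K V := by
        rw [hV₀]; exact (Submodule.equivMapOfInjective _ (hinj _ hw₀0) V).finrank_eq.symm
      have h2 : Module.finrank K W₀ = Module.finrank K W := by
        rw [hW₀]; exact (Submodule.equivMapOfInjective _ (hinj _ ha0) W).finrank_eq.symm
      have h3 : Module.finrank K ↥(V₀ ⊓ W₀) = Module.finrank K W' := by
        have : V₀ ⊓ W₀ = W'.map (LinearMap.mulLeft K a) := by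
          rw [hW', hW₀]
          ext z
          constructor
          · rintro ⟨h1, w, hw, rfl⟩
            exact ⟨w, ⟨hw, h1⟩, rfl⟩
          · rintro ⟨w, ⟨hw, h1⟩, rfl⟩
            exact ⟨h1, w, hw, rfl⟩
        rw [this]; exact (Submodule.equivMapOfInjective _ (hinj _ ha0) W').finrank_eq.symm
      have hlt : Module.finrank K W' < Module.finrank K W := by
        refine Submodule.finrank_lt_finrank_of_lt (lt_of_le_of_ne (hW' ▸ inf_le_left) ?_)
        rintro h4
        apply haW
        rw [← hV₀, Submodule.map_le_iff_le_comap]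
        rw [hW'] at h4
        exact inf_eq_left.1 h4
      have hw₀W' : w₀ ∈ W' := by
        rw [hW', hV₀]
        exact ⟨hw₀, ⟨a, ha, mul_comm _ _⟩⟩
      have key := ih (V₀ ⊔ W₀) W' inferInstance hfW'
        (fun h0 => by
          have : a * w₀ ∈ V₀ ⊔ W₀ := Submodule.mem_sup_right (hW₀ ▸ ⟨w₀, hw₀, rfl⟩)
          rw [h0, Submodule.mem_bot] at this
          exact mul_ne_zero ha0 hw₀0 this)
        (fun h0 => by rw [h0, Submodule.mem_bot] at hw₀W'; exact hw₀0 hw₀W') (by omega)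
      have hle : (V₀ ⊔ W₀) * W' ≤ (V * W).map (LinearMap.mulLeft K w₀) := by
        rw [Submodule.mul_le]
        intro x hx w hw
        rw [hW'] at hw
        obtain ⟨hwW, hwV⟩ := hw
        obtain ⟨x₁, hx₁, x₂, hx₂, rfl⟩ := Submodule.mem_sup.1 hx
        rw [add_mul]
        refine add_mem ?_ ?_
        · rw [hV₀] at hx₁
          obtain ⟨v, hv, rfl⟩ := hx₁
          exact ⟨v * w, Submodule.mul_mem_mul hv hwW, (mul_assoc _ _ _).symm⟩
        · rw [hW₀] at hx₂
          obtain ⟨u, hu, rfl⟩ := hx₂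
          rw [hV₀] at hwV
          obtain ⟨v, hv, hvw⟩ := hwV
          have hvw' : w₀ * v = a * w := hvw
          refine ⟨v * u, Submodule.mul_mem_mul hv hu, ?_⟩
          change w₀ * (v * u) = a * u * w
          linear_combination u * hvw'
      have hfin := Submodule.finrank_mono hle
      rw [← (Submodule.equivMapOfInjective _ (hinj _ hw₀0) (V * W)).finrank_eq] at hfin
      have := Submodule.finrank_sup_add_finrank_inf_eq V₀ W₀
      omega

theorem finrank_pow_ge {K L : Type*} [Field K] [IsAlgClosed K] [Field L] [Algebra K L] {k : ℕ}
    (V : Submodule K L) [FiniteDimensional K V] (hV : Module.finrank K V = k + 1) (j : ℕ) :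
    FiniteDimensional K ↥(V ^ j) ∧ k * j + 1 ≤ Module.finrank K ↥(V ^ j) := by
  induction j with
  | zero =>
    rw [pow_zero, Submodule.one_eq_span]
    exact ⟨inferInstance, by rw [finrank_span_singleton one_ne_zero]; omega⟩
  | succ j ih =>
    obtain ⟨h1, h2⟩ := ih
    rw [pow_succ]
    have h3 : FiniteDimensional K ↥(V ^ j * V) :=
      Module.Finite.iff_fg.2 ((Module.Finite.iff_fg.1 h1).mul (Module.Finite.iff_fg.1 inferInstance))
    refine ⟨h3, ?_⟩
    have hne : ∀ W : Submodule K L, 1 ≤ Module.finrank K W → W ≠ ⊥ := by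
      rintro W hW rfl
      simp at hW
    have := finrank_add_finrank_le_finrank_mul_add_one (k + 1) (V ^ j) V h1 inferInstance
      (hne _ (by omega)) (hne _ (by omega)) hV.le
    rw [mul_add]
    omega

/-- The space spanned by the values of all monomials of degree `j`. -/
def monoSpan (K : Type*) {L : Type*} {n : ℕ} [Field K] [Field L] [Algebra K L] (x : Fin n → L)
    (j : ℕ) : Submodule K L :=
  Submodule.span K ((fun m : Fin n →₀ ℕ => ∏ i, x i ^ m i) '' {m | m.degree = j})

theorem span_pow_le_monoSpan {K L : Type*} {n : ℕ} [Field K] [Field L] [Algebra K L]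
    (x : Fin n → L) (j : ℕ) : Submodule.span K (Set.range x) ^ j ≤ monoSpan K x j := by
  induction j with
  | zero =>
    rw [pow_zero, Submodule.one_eq_span, Submodule.span_singleton_le_iff_mem]
    exact Submodule.subset_span ⟨0, by simp, by simp⟩
  | succ j ih =>
    rw [pow_succ]
    refine (mul_le_mul_left ih _).trans ?_
    rw [monoSpan, Submodule.span_mul_span, Submodule.span_le]
    rintro _ ⟨_, ⟨m, hm, rfl⟩, _, ⟨i, rfl⟩, rfl⟩
    refine Submodule.subset_span ⟨m + Finsupp.single i 1, ?_, ?_⟩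
    · have : m.degree = j := hm
      simp [this]
    · simp only [Finsupp.add_apply, pow_add, Finset.prod_mul_distrib]
      congr 1
      rw [Finset.prod_eq_single i]
      · simp
      · intro b _ hb; simp [Finsupp.single_apply, hb.symm]
      · simp

instance {K L : Type*} {n : ℕ} [Field K] [Field L] [Algebra K L] (x : Fin n → L) (j : ℕ) :
    FiniteDimensional K (monoSpan K x j) := by
  refine FiniteDimensional.span_of_finite K (Set.Finite.image _ ?_)
  refine ((monos (Fin n) j j).finite_toSet).subset fun m hm => ?_
  have : m.degree = j := hm
  exact mem_monos.2 ⟨this.ge, this.le⟩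

theorem le_finrank_monoSpan {K L : Type*} {n k : ℕ} [Field K] [IsAlgClosed K] [Field L]
    [Algebra K L] (x : Fin n → L)
    (hk : k + 1 ≤ Module.finrank K ↥(Submodule.span K (Set.range x))) (j : ℕ) :
    k * j + 1 ≤ Module.finrank K (monoSpan K x j) := by
  obtain ⟨r, hr⟩ : ∃ r, Module.finrank K ↥(Submodule.span K (Set.range x)) = r + 1 :=
    ⟨Module.finrank K ↥(Submodule.span K (Set.range x)) - 1, by omega⟩
  have hfd : FiniteDimensional K ↥(Submodule.span K (Set.range x)) :=
    FiniteDimensional.span_of_finite K (Set.finite_range x)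
  have h1 := (finrank_pow_ge _ hr j).2
  have h2 := Submodule.finrank_mono (span_pow_le_monoSpan (K := K) x j)
  have h3 : k * j ≤ r * j := Nat.mul_le_mul_right j (by omega)
  omega

theorem mem_acl_iff_isAlgebraic_adjoin {S : Set ℂ} {x : ℂ} :
    x ∈ acl S ↔ IsAlgebraic (Algebra.adjoin ℚ S) x := by
  rw [mem_acl_iff, AlgebraicIndependent.matroid_closure_eq, SetLike.mem_coe,
    Subalgebra.mem_algebraicClosure]

theorem coe_mem_adjoin_acl {G T : Set ℂ} : ∀ z : Algebra.adjoin ℚ (G ∪ T), (z : ℂ) ∈ Algebra.adjoin (acl G) T := by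
    rintro ⟨z, hz⟩
    induction hz using Algebra.adjoin_induction with
    | mem z hz =>
      rcases hz with hz | hz
      · exact Subalgebra.algebraMap_mem (Algebra.adjoin (acl G) T) (⟨z, subset_acl G hz⟩ : acl G)
      · exact Algebra.subset_adjoin hz
    | algebraMap r =>
      have := Subalgebra.algebraMap_mem (Algebra.adjoin (acl G) T) (algebraMap ℚ (acl G) r)
      rw [← IsScalarTower.algebraMap_apply] at this
      exact this
    | add _ _ _ _ h1 h2 => exact add_mem h1 h2
    | mul _ _ _ _ h1 h2 => exact mul_mem h1 h2


theorem isAlgebraic_of_forall_mem {F L : Type*} [Field F] [Field L] [Algebra ℚ L] [Algebra F L] (A : Subalgebra ℚ L)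
   (B : Subalgebra F L) (h : ∀ z : A, (z : L) ∈ B) {x : L} (hx : IsAlgebraic A x) : IsAlgebraic B x := by
  let i : A →+* B := (A.val : _ →+* L).codRestrict B h
  letI := i.toAlgebra
  have : IsScalarTower A B L := IsScalarTower.of_algebraMap_eq fun _ => rfl
  refine hx.extendScalars (S := B) ?_
  intro a b hab
  exact Subtype.ext (congrArg (fun z : B => (z : L)) hab)

theorem isAlgebraic_adjoin_of_mem_acl {G T : Set ℂ} {x : ℂ} (hx : x ∈ acl (G ∪ T)) :
    IsAlgebraic (Algebra.adjoin (acl G) T) x := 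
  isAlgebraic_of_forall_mem _ _ coe_mem_adjoin_acl (mem_acl_iff_isAlgebraic_adjoin.1 hx)

theorem algebraicIndependent_acl {G : Set ℂ} (hG : G.Finite) {d : ℕ} {t : Fin d → ℂ}
    (h : algMat.eRk G + d ≤ algMat.eRk (G ∪ Set.range t)) : AlgebraicIndependent (acl G) t := by
  obtain ⟨I, hI⟩ := algMat.exists_isBasis G
  have hIf : I.Finite := hG.subset hI.subset
  have hcl : G ⊆ acl I := by
    rw [coe_acl]; exact hI.subset_closure
  let w : Fin d ⊕ I → ℂ := Sum.elim t Subtype.val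
  have hw : Set.range w = Set.range t ∪ I := by
    rw [Set.Sum.elim_range, Subtype.range_coe]
  have hfin : (Set.range w).Finite := by
    rw [hw]; exact (Set.finite_range t).union hIf
  have hIe : algMat.eRk G = I.encard := by
    rw [hI.eRk_eq_encard]
  have h1 : I.encard + d ≤ algMat.eRk (Set.range w) := by
    rw [← hIe]
    refine h.trans (eRk_le_of_subset_acl ?_)
    rw [hw]
    refine Set.union_subset ?_ (Set.subset_union_left.trans (subset_acl _))
    exact hcl.trans (acl_mono Set.subset_union_right)
  have h2 : (Set.range w).encard ≤ I.encard + d := by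
    rw [hw, add_comm]
    refine (Set.encard_union_le _ _).trans (add_le_add_left ?_ _)
    rw [← Set.image_univ]
    refine (Set.encard_image_le _ _).trans ?_
    simp
  have h3 : (Set.range w).encard = I.encard + d :=
    le_antisymm h2 (h1.trans (algMat.eRk_le_encard _))
  have hind : algMat.Indep (Set.range w) := by
    rw [algMat.indep_iff_eRk_eq_encard_of_finite hfin]
    exact le_antisymm (algMat.eRk_le_encard _) (h3.trans_le h1)
  have hinj : Function.Injective w := by
    have := hIf.to_subtype
    have := Fintype.ofFinite I
    rw [← Set.injOn_univ]
    refine Set.finite_univ.injOn_of_encard_image_eq ?_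
    rw [Set.image_univ, h3, Set.encard_univ, ENat.card_sum, add_comm]
    simp [ENat.card_coe_set_eq]
  have hAI : AlgebraicIndependent ℚ w := by
    rw [AlgebraicIndependent.matroid_indep_iff] at hind
    exact (algebraicIndependent_subtype_range hinj).1 hind
  have hAI2 := (AlgebraicIndependent.sumElim_iff.1 hAI).2
  rw [Subtype.range_coe] at hAI2
  have hle : ∀ z : Algebra.adjoin ℚ I, (z : ℂ) ∈ acl G := fun z =>
    acl_mono hI.subset (mem_acl_iff_isAlgebraic_adjoin.2 (isAlgebraic_algebraMap z))
  let i : Algebra.adjoin ℚ I →+* acl G :=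
    ((Algebra.adjoin ℚ I).val : _ →+* ℂ).codRestrict (acl G) hle
  letI := i.toAlgebra
  have : IsScalarTower (Algebra.adjoin ℚ I) (acl G) ℂ :=
    IsScalarTower.of_algebraMap_eq fun _ => rfl
  have : Algebra.IsAlgebraic (Algebra.adjoin ℚ I) (acl G) := ⟨fun z => by
    have hz : (z : ℂ) ∈ acl I := acl_le_iff.2 hcl z.2
    rw [mem_acl_iff_isAlgebraic_adjoin] at hz
    exact (isAlgebraic_algebraMap_iff (algebraMap (acl G) ℂ).injective).1 hz⟩
  exact hAI2.extendScalars (acl G)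

theorem exists_transcendence_basis_in {G X : Set ℂ} (hG : G.Finite) (hX : X.Finite) {d : ℕ}
    (h : algMat.eRk (G ∪ X) = algMat.eRk G + d) :
    ∃ t : Fin d → ℂ, Set.range t ⊆ X ∧ X ⊆ acl (G ∪ Set.range t) := by
  obtain ⟨I, hI⟩ := algMat.exists_isBasis G
  obtain ⟨I', hI', hII'⟩ := hI.indep.subset_isBasis_of_subset
    (hI.subset.trans (Set.subset_union_left (t := X)))
  have hI'f : I'.Finite := (hG.union hX).subset hI'.subset
  have hcard : (I' \ I).encard = d := by
    rw [hI'.eRk_eq_encard, hI.eRk_eq_encard, ← Set.encard_sdiff_add_encard_of_subset hII',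
      add_comm] at h
    have : I.encard ≠ ⊤ := Set.encard_ne_top_iff.2 (hI'f.subset hII')
    exact WithTop.add_left_cancel this h
  have hfin : (I' \ I).Finite := hI'f.subset Set.sdiff_subset
  obtain ⟨t, ht⟩ : ∃ t : Fin d → ℂ, Set.range t = I' \ I := by
    have := hfin.to_subtype
    have hc : Nat.card ↥(I' \ I) = d := by
      rw [Nat.card_coe_set_eq, Set.ncard, hcard]; rfl
    refine ⟨fun i => ((Finite.equivFinOfCardEq hc).symm i : ↥(I' \ I)), ?_⟩
    ext z
    constructor
    · rintro ⟨i, rfl⟩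
      exact Subtype.prop _
    · intro hz
      exact ⟨Finite.equivFinOfCardEq hc ⟨z, hz⟩, by simp⟩
  refine ⟨t, ?_, ?_⟩
  · rw [ht]
    rintro z ⟨hz, hzI⟩
    rcases hI'.subset hz with hzG | hzX
    · exact absurd (hI.mem_of_insert_indep hzG
        (hI'.indep.subset (Set.insert_subset hz hII'))) hzI
    · exact hzX
  · rw [ht]
    intro z hz
    have : z ∈ acl I' := by
      rw [mem_acl_iff]; exact hI'.subset_closure (Or.inr hz)
    refine acl_mono ?_ this
    intro u hu
    by_cases huI : u ∈ I
    · exact Or.inl (hI.subset huI)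
    · exact Or.inr ⟨hu, huI⟩

theorem algebraicIndependent_adjoin_of_le {F L τ : Type*} [Field F] [Field L] [Algebra ℚ L]
    [Algebra F L] (B : Subalgebra F L) (E : IntermediateField ℚ L) (h : ∀ z : B, (z : L) ∈ E)
    {t : τ → L} (ht : AlgebraicIndependent E t) : AlgebraicIndependent B t := by
  let i : B →+* E := (B.val : _ →+* L).codRestrict E h
  letI := i.toAlgebra
  have : IsScalarTower B E L := IsScalarTower.of_algebraMap_eq fun _ => rfl
  refine ht.restrictScalars ?_
  intro a b hab
  exact Subtype.ext (congrArg (fun z : E => (z : L)) hab)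

theorem coe_mem_acl_of_forall_mem {G H : Set ℂ} {ι : Type*} {b : ι → ℂ} (hGH : G ⊆ H)
    (hb : ∀ i, b i ∈ acl H) : ∀ z : Algebra.adjoin (acl G) (Set.range b), (z : ℂ) ∈ acl H := by
  rintro ⟨z, hz⟩
  induction hz using Algebra.adjoin_induction with
  | mem z hz =>
    obtain ⟨i, rfl⟩ := hz
    exact hb i
  | algebraMap r => exact acl_mono hGH r.2
  | add _ _ _ _ h1 h2 => exact add_mem h1 h2
  | mul _ _ _ _ h1 h2 => exact mul_mem h1 h2

/-- If a form of degree `j` with coefficients `a` vanishes at `x`, and `a` does not lower the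
transcendence degree of `x`, then the coefficients satisfy as many independent relations as
there are linearly independent monomials at `x`. -/
theorem eRk_add_finrank_monoSpan_le {n j d : ℕ} {G : Set ℂ} (hG : G.Finite) (x : Fin n → ℂ)
    (a : monos (Fin n) j j → ℂ) (hax : ∑ m, a m * ∏ i, x i ^ (m : Fin n →₀ ℕ) i = 0)
    (h1 : algMat.eRk (G ∪ Set.range x) = algMat.eRk G + d)
    (h2 : algMat.eRk (G ∪ Set.range a) + d ≤ algMat.eRk (G ∪ Set.range a ∪ Set.range x)) :
    algMat.eRk (G ∪ Set.range a) + Module.finrank (acl G) (monoSpan (acl G) x j) ≤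
      algMat.eRk G + (monos (Fin n) j j).card := by
  classical
  obtain ⟨t, htx, hxt⟩ := exists_transcendence_basis_in hG (Set.finite_range x) h1
  have hAI : AlgebraicIndependent (acl (G ∪ Set.range a)) t := by
    refine algebraicIndependent_acl (hG.union (Set.finite_range a)) (h2.trans ?_)
    refine eRk_le_of_subset_acl (Set.union_subset (Set.subset_union_left.trans (subset_acl _)) ?_)
    exact hxt.trans (acl_mono (Set.union_subset_union_left _ Set.subset_union_left))
  obtain ⟨v, hv⟩ : ∃ v : monos (Fin n) j j → ℂ, ∀ m, v m = ∏ i, x i ^ (m : Fin n →₀ ℕ) i :=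
    ⟨_, fun _ => rfl⟩
  have hspan : monoSpan (acl G) x j = Submodule.span (acl G) (Set.range v) := by
    rw [monoSpan]
    congr 1
    ext z
    constructor
    · rintro ⟨m, hm, rfl⟩
      have : m.degree = j := hm
      exact ⟨⟨m, mem_monos.2 ⟨this.ge, this.le⟩⟩, hv _⟩
    · rintro ⟨⟨m, hm⟩, rfl⟩
      have hm' := mem_monos.1 hm
      exact ⟨m, le_antisymm hm'.2 hm'.1, (hv ⟨m, hm⟩).symm⟩
  obtain ⟨κ, α, hα, hκ, hli⟩ := exists_linearIndependent' (acl G) v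
  have : Finite κ := Finite.of_injective α hα
  have := Fintype.ofFinite κ
  have hcard : Module.finrank (acl G) (monoSpan (acl G) x j) = Fintype.card κ := by
    rw [hspan, ← hκ, finrank_span_eq_card hli]
  have hc : ∀ m, ∃ c : κ → acl G, ∑ i, c i • (v ∘ α) i = v m := fun m => by
    rw [← Submodule.mem_span_range_iff_exists_fun, hκ]
    exact Submodule.subset_span ⟨m, rfl⟩
  choose c hc using hc
  obtain ⟨R, hR⟩ : ∃ R : Finset (monos (Fin n) j j), R = Finset.univ.image α := ⟨_, rfl⟩
  have hRcard : R.card = Fintype.card κ := by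
    rw [hR, Finset.card_image_of_injective _ hα, Finset.card_univ]
  obtain ⟨b, hb⟩ : ∃ b : κ → ℂ, ∀ i, b i = a (α i) + ∑ m ∈ Rᶜ, a m * (c m i : ℂ) :=
    ⟨_, fun _ => rfl⟩
  have hsum : ∑ i, b i * (v ∘ α) i = 0 := by
    rw [← hax, ← Finset.sum_add_sum_compl R]
    simp only [hb, add_mul, Finset.sum_add_distrib, Finset.sum_mul]
    congr 1
    · rw [hR, Finset.sum_image hα.injOn]
      exact Finset.sum_congr rfl fun i _ => by rw [← hv]; rfl
    · rw [Finset.sum_comm]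
      refine Finset.sum_congr rfl fun m _ => ?_
      rw [← hv, ← hc m, Finset.mul_sum]
      exact Finset.sum_congr rfl fun i _ => by rw [mul_assoc]; rfl
  have hbG : ∀ i, b i ∈ acl (G ∪ Set.range a) := fun i => by
    rw [hb]
    refine add_mem (subset_acl _ (Or.inr ⟨_, rfl⟩)) (sum_mem fun m _ => mul_mem
      (subset_acl _ (Or.inr ⟨_, rfl⟩)) (acl_mono Set.subset_union_left (c m i).2))
  have hb0 : ∀ i, b i = 0 := eq_zero_of_sum_mul_eq_zero (K := acl G) b (v ∘ α) t
    (algebraicIndependent_adjoin_of_le _ _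
      (coe_mem_acl_of_forall_mem Set.subset_union_left hbG) hAI)
    (fun i => isAlgebraic_adjoin_of_mem_acl (by
      rw [Function.comp_apply, hv]
      exact prod_mem fun l _ => pow_mem (hxt ⟨l, rfl⟩) _)) hli hsum
  have hsub : G ∪ Set.range a ⊆ acl (G ∪ a '' (Rᶜ : Finset _)) := by
    refine Set.union_subset (Set.subset_union_left.trans (subset_acl _)) ?_
    rintro _ ⟨m, rfl⟩
    by_cases hm : m ∈ R
    · rw [hR, Finset.mem_image] at hm
      obtain ⟨i, -, rfl⟩ := hm
      have := hb0 i
      rw [hb, add_eq_zero_iff_eq_neg] at this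
      rw [this]
      exact neg_mem (sum_mem fun m hm => mul_mem (subset_acl _ (Or.inr ⟨m, hm, rfl⟩))
        (acl_mono Set.subset_union_left (c m i).2))
    · exact subset_acl _ (Or.inr ⟨m, by simpa using hm, rfl⟩)
  have h3 : algMat.eRk (G ∪ Set.range a) ≤ algMat.eRk G + (Rᶜ.card : ℕ) := by
    refine (eRk_le_of_subset_acl hsub).trans ((algMat.eRk_union_le_eRk_add_encard _ _).trans ?_)
    gcongr
    refine (Set.encard_image_le _ _).trans ?_
    rw [Set.encard_coe_eq_coe_finsetCard]
  have h4 : Rᶜ.card + Fintype.card κ = (monos (Fin n) j j).card := by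
    rw [← hRcard, add_comm, Finset.card_add_card_compl, Fintype.card_coe]
  rw [hcard, ← h4]
  push_cast
  rw [← add_assoc]
  gcongr

theorem choose_two_le_choose {N j : ℕ} (h2 : 2 ≤ j) (hj : j + 2 ≤ N) :
    N.choose 2 ≤ N.choose j := by
  induction N generalizing j with
  | zero => omega
  | succ N ih =>
    obtain rfl | h2' := h2.eq_or_lt
    · exact le_rfl
    obtain h | h := hj.eq_or_lt
    · rw [← Nat.choose_symm_of_eq_add (show N + 1 = j + 2 by omega)]
    · obtain ⟨i, rfl⟩ : ∃ i, j = i + 1 := ⟨j - 1, by omega⟩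
      rw [Nat.choose_succ_succ N i, Nat.choose_succ_succ N 1]
      have h3 := ih (j := i) (by omega) (by omega)
      have h4 := ih (j := i + 1) (by omega) (by omega)
      have h5 : N.choose 1 ≤ N.choose 2 := by
        rw [Nat.choose_one_right, Nat.choose_two_right, Nat.le_div_iff_mul_le two_pos]
        exact Nat.mul_le_mul_left _ (by omega)
      simp only [Nat.succ_eq_add_one, Nat.reduceAdd] at *
      omega

theorem sum_range_add_two_le_sum (s : Finset ℕ) (hs : ∀ j ∈ s, 2 ≤ j) :
    ∑ i ∈ Finset.range s.card, (i + 2) ≤ ∑ j ∈ s, j := by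
  induction s using Finset.induction_on_max with
  | empty => simp
  | insert a s ha ih =>
    have hna : a ∉ s := fun h => (ha a h).false
    rw [Finset.card_insert_of_notMem hna, Finset.sum_range_succ, Finset.sum_insert hna, add_comm]
    refine add_le_add ?_ (ih fun j hj => hs j (Finset.mem_insert_of_mem hj))
    have : s ⊆ Finset.Ico 2 a := fun j hj =>
      Finset.mem_Ico.2 ⟨hs j (Finset.mem_insert_of_mem hj), ha j hj⟩
    have h1 := Finset.card_le_card this
    rw [Nat.card_Ico] at h1
    have := hs a (Finset.mem_insert_self _ _)
    omega

/-- The total loss forced by the steps at which an antitone sequence is stationary. -/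
theorem le_sum_of_stationary {n k e : ℕ} (hn : 7 ≤ n) (hk : 1 ≤ k) (hke : n = k + 1 + e)
    (d h : ℕ → ℕ) (hd1 : d 1 ≤ k + 1) (hdn : 2 ≤ d n)
    (hd : ∀ j, 2 ≤ j → j ≤ n → d j ≤ d (j - 1))
    (h1 : ∀ j, 2 ≤ j → j ≤ n → d j = d (j - 1) → k * j + 1 ≤ h j)
    (h2 : ∀ j, 2 ≤ j → j ≤ n → d j = d (j - 1) → (d j + j - 1).choose j ≤ h j) :
    e * (k + 1) + (n - 5) * (n - 4) / 2 ≤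
      ∑ j ∈ (Finset.Icc 2 n).filter (fun j => d j = d (j - 1)), h j := by
  classical
  obtain ⟨F, hF⟩ : ∃ F, F = (Finset.Icc 2 n).filter (fun j => d j = d (j - 1)) := ⟨_, rfl⟩
  rw [← hF]
  have hmem : ∀ j, j ∈ F ↔ 2 ≤ j ∧ j ≤ n ∧ d j = d (j - 1) := fun j => by
    rw [hF, Finset.mem_filter, Finset.mem_Icc, and_assoc]
  have hdrop : ∀ i, ∀ j, 1 ≤ j → j + i ≤ n →
      d (j + i) + i ≤ d j + ((Finset.Icc (j + 1) (j + i)).filter (· ∈ F)).card := by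
    intro i
    induction i with
    | zero => intro j _ _; simp
    | succ i ih =>
      intro j hj hji
      have h3 := ih j hj (by omega)
      have h4 := hd (j + i + 1) (by omega) (by omega)
      rw [Nat.add_sub_cancel] at h4
      rw [← add_assoc j i 1, ← Finset.insert_Icc_right_eq_Icc_add_one (by omega), Finset.filter_insert]
      by_cases h5 : j + i + 1 ∈ F
      · rw [if_pos h5, Finset.card_insert_of_notMem (by simp)]
        omega
      · rw [if_neg h5]
        rw [hmem, Nat.add_sub_cancel] at h5
        omega
  have hcard : e + 1 ≤ F.card := by
    have h3 := hdrop (n - 1) 1 le_rfl (by omega)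
    have h4 : ((Finset.Icc (1 + 1) (1 + (n - 1))).filter (· ∈ F)).card ≤ F.card :=
      Finset.card_le_card fun j hj => (Finset.mem_filter.1 hj).2
    rw [show 1 + (n - 1) = n by omega] at *
    omega
  have hne : F.Nonempty := Finset.card_pos.1 (by omega)
  obtain ⟨J, hJ⟩ : ∃ J, J = F.max' hne := ⟨_, rfl⟩
  have hJF : J ∈ F := hJ ▸ F.max'_mem hne
  obtain ⟨hJ2, hJn, hJd⟩ := (hmem J).1 hJF
  have herase : e ≤ (F.erase J).card := by
    rw [Finset.card_erase_of_mem hJF]; omega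
  have hc : 2 * ((n - 5) * (n - 4) / 2) ≤ (n - 5) * (n - 4) := Nat.mul_div_le _ _
  rw [← Finset.sum_erase_add _ _ hJF]
  obtain hlt | rfl := hJn.lt_or_eq
  · have hdJ : n - J + 2 ≤ d J := by
      have h3 := hdrop (n - J) J (by omega) (by omega)
      rw [Finset.filter_false_of_mem, Finset.card_empty, show J + (n - J) = n by omega] at h3
      · omega
      · intro j hj hjF
        have := F.le_max' j hjF
        rw [Finset.mem_Icc] at hj
        omega
    refine add_le_add ?_ ?_
    · refine (Nat.mul_le_mul_right _ herase).trans ?_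
      rw [← smul_eq_mul]
      refine Finset.card_nsmul_le_sum _ _ _ fun j hj => ?_
      obtain ⟨h3, h4, h5⟩ := (hmem j).1 (Finset.mem_of_mem_erase hj)
      refine le_trans ?_ (h1 j h3 h4 h5)
      nlinarith
    · refine le_trans ?_ (h2 J hJ2 hJn hJd)
      have h6 : (n + 1).choose J ≤ (d J + J - 1).choose J := Nat.choose_le_choose _ (by omega)
      refine le_trans ?_ h6
      refine le_trans ?_ (choose_two_le_choose hJ2 (by omega))
      rw [Nat.choose_two_right]
      refine Nat.div_le_div_right ?_
      exact (Nat.mul_le_mul (by omega) (by omega) : (n - 5) * (n - 4) ≤ n * n).trans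
        (Nat.mul_le_mul (by omega) (by omega))
  · have h3 : ∑ j ∈ F.erase J, (k * j + 1) ≤ ∑ j ∈ F.erase J, h j :=
      Finset.sum_le_sum fun j hj => by
        obtain ⟨h3, h4, h5⟩ := (hmem j).1 (Finset.mem_of_mem_erase hj)
        exact h1 j h3 h4 h5
    have h4 := h1 J hJ2 hJn hJd
    have h5 := sum_range_add_two_le_sum (F.erase J)
      fun j hj => ((hmem j).1 (Finset.mem_of_mem_erase hj)).1
    have h6 : ∑ i ∈ Finset.range e, (i + 2) ≤ ∑ i ∈ Finset.range (F.erase J).card, (i + 2) :=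
      Finset.sum_le_sum_of_subset (Finset.range_subset_range.2 herase)
    have h7 : (∑ i ∈ Finset.range e, (i + 2)) * 2 = e * e + 3 * e := by
      clear * -
      induction e with
      | zero => rfl
      | succ e ih => rw [Finset.sum_range_succ, add_mul, ih]; ring
    rw [Finset.sum_add_distrib, ← Finset.mul_sum, Finset.sum_const, smul_eq_mul, mul_one] at h3
    have h8 : k * (∑ i ∈ Finset.range e, (i + 2)) ≤ k * ∑ j ∈ F.erase J, j :=
      Nat.mul_le_mul_left _ (h6.trans h5)
    have h9 : k * (e * e + 3 * e) = 2 * (k * ∑ i ∈ Finset.range e, (i + 2)) := by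
      rw [← h7]; ring
    obtain ⟨s, hs⟩ : ∃ s, J = s + 7 := ⟨J - 7, by omega⟩
    have h10 : (J - 5) * (J - 4) = (s + 2) * (s + 3) := by congr 1 <;> omega
    have h11 : s + 6 = k + e := by omega
    rw [h10] at *
    have h12 : 2 * (e * (k + 1)) + (s + 2) * (s + 3) ≤
        k * (e * e + 3 * e) + 2 * e + 2 * (k * J + 1) := by
      have hJ' : J = k + e + 1 := by omega
      rw [hJ']
      zify at h11 hk ⊢
      have : (s : ℤ) = k + e - 6 := by linarith
      rw [this]
      nlinarith [mul_nonneg (sub_nonneg.2 hk) (sq_nonneg (e : ℤ)),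
        mul_nonneg (Int.natCast_nonneg k) (Int.natCast_nonneg e), sq_nonneg ((k : ℤ) - 1), Int.natCast_nonneg e]
    omega

theorem choose_le_finrank_monoSpan {K L : Type*} {n d : ℕ} [Field K] [Field L] [Algebra K L]
    (x : Fin n → L) {t : Fin d → L} (htx : Set.range t ⊆ Set.range x)
    (ht : AlgebraicIndependent K t) (hd : d ≠ 0) (j : ℕ) :
    (d + j - 1).choose j ≤ Module.finrank K (monoSpan K x j) := by
  choose s hs using fun i => htx ⟨i, rfl⟩
  have hv : LinearIndependent K fun m : Fin d →₀ ℕ => ∏ i, t i ^ m i := by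
    have h1 := (basisMonomials (Fin d) K).linearIndependent.map' (aeval (R := K) t).toLinearMap
      (LinearMap.ker_eq_bot.2 ht)
    have h2 : (fun m : Fin d →₀ ℕ => ∏ i, t i ^ m i) =
        (aeval (R := K) t).toLinearMap ∘ basisMonomials (Fin d) K := by
      ext m
      simp [aeval_monomial, Finsupp.prod_fintype]
    rw [h2]
    exact h1
  have hmem : ∀ m : monos (Fin d) j j, ∏ i, t i ^ (m : Fin d →₀ ℕ) i ∈ monoSpan K x j := by
    rintro ⟨m, hm⟩
    rw [mem_monos] at hm
    refine Submodule.subset_span ⟨m.mapDomain s, ?_, ?_⟩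
    · change (m.mapDomain s).degree = j
      rw [Finsupp.degree_mapDomain]
      omega
    · have := Finsupp.prod_mapDomain_index (f := s) (s := m) (h := fun i k => x i ^ k)
        (fun _ => pow_zero _) (fun _ _ _ => pow_add _ _ _)
      rw [Finsupp.prod_fintype _ _ (fun _ => pow_zero _),
        Finsupp.prod_fintype _ _ (fun _ => pow_zero _)] at this
      exact this.trans (Finset.prod_congr rfl fun i _ => by rw [hs])
  have hli : LinearIndependent K fun m : monos (Fin d) j j =>
      (⟨_, hmem m⟩ : monoSpan K x j) :=
    LinearIndependent.of_comp (monoSpan K x j).subtype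
      (hv.comp (fun m : monos (Fin d) j j => (m : Fin d →₀ ℕ)) Subtype.val_injective)
  have := hli.fintype_card_le_finrank
  rwa [Fintype.card_coe, card_monos_self _ _ hd] at this

theorem linearIndependent_of_le {E F : IntermediateField ℚ ℂ} (h : E ≤ F) {ι : Type*} {v : ι → ℂ}
    (hv : LinearIndependent F v) : LinearIndependent E v := by
  letI := (IntermediateField.inclusion h).toRingHom.toAlgebra
  have : IsScalarTower E F ℂ := IsScalarTower.of_algebraMap_eq fun _ => rfl
  refine hv.restrict_scalars ?_
  intro a b hab
  have : (a : ℂ) = b := by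
    have := congrArg (fun z : F => (z : ℂ)) hab
    change (a : ℂ) * 1 = (b : ℂ) * 1 at this
    simpa only [mul_one] using this
  exact Subtype.ext this

theorem eval_homogeneousComponent_eq_sum {n : ℕ} (j : ℕ) (f : MvPolynomial (Fin n) ℂ)
    (x : Fin n → ℂ) : eval x (homogeneousComponent j f) =
      ∑ m : monos (Fin n) j j, coeff (m : Fin n →₀ ℕ) f * ∏ i, x i ^ (m : Fin n →₀ ℕ) i := by
  classical
  rw [eval_eq', Finset.sum_coe_sort (monos (Fin n) j j)
    fun m : Fin n →₀ ℕ => coeff m f * ∏ i, x i ^ m i]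
  refine (Finset.sum_subset (s₂ := monos (Fin n) j j) ?_ ?_).trans
    (Finset.sum_congr rfl fun m hm => ?_)
  · intro m hm
    rw [mem_support_iff, coeff_homogeneousComponent] at hm
    have : m.degree = j := by by_contra h; exact hm (if_neg h)
    exact mem_monos.2 ⟨this.ge, this.le⟩
  · intro m _ hm
    rw [notMem_support_iff.1 hm, zero_mul]
  · rw [mem_monos] at hm
    rw [coeff_homogeneousComponent, if_pos (le_antisymm hm.2 hm.1)]

/-- The dimension of the span of the monomials of degree `j` at `x`, over the algebraic closure
of `ℚ(G)`. -/
def monoRank {n : ℕ} (G : Set ℂ) (x : Fin n → ℂ) (j : ℕ) : ℕ :=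
  Module.finrank (acl G) (monoSpan (acl G) x j)

/-- The coefficients of `f` of degrees between two and `j`. -/
def coeffSet {n : ℕ} (f : MvPolynomial (Fin n) ℂ) (j : ℕ) : Set ℂ :=
  Set.range fun m : monos (Fin n) 2 j => coeff (m : Fin n →₀ ℕ) f

theorem finite_coeffSet {n : ℕ} (f : MvPolynomial (Fin n) ℂ) (j : ℕ) : (coeffSet f j).Finite :=
  Set.finite_range _

theorem coeffSet_mono {n : ℕ} (f : MvPolynomial (Fin n) ℂ) {i j : ℕ} (h : i ≤ j) :
    coeffSet f i ⊆ coeffSet f j := by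
  rintro _ ⟨⟨m, hm⟩, rfl⟩
  have := mem_monos.1 hm
  exact ⟨⟨m, mem_monos.2 ⟨this.1, this.2.trans h⟩⟩, rfl⟩

theorem coeffSet_succ {n : ℕ} (f : MvPolynomial (Fin n) ℂ) {j : ℕ} (h : 1 ≤ j) :
    coeffSet f (j + 1) = coeffSet f j ∪
      Set.range fun m : monos (Fin n) (j + 1) (j + 1) => coeff (m : Fin n →₀ ℕ) f := by
  ext z
  constructor
  · rintro ⟨⟨m, hm⟩, rfl⟩
    have h1 := mem_monos.1 hm
    by_cases h2 : m.degree ≤ j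
    · exact Or.inl ⟨⟨m, mem_monos.2 ⟨h1.1, h2⟩⟩, rfl⟩
    · exact Or.inr ⟨⟨m, mem_monos.2 ⟨by omega, h1.2⟩⟩, rfl⟩
  · rintro (hz | ⟨⟨m, hm⟩, rfl⟩)
    · exact coeffSet_mono f (by omega) hz
    · have h1 := mem_monos.1 hm
      exact ⟨⟨m, mem_monos.2 ⟨by omega, h1.2⟩⟩, rfl⟩

theorem exists_natCast_eq_eRk {S : Set ℂ} (hS : S.Finite) : ∃ u : ℕ, (u : ℕ∞) = algMat.eRk S := by
  have : algMat.eRk S ≠ ⊤ :=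
    ne_top_of_le_ne_top (Set.encard_ne_top_iff.2 hS) (algMat.eRk_le_encard S)
  exact ENat.ne_top_iff_exists.1 this

theorem eRk_union_range_le {S : Set ℂ} {ι : Type*} [Fintype ι] (v : ι → ℂ) :
    algMat.eRk (S ∪ Set.range v) ≤ algMat.eRk S + Fintype.card ι := by
  refine (algMat.eRk_union_le_eRk_add_encard _ _).trans ?_
  gcongr
  rw [← Set.image_univ]
  refine (Set.encard_image_le _ _).trans ?_
  simp

theorem card_monos_succ {τ : Type*} [Finite τ] {a b : ℕ} (hab : a ≤ b + 1) :
    (monos τ a (b + 1)).card = (monos τ a b).card + (monos τ (b + 1) (b + 1)).card := by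
  classical
  rw [← Finset.card_union_of_disjoint]
  · congr 1
    ext m
    simp only [Finset.mem_union, mem_monos]
    omega
  · rw [Finset.disjoint_left]
    intro m
    simp only [mem_monos]
    omega

/-- If the forms of degrees `2, …, n` of `f` have a common zero `x` whose coordinates have
transcendence degree at least two over the coefficients, then the coefficients satisfy many
independent algebraic relations. -/
theorem eRk_coeffSet_add_le {n : ℕ} (hn : 7 ≤ n) (f : MvPolynomial (Fin n) ℂ) (x : Fin n → ℂ)
    (hx : ∀ j, 2 ≤ j → j ≤ n → eval x (homogeneousComponent j f) = 0)
    (h : algMat.eRk (coeffSet f (n + 1)) + 2 ≤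
      algMat.eRk (coeffSet f (n + 1) ∪ Set.range x)) :
    algMat.eRk (coeffSet f (n + 1)) + ((n - 5) * (n - 4) / 2 : ℕ) ≤
      (monos (Fin n) 2 (n + 1)).card := by
  classical
  obtain ⟨R, hR⟩ : ∃ R, R = coeffSet f (n + 1) := ⟨_, rfl⟩
  rw [← hR] at h
  obtain ⟨κ, α, hα, hκ, hli⟩ := exists_linearIndependent' (acl R) x
  have : Finite κ := Finite.of_injective α hα
  have := Fintype.ofFinite κ
  have hc : ∀ i, ∃ c : κ → acl R, ∑ t, c t • (x ∘ α) t = x i := fun i => by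
    rw [← Submodule.mem_span_range_iff_exists_fun, hκ]
    exact Submodule.subset_span ⟨i, rfl⟩
  choose c hc using hc
  obtain ⟨Λ, hΛ⟩ : ∃ Λ : Set ℂ, Λ = Set.range fun p : {i // i ∉ Set.range α} × κ =>
    (c p.1 p.2 : ℂ) := ⟨_, rfl⟩
  have hΛR : Λ ⊆ acl R := by
    rw [hΛ]
    rintro _ ⟨p, rfl⟩
    exact (c p.1 p.2).2
  have hxΛ : Set.range x ⊆ acl (Λ ∪ Set.range (x ∘ α)) := by
    rintro _ ⟨i, rfl⟩
    by_cases hi : i ∈ Set.range α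
    · obtain ⟨t, rfl⟩ := hi
      exact subset_acl _ (Or.inr ⟨t, rfl⟩)
    · rw [← hc i]
      refine sum_mem fun t _ => mul_mem (subset_acl _ (Or.inl ?_)) (subset_acl _ (Or.inr ⟨t, rfl⟩))
      rw [hΛ]
      exact ⟨(⟨i, hi⟩, t), rfl⟩
  have hΛf : Λ.Finite := by rw [hΛ]; exact Set.finite_range _
  have hcardκ : Fintype.card κ ≤ n := by
    simpa using Fintype.card_le_of_injective α hα
  have hcompl : Fintype.card {i // i ∉ Set.range α} = n - Fintype.card κ := by
    rw [Fintype.card_subtype_compl, Fintype.card_fin]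
    congr 1
    exact Fintype.card_congr (Equiv.ofInjective α hα).symm
  have hu' : ∀ j, ∃ u : ℕ, (u : ℕ∞) = algMat.eRk (Λ ∪ coeffSet f j) := fun j =>
    exists_natCast_eq_eRk (hΛf.union (finite_coeffSet f j))
  choose u hu using hu'
  have hv' : ∀ j, ∃ v : ℕ, (v : ℕ∞) = algMat.eRk (Λ ∪ coeffSet f j ∪ Set.range x) := fun j =>
    exists_natCast_eq_eRk ((hΛf.union (finite_coeffSet f j)).union (Set.finite_range x))
  choose v hv using hv'
  have huv : ∀ j, u j ≤ v j := fun j => by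
    have := algMat.eRk_mono (Set.subset_union_left (s := Λ ∪ coeffSet f j) (t := Set.range x))
    rw [← hu, ← hv] at this
    exact_mod_cast this
  have hvκ : ∀ j, v j ≤ u j + Fintype.card κ := fun j => by
    have h1 := (eRk_le_of_subset_acl (S := Λ ∪ coeffSet f j ∪ Set.range x)
      (T := Λ ∪ coeffSet f j ∪ Set.range (x ∘ α)) (Set.union_subset
        (Set.subset_union_left.trans (subset_acl _)) (hxΛ.trans (acl_mono
          (Set.union_subset_union_left _ Set.subset_union_left))))).trans
      (eRk_union_range_le (x ∘ α))
    rw [← hu, ← hv] at h1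
    exact_mod_cast h1
  have hsub : ∀ j, v (j + 1) + u j ≤ u (j + 1) + v j := fun j => by
    have h1 := algMat.eRk_inter_add_eRk_union_le (Λ ∪ coeffSet f (j + 1))
      (Λ ∪ coeffSet f j ∪ Set.range x)
    have hle := coeffSet_mono f (Nat.le_succ j)
    have h2 : Λ ∪ coeffSet f (j + 1) ∪ (Λ ∪ coeffSet f j ∪ Set.range x) =
        Λ ∪ coeffSet f (j + 1) ∪ Set.range x := by
      rw [← Set.union_assoc, Set.union_eq_left.2 (Set.union_subset_union_right _ hle)]
    have h3 := algMat.eRk_mono (Set.subset_inter (Set.union_subset_union_right Λ hle) (Set.subset_union_left (t := Set.range x)))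
    rw [h2, ← hv, ← hu, ← hv] at h1
    rw [← hu] at h3
    have h4 := (add_le_add_left h3 (v (j + 1) : ℕ∞)).trans h1
    have h5 : u j + v (j + 1) ≤ u (j + 1) + v j := by exact_mod_cast h4
    omega
  have hu1 : u 1 ≤ (n - Fintype.card κ) * Fintype.card κ := by
    have h1 : coeffSet f 1 = ∅ := by
      refine Set.range_eq_empty_iff.2 ⟨fun m => ?_⟩
      have := mem_monos.1 m.2
      omega
    have h2 := eRk_union_range_le (S := ∅) fun p : {i // i ∉ Set.range α} × κ => (c p.1 p.2 : ℂ)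
    rw [Set.empty_union, ← hΛ, Fintype.card_prod, hcompl, Matroid.eRk_empty, zero_add] at h2
    have h3 := hu 1
    rw [h1, Set.union_empty] at h3
    rw [← h3] at h2
    exact_mod_cast h2
  have hstep : ∀ j, 1 ≤ j → u (j + 1) ≤ u j + (monos (Fin n) (j + 1) (j + 1)).card := fun j hj => by
    have h1 := eRk_union_range_le (S := Λ ∪ coeffSet f j)
      fun m : monos (Fin n) (j + 1) (j + 1) => coeff (m : Fin n →₀ ℕ) f
    rw [Set.union_assoc, ← coeffSet_succ f hj, ← hu, ← hu, Fintype.card_coe] at h1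
    exact_mod_cast h1
  have hRu : algMat.eRk R ≤ u (n + 1) := by
    rw [hu, ← hR]; exact algMat.eRk_mono Set.subset_union_right
  have hsubR : ∀ j, j ≤ n + 1 → Λ ∪ coeffSet f j ⊆ acl R := fun j hj =>
    Set.union_subset hΛR ((coeffSet_mono f hj).trans (hR ▸ subset_acl _))
  have hlast : u (n + 1) + 2 ≤ v (n + 1) := by
    have h1 := eRk_le_of_subset_acl (hsubR (n + 1) le_rfl)
    have h2 : algMat.eRk (R ∪ Set.range x) ≤ algMat.eRk (Λ ∪ coeffSet f (n + 1) ∪ Set.range x) :=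
      algMat.eRk_mono (Set.union_subset_union_left _ (hR ▸ Set.subset_union_right))
    rw [← hu] at h1
    rw [← hv] at h2
    exact_mod_cast (add_le_add_left h1 2).trans (h.trans h2)
  have hfail : ∀ j, 1 ≤ j → j + 1 ≤ n → v (j + 1) - u (j + 1) = v j - u j →
      u (j + 1) + monoRank (Λ ∪ coeffSet f j) x (j + 1) ≤ u j + (monos (Fin n) (j + 1) (j + 1)).card := by
    intro j hj hjn hd
    have h0 := huv j
    have h0' := huv (j + 1)
    have h1 := eRk_add_finrank_monoSpan_le (j := j + 1) (d := v j - u j) (hΛf.union (finite_coeffSet f j)) x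
      (fun m => coeff (m : Fin n →₀ ℕ) f)
      (by rw [← eval_homogeneousComponent_eq_sum]; exact hx _ (by omega) hjn)
      (by rw [← hu, ← hv, ← Nat.cast_add]; congr 1; omega)
      (by
        rw [Set.union_assoc _ _ (Set.range fun m : monos (Fin n) (j + 1) (j + 1) => _),
          ← coeffSet_succ f hj, ← hu, ← hv, ← Nat.cast_add]
        exact_mod_cast (by omega : u (j + 1) + (v j - u j) ≤ v (j + 1)))
    rw [Set.union_assoc _ _ (Set.range fun m : monos (Fin n) (j + 1) (j + 1) => _),
          ← coeffSet_succ f hj, ← hu, ← hu] at h1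
    exact_mod_cast h1
  have hfin1 : ∀ j, j ≤ n → Fintype.card κ ≤ Module.finrank (acl (Λ ∪ coeffSet f j))
      (Submodule.span (acl (Λ ∪ coeffSet f j)) (Set.range x)) := by
    intro j hj
    have h1 := linearIndependent_of_le (acl_le_iff.2 (hsubR j (by omega))) hli
    rw [← finrank_span_eq_card h1]
    have := FiniteDimensional.span_of_finite (acl (Λ ∪ coeffSet f j)) (Set.finite_range x)
    exact Submodule.finrank_mono (Submodule.span_mono (Set.range_comp_subset_range α x))
  have hfin2 : ∀ j i, v j - u j ≠ 0 → ((v j - u j) + i - 1).choose i ≤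
      monoRank (Λ ∪ coeffSet f j) x i := by
    intro j i hd
    have hG := hΛf.union (finite_coeffSet f j)
    have h0 := huv j
    have h1 : algMat.eRk (Λ ∪ coeffSet f j ∪ Set.range x) =
        algMat.eRk (Λ ∪ coeffSet f j) + (v j - u j : ℕ) := by
      rw [← hu, ← hv, ← Nat.cast_add]; congr 1; omega
    obtain ⟨t, htx, hxt⟩ := exists_transcendence_basis_in hG (Set.finite_range x) h1
    refine choose_le_finrank_monoSpan x htx (algebraicIndependent_acl hG ?_) hd i
    rw [← h1]
    exact eRk_le_of_subset_acl (Set.union_subset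
      (Set.subset_union_left.trans (subset_acl _)) hxt)
  have hanti : ∀ j, v (j + 1) - u (j + 1) ≤ v j - u j := fun j => by
    have := hsub j
    have := huv j
    have := huv (j + 1)
    omega
  have hdn : 2 ≤ v n - u n := le_trans (by omega) (hanti n)
  have hdlow : ∀ i, ∀ j, j + i = n → 2 ≤ v j - u j := by
    intro i
    induction i with
    | zero => rintro j rfl; exact hdn
    | succ i ih => intro j hj; exact (ih (j + 1) (by omega)).trans (hanti j)
  have hκ2 : 2 ≤ Fintype.card κ := by
    have := hvκ n
    omega
  obtain ⟨k, hk⟩ : ∃ k, Fintype.card κ = k + 1 := ⟨Fintype.card κ - 1, by omega⟩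
  obtain ⟨e, he⟩ := Nat.exists_eq_add_of_le hcardκ
  obtain ⟨w, hw⟩ : ∃ w : ℕ → ℕ, ∀ j, w j = monoRank (Λ ∪ coeffSet f (j - 1)) x j :=
    ⟨_, fun _ => rfl⟩
  obtain ⟨d, hd⟩ : ∃ d : ℕ → ℕ, ∀ j, d j = v j - u j := ⟨_, fun _ => rfl⟩
  have hcount := le_sum_of_stationary (n := n) (k := k) (e := e) hn (by omega) (by omega) d w
    (by rw [hd]; have := hvκ 1; omega) (by rw [hd]; exact hdn)
    (fun j h2 hj => by
      obtain ⟨i, rfl⟩ : ∃ i, j = i + 1 := ⟨j - 1, by omega⟩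
      rw [hd, hd]; exact hanti i)
    (fun j h2 hj _ => by
      rw [hw]
      exact le_finrank_monoSpan x (hk ▸ hfin1 (j - 1) (by omega)) j)
    (fun j h2 hj hjd => by
      rw [hw, hjd, hd]
      have := hdlow (n - (j - 1)) (j - 1) (by omega)
      exact hfin2 (j - 1) j (by omega))
  have hsum : ∀ i, i + 1 ≤ n →
      u (i + 1) + ∑ j ∈ (Finset.Icc 2 (i + 1)).filter (fun j => d j = d (j - 1)), w j ≤
        u 1 + (monos (Fin n) 2 (i + 1)).card := by
    intro i
    induction i with
    | zero => intro _; simp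
    | succ i ih =>
      intro hi
      have h1 := ih (by omega)
      rw [card_monos_succ (a := 2) (b := i + 1) (by omega),
        ← Finset.insert_Icc_right_eq_Icc_add_one (by omega), Finset.filter_insert]
      by_cases h2 : d (i + 1 + 1) = d (i + 1 + 1 - 1)
      · rw [if_pos h2, Finset.sum_insert (by simp)]
        have h3 := hfail (i + 1) (by omega) hi (by rw [← hd, ← hd]; exact h2)
        have h4 := hw (i + 1 + 1)
        rw [Nat.add_sub_cancel] at h4
        rw [← h4] at h3
        omega
      · rw [if_neg h2]
        have := hstep (i + 1) (by omega)
        omega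
  have h1 := hsum (n - 1) (by omega)
  rw [Nat.sub_add_cancel (by omega)] at h1
  have h2 := hstep n (by omega)
  have h3 : (monos (Fin n) 2 (n + 1)).card = _ := card_monos_add (b := n) (by omega) (by omega)
  have h4 : u (n + 1) + (n - 5) * (n - 4) / 2 ≤ (monos (Fin n) 2 (n + 1)).card := by
    have : (n - Fintype.card κ) * Fintype.card κ = e * (k + 1) := by
      rw [hk] at he ⊢
      congr 1; omega
    omega
  rw [← hR]
  exact (add_le_add_left hRu _).trans (by exact_mod_cast h4)

/-- The coefficients, in degree `d`, of the products of `H` with the monomials `s k`. -/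
def colMat {R : Type*} [CommRing R] {n d a b : ℕ} (H : MvPolynomial (Fin n) R)
    (s : monos (Fin n) d d → monos (Fin n) a b) : Matrix (monos (Fin n) d d) (monos (Fin n) d d) R :=
  Matrix.of fun m k => coeff (m : Fin n →₀ ℕ) (H * monomial (s k : Fin n →₀ ℕ) 1)

theorem coeff_homogeneousComponent_mul_monomial {R τ : Type*} [CommRing R] [Finite τ]
    (H : MvPolynomial τ R) {m k : τ →₀ ℕ} (hk : k.degree ≤ m.degree) :
    coeff m (homogeneousComponent (m.degree - k.degree) H * monomial k 1) =
      coeff m (H * monomial k 1) := by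
  rw [coeff_mul_monomial', coeff_mul_monomial']
  by_cases h : k ≤ m
  · rw [if_pos h, if_pos h, coeff_homogeneousComponent, if_pos]
    have := congrArg Finsupp.degree (tsub_add_cancel_of_le h)
    rw [map_add] at this
    omega
  · rw [if_neg h, if_neg h]

theorem coeff_homogeneousComponent_mul_monomial_eq_zero {R τ : Type*} [CommRing R] [Finite τ]
    (H : MvPolynomial τ R) {m k : τ →₀ ℕ} {d : ℕ} (hk : k.degree ≤ d) (hm : m.degree ≠ d) :
    coeff m (homogeneousComponent (d - k.degree) H * monomial k 1) = 0 := by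
  have h1 := (homogeneousComponent_isHomogeneous (d - k.degree) H).mul
    (isHomogeneous_monomial (1 : R) (rfl : k.degree = k.degree))
  refine h1.coeff_eq_zero ?_
  omega

theorem exists_monomial_eq_sum {n D a : ℕ} (H : MvPolynomial (Fin n) ℂ)
    (s : monos (Fin n) (D + 1) (D + 1) → monos (Fin n) a D) (hdet : (colMat H s).det ≠ 0)
    (m : monos (Fin n) (D + 1) (D + 1)) :
    ∃ g : monos (Fin n) (D + 1) (D + 1) → ℂ, monomial (m : Fin n →₀ ℕ) (1 : ℂ) =
      ∑ k, C (g k) * (homogeneousComponent (D + 1 - (s k : Fin n →₀ ℕ).degree) H *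
        monomial (s k : Fin n →₀ ℕ) 1) := by
  classical
  refine ⟨(colMat H s)⁻¹.mulVec (Pi.single m 1), ?_⟩
  have h1 : (colMat H s).mulVec ((colMat H s)⁻¹.mulVec (Pi.single m 1)) = Pi.single m 1 := by
    rw [Matrix.mulVec_mulVec, Matrix.mul_nonsing_inv _ (isUnit_iff_ne_zero.2 hdet),
      Matrix.one_mulVec]
  have hmd := mem_monos.1 m.2
  ext m'
  rw [coeff_sum]
  simp only [coeff_C_mul]
  by_cases hm' : m'.degree = D + 1
  · have h2 := congrFun h1 ⟨m', mem_monos.2 ⟨hm'.ge, hm'.le⟩⟩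
    rw [Matrix.mulVec, dotProduct] at h2
    rw [coeff_monomial]
    have h3 : (Pi.single m 1 : monos (Fin n) (D + 1) (D + 1) → ℂ)
        ⟨m', mem_monos.2 ⟨hm'.ge, hm'.le⟩⟩ = if (m : Fin n →₀ ℕ) = m' then 1 else 0 := by
      rw [Pi.single_apply]
      refine if_congr ?_ rfl rfl
      rw [eq_comm, Subtype.ext_iff]
    rw [← h3, ← h2]
    refine Finset.sum_congr rfl fun k _ => ?_
    have hk := mem_monos.1 (s k).2
    have h4 := coeff_homogeneousComponent_mul_monomial H
      (by omega : (s k : Fin n →₀ ℕ).degree ≤ m'.degree)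
    rw [hm'] at h4
    rw [h4, mul_comm]
    rfl
  · rw [coeff_monomial, if_neg (by rintro rfl; omega)]
    refine (Finset.sum_eq_zero fun k _ => ?_).symm
    have hk := mem_monos.1 (s k).2
    rw [coeff_homogeneousComponent_mul_monomial_eq_zero _ (by omega) hm', mul_zero]

theorem exists_add_eq_of_le_degree {τ : Type*} {m : τ →₀ ℕ} {d : ℕ} (h : d ≤ m.degree) :
    ∃ m₁ m₂ : τ →₀ ℕ, m₁ + m₂ = m ∧ m₁.degree = d := by
  induction d with
  | zero => exact ⟨0, m, by simp, by simp⟩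
  | succ d ih =>
    obtain ⟨m₁, m₂, rfl, h1⟩ := ih (by omega)
    rw [map_add] at h
    have h2 : m₂ ≠ 0 := by rintro rfl; simp at h; omega
    obtain ⟨i, hi⟩ := Finsupp.ne_iff.1 h2
    refine ⟨m₁ + Finsupp.single i 1, m₂ - Finsupp.single i 1, ?_, by simp [h1]⟩
    rw [add_assoc, add_tsub_cancel_of_le]
    rw [Finsupp.single_le_iff]
    exact Nat.one_le_iff_ne_zero.2 hi

theorem isIntegral_of_det_ne_zero {n D : ℕ} {Q : Type*} [CommRing Q] [Algebra ℂ Q]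
    (φ : MvPolynomial (Fin n) ℂ →ₐ[ℂ] Q) (hφ : Function.Surjective φ)
    (H : MvPolynomial (Fin n) ℂ)
    (hH : ∀ j, 2 ≤ j → j ≤ n → φ (homogeneousComponent j H) = 0)
    (s : monos (Fin n) (D + 1) (D + 1) → monos (Fin n) (D + 1 - n) D)
    (hdet : (colMat H s).det ≠ 0) :
    ((aeval fun _ : Fin 1 => φ (homogeneousComponent 1 H) :
      MvPolynomial (Fin 1) ℂ →ₐ[ℂ] Q) : MvPolynomial (Fin 1) ℂ →+* Q).IsIntegral := by
  classical
  obtain ⟨θ, hθ⟩ : ∃ θ : MvPolynomial (Fin 1) ℂ →ₐ[ℂ] Q,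
    θ = aeval fun _ : Fin 1 => φ (homogeneousComponent 1 H) := ⟨_, rfl⟩
  rw [← hθ]
  letI := (θ : MvPolynomial (Fin 1) ℂ →+* Q).toAlgebra
  have hsm : ∀ (p : MvPolynomial (Fin 1) ℂ) (q : Q), p • q = θ p * q := fun _ _ => rfl
  obtain ⟨N, hN⟩ : ∃ N : Submodule (MvPolynomial (Fin 1) ℂ) Q, N = Submodule.span _
    ((fun m => φ (monomial m 1)) '' (monos (Fin n) 0 D : Set (Fin n →₀ ℕ))) := ⟨_, rfl⟩
  have hC : ∀ (c : ℂ) (q : Q), q ∈ N → φ (C c) * q ∈ N := fun c q hq => by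
    have : φ (C c) * q = (C c : MvPolynomial (Fin 1) ℂ) • q := by
      rw [hsm, ← algebraMap_eq, ← algebraMap_eq, AlgHom.commutes, AlgHom.commutes]
    rw [this]
    exact N.smul_mem _ hq
  have hmon : ∀ d, ∀ m : Fin n →₀ ℕ, m.degree = d → φ (monomial m 1) ∈ N := by
    intro d
    induction d using Nat.strong_induction_on with
    | _ d ih =>
      rintro m rfl
      by_cases hm : m.degree ≤ D
      · rw [hN]
        exact Submodule.subset_span ⟨m, mem_monos.2 ⟨zero_le, hm⟩, rfl⟩
      · obtain ⟨m₁, m₂, rfl, h1⟩ := exists_add_eq_of_le_degree (d := D + 1) (by omega : D + 1 ≤ m.degree)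
        rw [map_add] at ih
        obtain ⟨g, hg⟩ := exists_monomial_eq_sum H s hdet ⟨m₁, mem_monos.2 ⟨h1.ge, h1.le⟩⟩
        rw [← one_mul (1 : ℂ), ← monomial_mul, map_mul, hg, map_sum, Finset.sum_mul]
        refine sum_mem fun k _ => ?_
        rw [map_mul, map_mul, mul_assoc, mul_assoc]
        refine hC _ _ ?_
        have hk := mem_monos.1 (s k).2
        by_cases hk2 : (s k : Fin n →₀ ℕ).degree = D
        · rw [hk2, Nat.add_sub_cancel_left, ← map_mul, monomial_mul, one_mul]
          have h2 : φ (homogeneousComponent 1 H) = θ (X 0) := by rw [hθ, aeval_X]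
          rw [h2, ← hsm]
          refine N.smul_mem _ (ih _ ?_ _ rfl)
          rw [map_add]
          omega
        · rw [hH _ (by omega) (by omega), zero_mul]
          exact N.zero_mem
  have htop : N = ⊤ := by
    rw [eq_top_iff]
    rintro q -
    obtain ⟨p, rfl⟩ := hφ q
    induction p using MvPolynomial.induction_on' with
    | monomial m c =>
      rw [← mul_one c, ← C_mul_monomial, map_mul]
      exact hC _ _ (hmon _ m rfl)
    | add p q hp hq =>
      rw [map_add]
      exact N.add_mem hp hq
  have : Module.Finite (MvPolynomial (Fin 1) ℂ) Q := by
    refine ⟨?_⟩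
    rw [← htop, hN]
    exact Submodule.fg_span ((Finset.finite_toSet _).image _)
  intro q
  exact Algebra.IsIntegral.isIntegral (R := MvPolynomial (Fin 1) ℂ) q

theorem zdim_le_of_isIntegral {E τ : Type*} [AddCommGroup E] [Module ℂ E] [Finite τ]
    (e : E ≃ₗ[ℂ] (τ → ℂ)) (A : Set E) {d : ℕ}
    (f : MvPolynomial (Fin d) ℂ →+* MvPolynomial τ ℂ ⧸ coordIdeal e A) (hf : f.IsIntegral) :
    zdim A ≤ d :=
  (zdim_le_ringKrullDim e A).trans ((ringKrullDim_le_of_isIntegral f hf).trans_eq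
    (ringKrullDim_mvPolynomial_field ℂ d))

theorem condR11_of_det_ne_zero {n D : ℕ} {q₁ f : MvPolynomial (Fin (n + 1)) ℂ}
    {ι : MvPolynomial (Fin (n + 1)) ℂ →ₐ[ℂ] MvPolynomial (Fin n) ℂ}
    {σ : MvPolynomial (Fin n) ℂ →ₐ[ℂ] MvPolynomial (Fin (n + 1)) ℂ}
    (h : IsHyperplaneRestriction q₁ ι σ) (H : MvPolynomial (Fin n) ℂ)
    (hH : ∀ j, 2 ≤ j → j ≤ n → homogeneousComponent j H = homogeneousComponent j (ι f))
    (s : monos (Fin n) (D + 1) (D + 1) → monos (Fin n) (D + 1 - n) D)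
    (hdet : (colMat H s).det ≠ 0) : CondR11 q₁ f := by
  obtain ⟨A, hA⟩ : ∃ A : Set (Fin (n + 1) → ℂ), A = {z | MvPolynomial.eval z q₁ = 0 ∧
    ∀ i ∈ Finset.Icc 2 (n + 1 - 1), MvPolynomial.eval z (homogeneousComponent i f) = 0} :=
    ⟨_, rfl⟩
  rw [CondR11, ← hA]
  obtain ⟨I, hI⟩ : ∃ I, I = coordIdeal (LinearEquiv.refl ℂ (Fin (n + 1) → ℂ)) A := ⟨_, rfl⟩
  have hmem : ∀ p, (∀ z ∈ A, eval z p = 0) → Ideal.Quotient.mk I p = 0 := fun p hp => by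
    rw [Ideal.Quotient.eq_zero_iff_mem, hI, mem_coordIdeal]
    exact hp
  have hker : ∀ p, ι p = 0 → Ideal.Quotient.mk I p = 0 := fun p hp => by
    have h1 : p ∈ RingHom.ker ι := hp
    rw [h.ker_eq, Ideal.mem_span_singleton] at h1
    obtain ⟨r, rfl⟩ := h1
    rw [map_mul, hmem q₁ (fun z hz => by rw [hA] at hz; exact hz.1), zero_mul]
  have hφι : ∀ p, Ideal.Quotient.mk I (σ (ι p)) = Ideal.Quotient.mk I p := fun p => by
    rw [← sub_eq_zero, ← map_sub]
    refine hker _ ?_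
    rw [map_sub, h.right_inv, sub_self]
  have h1 := isIntegral_of_det_ne_zero ((Ideal.Quotient.mkₐ ℂ I).comp σ) (by
      intro q
      obtain ⟨p, rfl⟩ := Ideal.Quotient.mk_surjective q
      exact ⟨ι p, hφι p⟩) H (by
      intro j h2 hj
      rw [hH j h2 hj, h.linear.homogeneousComponent]
      refine (hφι _).trans (hmem _ fun z hz => ?_)
      rw [hA] at hz
      exact hz.2 j (Finset.mem_Icc.2 ⟨h2, hj⟩)) s hdet
  subst hI
  exact zdim_le_of_isIntegral (d := 1) _ A _ h1

theorem exists_det_ne_zero_of_span {K α β : Type*} [Field K] [Fintype α] [DecidableEq α]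
    (v : β → α → K) (hv : Submodule.span K (Set.range v) = ⊤) :
    ∃ s : α → β, (Matrix.of fun m k => v (s k) m).det ≠ 0 := by
  obtain ⟨κ, a, ha, hκ, hli⟩ := exists_linearIndependent' K v
  have : Fintype κ := FiniteDimensional.fintypeBasisIndex (Module.Basis.mk hli (by rw [hκ, hv]))
  have hcard : Fintype.card α = Fintype.card κ := by
    rw [← Module.finrank_eq_card_basis (Module.Basis.mk hli (by rw [hκ, hv])),
      Module.finrank_fintype_fun_eq_card]
  obtain ⟨e⟩ := Fintype.card_eq.1 hcard
  refine ⟨a ∘ e, ?_⟩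
  have h1 : LinearIndependent K (Matrix.of fun m k => v ((a ∘ e) k) m).col := hli.comp e e.injective
  rw [Matrix.linearIndependent_cols_iff_isUnit, Matrix.isUnit_iff_isUnit_det] at h1
  exact h1.ne_zero

theorem coeff_mul_homogeneousComponent {R τ : Type*} [CommRing R] [Finite τ]
    (H : MvPolynomial τ R) (m k : τ →₀ ℕ) (c : R) (j : ℕ) :
    coeff m (monomial k c * homogeneousComponent j H) =
      if m.degree = k.degree + j then c * coeff m (H * monomial k 1) else 0 := by
  have h1 : monomial k c = C c * monomial k (1 : R) := by rw [C_mul_monomial, mul_one]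
  rw [h1, mul_assoc, coeff_C_mul, mul_comm (monomial k 1)]
  by_cases h : m.degree = k.degree + j
  · have h2 := coeff_homogeneousComponent_mul_monomial H (by omega : k.degree ≤ m.degree)
    rw [h, Nat.add_sub_cancel_left] at h2
    rw [if_pos h, h2]
  · have h2 := coeff_homogeneousComponent_mul_monomial_eq_zero H (by omega : k.degree ≤ k.degree + j) h
    rw [Nat.add_sub_cancel_left] at h2
    rw [if_neg h, h2, mul_zero]

/-- If the forms of degrees `1, …, n` of `H` only vanish simultaneously at the origin, then they
generate all forms of large degree. -/
theorem exists_common_zero {n : ℕ} (H : MvPolynomial (Fin n) ℂ)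
    (hH : ∀ D, ∀ s : monos (Fin n) (D + 1) (D + 1) → monos (Fin n) (D + 1 - n) D,
      (colMat H s).det = 0) :
    ∃ x : Fin n → ℂ, x ≠ 0 ∧ ∀ j, 1 ≤ j → j ≤ n → eval x (homogeneousComponent j H) = 0 := by
  classical
  by_contra hx
  push Not at hx
  obtain ⟨I, hI⟩ : ∃ I : Ideal (MvPolynomial (Fin n) ℂ),
    I = Ideal.span (Set.range fun j : Fin n => homogeneousComponent (j + 1 : ℕ) H) := ⟨_, rfl⟩
  have hrad : ∀ i, X i ∈ I.radical := fun i => by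
    rw [← vanishingIdeal_zeroLocus_eq_radical (K := ℂ), mem_vanishingIdeal_iff]
    intro x hxI
    have hx0 : x = 0 := by
      by_contra hx0
      obtain ⟨j, h1, hj, hne⟩ := hx x hx0
      refine hne ?_
      rw [← aeval_eq_eval_apply]
      refine hxI _ ?_
      rw [hI]
      refine Ideal.subset_span ⟨⟨j - 1, by omega⟩, ?_⟩
      simp only
      rw [Nat.sub_add_cancel h1]
    rw [hx0, aeval_X]
    rfl
  choose k hk using fun i => Ideal.mem_radical_iff.1 (hrad i)
  obtain ⟨K, hK⟩ : ∃ K, K = ∑ i, k i := ⟨_, rfl⟩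
  have hkK : ∀ i, X i ^ K ∈ I := fun i => by
    have : k i ≤ K := hK ▸ Finset.single_le_sum (fun _ _ => Nat.zero_le _) (Finset.mem_univ i)
    exact I.mem_of_dvd (pow_dvd_pow _ this) (hk i)
  obtain ⟨D, hD⟩ : ∃ D, D = n * K + n := ⟨_, rfl⟩
  have hmon : ∀ m : Fin n →₀ ℕ, D + 1 ≤ m.degree → monomial m (1 : ℂ) ∈ I := fun m hm => by
    obtain ⟨i, hi⟩ : ∃ i, K ≤ m i := by
      by_contra hcon
      push Not at hcon
      have h1 : m.degree ≤ ∑ _i : Fin n, K := by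
        rw [Finsupp.degree_eq_sum]
        exact Finset.sum_le_sum fun i _ => (hcon i).le
      rw [Finset.sum_const, Finset.card_univ, Fintype.card_fin, smul_eq_mul] at h1
      omega
    refine I.mem_of_dvd ?_ (hkK i)
    rw [X_pow_eq_monomial]
    exact (monomial_dvd_monomial.2 ⟨Or.inr (Finsupp.single_le_iff.2 hi), one_dvd _⟩)
  obtain ⟨v, hv⟩ : ∃ v : monos (Fin n) (D + 1 - n) D → monos (Fin n) (D + 1) (D + 1) → ℂ,
    ∀ k m, v k m = coeff (m : Fin n →₀ ℕ) (H * monomial (k : Fin n →₀ ℕ) 1) := ⟨_, fun _ _ => rfl⟩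
  obtain ⟨π, hπ⟩ : ∃ π : MvPolynomial (Fin n) ℂ →ₗ[ℂ] (monos (Fin n) (D + 1) (D + 1) → ℂ),
    ∀ p m, π p m = coeff (m : Fin n →₀ ℕ) p :=
    ⟨LinearMap.pi fun m => lcoeff ℂ (m : Fin n →₀ ℕ), fun _ _ => rfl⟩
  have hπI : ∀ p ∈ I, π p ∈ Submodule.span ℂ (Set.range v) := by
    intro p hp
    rw [hI, Ideal.mem_span_range_iff_exists_fun] at hp
    obtain ⟨c, rfl⟩ := hp
    rw [map_sum]
    refine sum_mem fun j _ => ?_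
    generalize c j = g
    induction g using MvPolynomial.induction_on' with
    | monomial k a =>
      by_cases hkD : k.degree + (j + 1) = D + 1
      · have h1 : π (monomial k a * homogeneousComponent (j + 1 : ℕ) H) =
            a • v ⟨k, mem_monos.2 ⟨by omega, by omega⟩⟩ := by
          ext m
          have hm := mem_monos.1 m.2
          rw [hπ, coeff_mul_homogeneousComponent, if_pos (by omega), Pi.smul_apply, hv, smul_eq_mul]
        rw [h1]
        exact Submodule.smul_mem _ _ (Submodule.subset_span ⟨_, rfl⟩)
      · have h1 : π (monomial k a * homogeneousComponent (j + 1 : ℕ) H) = 0 := by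
          ext m
          have hm := mem_monos.1 m.2
          rw [hπ, coeff_mul_homogeneousComponent, if_neg (by omega)]
          rfl
        rw [h1]
        exact Submodule.zero_mem _
    | add p q hp hq =>
      rw [add_mul, map_add]
      exact Submodule.add_mem _ hp hq
  have htop : Submodule.span ℂ (Set.range v) = ⊤ := by
    rw [eq_top_iff, ← (Pi.basisFun ℂ (monos (Fin n) (D + 1) (D + 1))).span_eq, Submodule.span_le]
    rintro _ ⟨m, rfl⟩
    have hm := mem_monos.1 m.2
    have h1 : π (monomial m 1) = Pi.basisFun ℂ (monos (Fin n) (D + 1) (D + 1)) m := by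
      ext m'
      rw [hπ, coeff_monomial, Pi.basisFun_apply, Pi.single_apply]
      refine if_congr ?_ rfl rfl
      rw [eq_comm, Subtype.ext_iff]
    rw [← h1]
    exact hπI _ (hmon _ hm.1)
  obtain ⟨s, hs⟩ := exists_det_ne_zero_of_span v htop
  refine hs ?_
  rw [← hH D s]
  congr 1
  ext m k
  exact hv _ _

/-- The polynomial with coefficients `b ∘ Sum.inl` at the monomials of degree `≥ 2` and
`b ∘ Sum.inr` in degree one. -/
def polyOfSum {R : Type*} [CommRing R] {n a b : ℕ}
    (w : monos (Fin n) a b ⊕ Fin n → R) : MvPolynomial (Fin n) R :=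
  polyOf (monos (Fin n) a b) (fun j => w (Sum.inl j)) + ∑ i, C (w (Sum.inr i)) * X i

theorem map_polyOfSum {R S : Type*} [CommRing R] [CommRing S] (φ : R →+* S) {n a b : ℕ}
    (w : monos (Fin n) a b ⊕ Fin n → R) :
    map φ (polyOfSum w) = polyOfSum fun j => φ (w j) := by
  simp [polyOfSum, map_polyOf]

theorem homogeneousComponent_polyOfSum {n b j : ℕ} (hj : 2 ≤ j)
    (w : monos (Fin n) 2 b ⊕ Fin n → ℂ) :
    homogeneousComponent j (polyOfSum w) =
      homogeneousComponent j (polyOf (monos (Fin n) 2 b) fun j => w (Sum.inl j)) := by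
  rw [polyOfSum, map_add, homogeneousComponent_of_mem (isHomogeneous_sum_C_mul_X _),
    if_neg (by omega), add_zero]

theorem homogeneousComponent_one_polyOfSum {n b : ℕ}
    (w : monos (Fin n) 2 b ⊕ Fin n → ℂ) :
    homogeneousComponent 1 (polyOfSum w) = ∑ i, C (w (Sum.inr i)) * X i := by
  rw [polyOfSum, map_add, homogeneousComponent_of_mem (isHomogeneous_sum_C_mul_X _), if_pos rfl]
  convert zero_add _
  ext m
  rw [coeff_homogeneousComponent, coeff_zero]
  split_ifs with h
  · exact coeff_polyOf_of_notMem _ _ (by rw [mem_monos]; omega)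
  · rfl

theorem det_colMat_map {R S : Type*} [CommRing R] [CommRing S] (φ : R →+* S) {n d a b : ℕ}
    (H : MvPolynomial (Fin n) R) (s : monos (Fin n) d d → monos (Fin n) a b) :
    (colMat (map φ H) s).det = φ (colMat H s).det := by
  rw [RingHom.map_det]
  congr 1
  ext m k
  simp only [colMat, RingHom.mapMatrix_apply, Matrix.map_apply, Matrix.of_apply]
  rw [← coeff_map, map_mul, map_monomial, RingHom.map_one]

/-- The coefficient vectors all of whose extensions by a linear part have vanishing
Macaulay determinants. -/
def detLocus (n : ℕ) : Set (monos (Fin n) 2 (n + 1) → ℂ) :=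
  {a | ∀ (l : Fin n → ℂ) (D : ℕ)
    (s : monos (Fin n) (D + 1) (D + 1) → monos (Fin n) (D + 1 - n) D),
    (colMat (polyOfSum (Sum.elim a l)) s).det = 0}

theorem zeroLocus_vanishingIdeal_detLocus_subset (n : ℕ) :
    zeroLocus ℂ (vanishingIdeal ℚ (detLocus n)) ⊆ detLocus n := by
  intro a ha l D s
  obtain ⟨P, hP⟩ : ∃ P : MvPolynomial (monos (Fin n) 2 (n + 1) ⊕ Fin n) ℚ,
      ∀ (S : Type) [CommRing S] [Algebra ℚ S] (b : monos (Fin n) 2 (n + 1) ⊕ Fin n → S),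
        (colMat (polyOfSum b) s).det = aeval b P := by
    refine ⟨(colMat (polyOfSum fun j => (X j : MvPolynomial _ ℚ)) s).det, fun S _ _ b => ?_⟩
    have := det_colMat_map (aeval b : MvPolynomial _ ℚ →ₐ[ℚ] S).toRingHom
      (polyOfSum fun j => (X j : MvPolynomial (monos (Fin n) 2 (n + 1) ⊕ Fin n) ℚ)) s
    rw [map_polyOfSum] at this
    simpa using this
  have key : ∀ q : Fin n → ℚ, aeval (Sum.elim a fun i => ((q i : ℚ) : ℂ)) P = 0 := by
    intro q
    rw [mem_zeroLocus_iff] at ha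
    have h1 : ∀ a' : monos (Fin n) 2 (n + 1) → ℂ,
        aeval a' (aeval (Sum.elim X fun i => C (q i)) P : MvPolynomial _ ℚ) =
          aeval (Sum.elim a' fun i => ((q i : ℚ) : ℂ)) P := by
      intro a'
      have := comp_aeval_apply (R := ℚ)
        (Sum.elim X fun i => C (q i) : _ → MvPolynomial (monos (Fin n) 2 (n + 1)) ℚ)
        (aeval a' : MvPolynomial (monos (Fin n) 2 (n + 1)) ℚ →ₐ[ℚ] ℂ) P
      rw [this]
      congr 2
      ext j
      cases j <;> simp
    rw [← h1]
    apply ha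
    rw [mem_vanishingIdeal_iff]
    intro a' ha'
    rw [h1, ← hP]
    exact ha' _ _ _
  rw [hP]
  have h2 : (aeval (Sum.elim (fun j => C (a j)) X) P : MvPolynomial (Fin n) ℂ) = 0 := by
    refine MvPolynomial.funext_set (fun _ => Set.range ((↑) : ℚ → ℂ))
      (fun i => Set.infinite_range_of_injective Rat.cast_injective) fun x hx => ?_
    choose q hq using fun i => hx i (Set.mem_univ i)
    rw [map_zero, ← key q]
    have := comp_aeval_apply (R := ℚ) (Sum.elim (fun j => C (a j)) X : _ → MvPolynomial (Fin n) ℂ)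
      ((aeval x : MvPolynomial (Fin n) ℂ →ₐ[ℂ] ℂ).restrictScalars ℚ) P
    rw [AlgHom.restrictScalars_apply, aeval_eq_eval_apply] at this
    rw [this]
    congr 2
    ext j
    cases j <;> simp [hq]
  have := congrArg (eval l) h2
  have h3 := comp_aeval_apply (R := ℚ) (Sum.elim (fun j => C (a j)) X : _ → MvPolynomial (Fin n) ℂ)
      ((aeval l : MvPolynomial (Fin n) ℂ →ₐ[ℂ] ℂ).restrictScalars ℚ) P
  rw [AlgHom.restrictScalars_apply, aeval_eq_eval_apply, this, map_zero] at h3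
  rw [h3]
  congr 2
  ext j
  cases j <;> simp

theorem MvPolynomial.IsHomogeneous.eval_const_mul {R τ : Type*} [CommRing R] {d : ℕ} {f : MvPolynomial τ R}
    (hf : f.IsHomogeneous d) (r : R) (x : τ → R) :
    eval (fun i => r * x i) f = r ^ d * eval x f := by
  rw [eval_eq, eval_eq, Finset.mul_sum]
  refine Finset.sum_congr rfl fun m hm => ?_
  have h : m.degree = d := by
    by_contra hd
    exact mem_support_iff.1 hm (hf.coeff_eq_zero hd)
  simp_rw [mul_pow, Finset.prod_mul_distrib, Finset.prod_pow_eq_pow_sum]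
  rw [← h, Finsupp.degree]
  ring_nf
  rfl

theorem exists_notMem_acl {S : Set ℂ} (hS : S.Countable) : ∃ s, s ∉ acl S := by
  have : Countable (acl S) := (acl_countable hS).to_subtype
  obtain ⟨y, hy⟩ := exists_algebraicIndependent (R := acl S) 1
  refine ⟨y 0, fun h => (hy.transcendental 0) ?_⟩
  exact isAlgebraic_algebraMap (⟨y 0, h⟩ : acl S)

theorem exists_linearIndependent_acl {S : Set ℂ} (hS : S.Countable) (n : ℕ) :
    ∃ l : Fin n → ℂ, ∀ x : Fin n → ℂ, (∀ i, x i ∈ acl S) → ∑ i, l i * x i = 0 → x = 0 := by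
  have : Countable (acl S) := (acl_countable hS).to_subtype
  obtain ⟨y, hy⟩ := exists_algebraicIndependent (R := acl S) n
  refine ⟨y, fun x hx h => ?_⟩
  have := Fintype.linearIndependent_iff.1 hy.linearIndependent (fun i => ⟨x i, hx i⟩) (by
    rw [← h]
    refine Finset.sum_congr rfl fun i _ => ?_
    rw [Algebra.smul_def, mul_comm]; rfl)
  ext i
  exact congrArg Subtype.val (this i)

theorem eRk_add_two_le {S : Set ℂ} {t s : ℂ} {U : Set ℂ} (ht : t ∉ acl S)
    (hs : s ∉ acl (insert t S)) (hU : insert s (insert t S) ⊆ acl U) :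
    algMat.eRk S + 2 ≤ algMat.eRk U := by
  have h1 := Matroid.eRk_insert_eq_add_one (M := algMat) (X := S) (e := t)
    ⟨Set.mem_univ _, fun h => ht (mem_acl_iff.2 h)⟩
  have h2 := Matroid.eRk_insert_eq_add_one (M := algMat) (X := insert t S) (e := s)
    ⟨Set.mem_univ _, fun h => hs (mem_acl_iff.2 h)⟩
  have h3 := eRk_le_of_subset_acl hU
  rw [h2, h1, add_assoc] at h3
  exact h3

theorem exists_zero_of_mem_detLocus {n : ℕ} {a : monos (Fin n) 2 (n + 1) → ℂ}
    (ha : a ∈ detLocus n) : ∃ x : Fin n → ℂ,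
    (∀ j, 2 ≤ j → j ≤ n →
      eval x (homogeneousComponent j (polyOf (monos (Fin n) 2 (n + 1)) a)) = 0) ∧
    algMat.eRk (Set.range a) + 2 ≤ algMat.eRk (Set.range a ∪ Set.range x) := by
  have hc : (Set.range a).Countable := Set.countable_range a
  obtain ⟨l, hl⟩ := exists_linearIndependent_acl hc n
  obtain ⟨x, hx0, hx⟩ := exists_common_zero (polyOfSum (Sum.elim a l)) (ha l)
  obtain ⟨i, hi⟩ : ∃ i, x i ≠ 0 := by
    by_contra! h
    exact hx0 (_root_.funext h)
  have h1 : ∑ i, l i * x i = 0 := by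
    by_cases hn : 1 ≤ n
    · have := hx 1 le_rfl hn
      rw [homogeneousComponent_one_polyOfSum] at this
      simpa using this
    · obtain rfl : n = 0 := by omega
      exact i.elim0
  obtain ⟨t, ht⟩ : ∃ t, (x i)⁻¹ * x t ∉ acl (Set.range a) := by
    by_contra! h
    have := hl (fun t => (x i)⁻¹ * x t) h (by
      simp_rw [mul_left_comm _ (x i)⁻¹, ← Finset.mul_sum, h1, mul_zero])
    have := congrFun this i
    simp [hi] at this
  obtain ⟨s, hs⟩ := exists_notMem_acl (hc.insert ((x i)⁻¹ * x t))
  have hs0 : s ≠ 0 := fun h => hs (h ▸ zero_mem _)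
  refine ⟨fun j => (s * (x i)⁻¹) * x j, fun j h2 hj => ?_, eRk_add_two_le ht hs ?_⟩
  · have := hx j (by omega) hj
    rw [homogeneousComponent_polyOfSum h2] at this
    simp only [Sum.elim_inl] at this
    rw [(homogeneousComponent_isHomogeneous j _).eval_const_mul, this, mul_zero]
  · set U := Set.range a ∪ Set.range fun j => (s * (x i)⁻¹) * x j
    have hj : ∀ j, (s * (x i)⁻¹) * x j ∈ acl U := fun j =>
      subset_acl _ (Or.inr ⟨j, rfl⟩)
    have hsU : s ∈ acl U := by
      have := hj i
      rwa [mul_assoc, inv_mul_cancel₀ hi, mul_one] at this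
    refine Set.insert_subset hsU (Set.insert_subset ?_ fun y hy => subset_acl _ (Or.inl hy))
    have := mul_mem (inv_mem hsU) (hj t)
    rwa [mul_assoc, inv_mul_cancel_left₀ hs0] at this

theorem coeffSet_polyOf {n : ℕ} (a : monos (Fin n) 2 (n + 1) → ℂ) :
    coeffSet (polyOf (monos (Fin n) 2 (n + 1)) a) (n + 1) = Set.range a := by
  simp only [coeffSet, coeff_polyOf]

theorem hasCodimGE_not_condR11 {n : ℕ} (hn : 7 ≤ n) {q₁ : MvPolynomial (Fin (n + 1)) ℂ}
    {ι : MvPolynomial (Fin (n + 1)) ℂ →ₐ[ℂ] MvPolynomial (Fin n) ℂ}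
    {σ : MvPolynomial (Fin n) ℂ →ₐ[ℂ] MvPolynomial (Fin (n + 1)) ℂ}
    (h : IsHyperplaneRestriction q₁ ι σ) :
    HasCodimGE {f : Psing (n + 1) | ¬ CondR11 q₁ f} ((n - 5) * (n - 4) / 2) := by
  have hb : ∀ a ∈ detLocus n, algMat.eRk (Set.range a) + ((n - 5) * (n - 4) / 2 : ℕ) ≤
      (monos (Fin n) 2 (n + 1)).card := by
    intro a ha
    obtain ⟨x, hx, hr⟩ := exists_zero_of_mem_detLocus ha
    have := eRk_coeffSet_add_le hn (polyOf _ a) x hx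
    rw [coeffSet_polyOf] at this
    exact this hr
  by_cases hne : ∃ f : Psing (n + 1), ¬ CondR11 q₁ f
  swap
  · rw [show {f : Psing (n + 1) | ¬ CondR11 q₁ f} = ∅ from by
      ext f; simpa using not_exists.1 hne f]
    exact hasCodimGE_empty _
  have hmem : ∀ f ∈ {f : Psing (n + 1) | ¬ CondR11 q₁ f}, coeffMap ι f ∈ detLocus n := by
    intro f hf l D s
    by_contra hdet
    refine hf (condR11_of_det_ne_zero h _ (fun j h2 hj => ?_) s hdet)
    rw [homogeneousComponent_polyOfSum h2]
    congr 1
    exact polyOf_coeff fun m hm => coeff_restriction_eq_zero h.linear f hm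
  have hc : (n - 5) * (n - 4) / 2 ≤ (monos (Fin n) 2 (n + 1)).card := by
    obtain ⟨f, hf⟩ := hne
    exact_mod_cast (le_add_self).trans (hb _ (hmem f hf))
  refine hasCodimGE_of_preimage (coeffMap ι) (coeffMap_surjective h) hmem
    (d := (monos (Fin n) 2 (n + 1)).card - (n - 5) * (n - 4) / 2)
    (isIntegralOverVars_of_eRk_le _ _ fun a ha => ?_) ?_
  · have := hb a (zeroLocus_vanishingIdeal_detLocus_subset n ha)
    push_cast
    exact ENat.le_sub_of_add_le_right (ENat.natCast_ne_top _) this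
  · rw [Fintype.card_coe]; omega

theorem hasCodimGE_of_det_ne_zero {V : Type} [AddCommGroup V] [Module ℂ V] [FiniteDimensional ℂ V]
    {J P K : Type} [Fintype J] [DecidableEq J] [Fintype P] [Fintype K] [DecidableEq K]
    (ρ : V →ₗ[ℂ] (J → ℂ)) (hρ : Function.Surjective ρ)
    (L : K → J → MvPolynomial P ℂ) (G : K → MvPolynomial P ℂ) (s : K → J) {c : ℕ}
    (hc : Fintype.card P + 1 + c ≤ Fintype.card K) :
    HasCodimGE {v | ∃ w : P → ℂ, (Matrix.of fun m k => eval w (L m (s k))).det ≠ 0 ∧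
      ∀ k, ∑ j, eval w (L k j) * ρ v j = eval w (G k)} c := by
  by_cases hs : Function.Injective s
  swap
  · refine (hasCodimGE_empty c).mono fun v ⟨w, hw, _⟩ => hw ?_
    simp only [Function.Injective, not_forall] at hs
    obtain ⟨a, b, hab, hne⟩ := hs
    exact Matrix.det_zero_of_column_eq hne fun k => by simp [hab]
  obtain ⟨t, ht⟩ : ∃ t : K ⊕ {j // j ∉ Set.range s} ≃ J,
      (∀ k, t (Sum.inl k) = s k) ∧ ∀ j, t (Sum.inr j) = j.1 :=
    ⟨(Equiv.sumCongr (Equiv.ofInjective s hs) (Equiv.refl _)).trans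
      (Equiv.sumCompl (· ∈ Set.range s)), fun _ => rfl, fun _ => rfl⟩
  have hcard := Fintype.card_congr t
  rw [Fintype.card_sum] at hcard
  let r : MvPolynomial P ℂ →ₐ[ℂ] MvPolynomial (P ⊕ Unit ⊕ {j // j ∉ Set.range s}) ℂ :=
    rename Sum.inl
  let A : Matrix K K (MvPolynomial P ℂ) := Matrix.of fun m k => L m (s k)
  refine hasCodimGE_of_param ρ hρ (P := P ⊕ Unit ⊕ {j // j ∉ Set.range s})
    (fun j => Sum.elim
      (fun k => X (Sum.inr (Sum.inl ())) * ∑ m, r (A.adjugate k m) *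
        (r (G m) - ∑ j, r (L m (t (Sum.inr j))) * X (Sum.inr (Sum.inr j))))
      (fun j => X (Sum.inr (Sum.inr j))) (t.symm j)) ?_ ?_
  swap
  · rw [Fintype.card_sum, Fintype.card_sum, Fintype.card_unit]
    omega
  rintro v ⟨w, hw, hv⟩
  let B : Matrix K K ℂ := Matrix.of fun m k => eval w (L m (s k))
  have hB : B = (eval w).mapMatrix A := by ext; rfl
  refine ⟨Sum.elim w (Sum.elim (fun _ => B.det⁻¹) fun j => ρ v j.1), fun j => ?_⟩
  obtain ⟨j, rfl⟩ := t.surjective j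
  have hr : ∀ (w' : Unit ⊕ {j // j ∉ Set.range s} → ℂ) (p : MvPolynomial P ℂ),
      eval (Sum.elim w w') (r p) = eval w p := by
    intro w' p
    simp only [r, eval_rename]
    congr 2
  cases j with
  | inr j =>
    rw [Equiv.symm_apply_apply]
    simp [ht]
  | inl k =>
    simp only [Equiv.symm_apply_apply, Sum.elim_inl, map_mul, map_sum, map_sub, eval_X, hr,
      Sum.elim_inr]
    have h1 : ∀ m, eval w (G m) - ∑ j : {j // j ∉ Set.range s}, eval w (L m (t (Sum.inr j))) *
        ρ v j.1 = ∑ k, B m k * ρ v (t (Sum.inl k)) := by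
      intro m
      rw [← hv m, ← t.sum_comp, Fintype.sum_sum_type]
      simp only [ht, add_sub_cancel_right]
      rfl
    have h2 : ∀ m, eval w (A.adjugate k m) = B.adjugate k m := by
      intro m
      rw [hB, ← RingHom.map_adjugate]
      rfl
    simp_rw [h1, h2]
    have h3 := congrFun (congrArg (fun C => C.mulVec fun k => ρ v (t (Sum.inl k)))
      (Matrix.adjugate_mul B)) k
    simp only [← Matrix.mulVec_mulVec, Matrix.smul_mulVec, Matrix.one_mulVec] at h3
    rw [Pi.smul_apply, smul_eq_mul] at h3
    change _ = B.det⁻¹ * (B.adjugate.mulVec (B.mulVec fun k => ρ v (t (Sum.inl k)))) k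
    rw [h3, inv_mul_cancel_left₀ hw]

/-- A family of systems of `|K|` independent linear equations, depending polynomially on the
parameters `P`, imposes at least `|K| - |P| - 1` conditions. -/
theorem hasCodimGE_of_linear_system {V : Type} [AddCommGroup V] [Module ℂ V]
    [FiniteDimensional ℂ V] {J P K : Type} [Fintype J] [Fintype P] [Fintype K]
    (ρ : V →ₗ[ℂ] (J → ℂ)) (hρ : Function.Surjective ρ) {S : Set V}
    (L : K → J → MvPolynomial P ℂ) (G : K → MvPolynomial P ℂ)
    (hS : ∀ v ∈ S, ∃ w : P → ℂ,
      Submodule.span ℂ (Set.range fun j k => eval w (L k j)) = ⊤ ∧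
      ∀ k, ∑ j, eval w (L k j) * ρ v j = eval w (G k)) {c : ℕ}
    (hc : Fintype.card P + 1 + c ≤ Fintype.card K) : HasCodimGE S c := by
  classical
  by_cases hne : S.Nonempty
  swap
  · rw [Set.not_nonempty_iff_eq_empty.1 hne]
    exact hasCodimGE_empty c
  have key : ∀ v ∈ S, ∃ s : K → J, v ∈ {v | ∃ w : P → ℂ,
      (Matrix.of fun m k => eval w (L m (s k))).det ≠ 0 ∧
      ∀ k, ∑ j, eval w (L k j) * ρ v j = eval w (G k)} := by
    intro v hv
    obtain ⟨w, hw, h⟩ := hS v hv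
    obtain ⟨s, hs⟩ := exists_det_ne_zero_of_span (fun j k => eval w (L k j)) hw
    exact ⟨s, w, hs, h⟩
  have hcf : c ≤ Module.finrank ℂ V := by
    obtain ⟨v, hv⟩ := hne
    obtain ⟨s, w, hs, -⟩ := key v hv
    have hinj : Function.Injective s := by
      intro a b hab
      by_contra hne
      exact hs (Matrix.det_zero_of_column_eq hne fun k => by simp [hab])
    have h1 := Fintype.card_le_of_injective s hinj
    have h2 := LinearMap.finrank_le_finrank_of_surjective (f := ρ) hρ
    rw [Module.finrank_fintype_fun_eq_card] at h2
    omega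
  exact (HasCodimGE.iUnion hcf fun s => hasCodimGE_of_det_ne_zero ρ hρ L G s hc).mono
    fun v hv => Set.mem_iUnion.2 (key v hv)

section LeadingForms

variable {τ A : Type*} [CommRing A]

/-- All monomials `m` of `a` satisfy `deg m + d < N`. -/
def ShiftedDegreeLT (a : MvPolynomial τ A) (d N : ℕ) : Prop :=
  ∀ m, coeff m a ≠ 0 → m.degree + d < N

namespace ShiftedDegreeLT

variable {a b : MvPolynomial τ A} {d e N : ℕ}

theorem zero : ShiftedDegreeLT (0 : MvPolynomial τ A) d N := fun m h => absurd (coeff_zero m) h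

theorem eq_zero (h : ShiftedDegreeLT a d N) (hd : N ≤ d) : a = 0 := by
  ext m
  by_contra hm
  have := h m hm
  omega

theorem add (ha : ShiftedDegreeLT a d N) (hb : ShiftedDegreeLT b d N) :
    ShiftedDegreeLT (a + b) d N := by
  intro m hm
  by_cases h : coeff m a = 0
  · exact hb m fun h' => hm (by rw [coeff_add, h, h', add_zero])
  · exact ha m h

theorem neg (ha : ShiftedDegreeLT a d N) : ShiftedDegreeLT (-a) d N :=
  fun m hm => ha m fun h => hm (by rw [coeff_neg, h, neg_zero])

theorem sub (ha : ShiftedDegreeLT a d N) (hb : ShiftedDegreeLT b d N) :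
    ShiftedDegreeLT (a - b) d N := sub_eq_add_neg a b ▸ ha.add hb.neg

theorem mul {i : ℕ} (ha : ShiftedDegreeLT a 0 (i + 1)) (hb : ShiftedDegreeLT b d N) :
    ShiftedDegreeLT (a * b) d (i + N) := by
  classical
  intro m hm
  rw [coeff_mul] at hm
  obtain ⟨⟨x, y⟩, hxy, hne⟩ := Finset.exists_ne_zero_of_sum_ne_zero hm
  rw [Finset.HasAntidiagonal.mem_antidiagonal] at hxy
  have h1 : x.degree + 0 < i + 1 := ha x (left_ne_zero_of_mul hne)
  have h2 : y.degree + d < N := hb y (right_ne_zero_of_mul hne)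
  rw [← show x + y = m from hxy, map_add]
  omega

theorem shift (h : ShiftedDegreeLT a d N) (i : ℕ) : ShiftedDegreeLT a (d + i) (N + i) :=
  fun m hm => by have := h m hm; omega

theorem homogeneousComponent_eq_zero (h : ShiftedDegreeLT a 0 N) {i : ℕ} (hi : N ≤ i) :
    homogeneousComponent i a = 0 := by
  ext m
  rw [coeff_homogeneousComponent, coeff_zero, ite_eq_right_iff]
  intro hm
  by_contra hne
  have := h m hne
  omega

theorem of_isHomogeneous (ha : a.IsHomogeneous e) (he : e + d < N) : ShiftedDegreeLT a d N := by
  intro m hm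
  have : m.degree = e := by
    by_contra hd
    exact hm (ha.coeff_eq_zero hd)
  omega

theorem sub_homogeneousComponent (h : ShiftedDegreeLT a d (N + 1)) {i : ℕ} (hi : i + d = N) :
    ShiftedDegreeLT (a - homogeneousComponent i a) d N := by
  intro m hm
  rw [coeff_sub, coeff_homogeneousComponent] at hm
  split_ifs at hm with hd
  · simp at hm
  · rw [sub_zero] at hm
    have := h m hm
    omega

theorem homogeneousComponent_mul (ha : ShiftedDegreeLT a 0 (d + 1))
    (hb : ShiftedDegreeLT b 0 (e + 1)) :
    homogeneousComponent (d + e) (a * b) =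
      homogeneousComponent d a * homogeneousComponent e b := by
  have h1 := homogeneousComponent_mul_of_left (homogeneousComponent_isHomogeneous d a) b e
  have h2 := (hb.mul (ha.sub_homogeneousComponent (i := d) (by omega))).homogeneousComponent_eq_zero
    (i := d + e) (by omega)
  rw [← h1, ← sub_eq_zero, ← map_sub, ← sub_mul, mul_comm _ b, h2]

theorem exists_top (ha : ShiftedDegreeLT a d (N + 1)) (hb : ShiftedDegreeLT b 0 (d + 1)) :
    ∃ a₀, homogeneousComponent N (a * b) = a₀ * homogeneousComponent d b ∧
      ShiftedDegreeLT (a - a₀) d N ∧ (a₀ ≠ 0 → ∃ i, i + d = N ∧ a₀.IsHomogeneous i) := by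
  by_cases hd : d ≤ N
  · obtain ⟨i, rfl⟩ := Nat.exists_eq_add_of_le' hd
    have ha' : ShiftedDegreeLT a 0 (i + 1) := fun m hm => by have := ha m hm; omega
    exact ⟨_, ha'.homogeneousComponent_mul hb, ha.sub_homogeneousComponent rfl, fun _ =>
      ⟨i, rfl, homogeneousComponent_isHomogeneous i a⟩⟩
  · have := ha.eq_zero (by omega)
    subst this
    exact ⟨0, by simp, by simpa using zero, by simp⟩

end ShiftedDegreeLT

theorem exists_homogeneousComponent_mul_eq {t : MvPolynomial τ A} {d : ℕ} (ht : t.IsHomogeneous d)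
    (a : MvPolynomial τ A) (N : ℕ) :
    ∃ a₀, homogeneousComponent N (t * a) = t * a₀ ∧
      (a₀ = 0 ∨ ∃ i, i + d = N ∧ a₀.IsHomogeneous i) := by
  by_cases hd : d ≤ N
  · obtain ⟨i, rfl⟩ := Nat.exists_eq_add_of_le' hd
    have := homogeneousComponent_mul_of_left ht a i
    rw [add_comm d i] at this
    exact ⟨homogeneousComponent i a, this,
      Or.inr ⟨i, rfl, homogeneousComponent_isHomogeneous i a⟩⟩
  · refine ⟨0, ?_, Or.inl rfl⟩
    ext m
    rw [coeff_homogeneousComponent, mul_zero, coeff_zero, ite_eq_right_iff]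
    intro hm
    classical
    rw [coeff_mul]
    refine Finset.sum_eq_zero fun x hx => ?_
    rw [Finset.HasAntidiagonal.mem_antidiagonal] at hx
    rw [ht.coeff_eq_zero, zero_mul]
    intro h
    have := congrArg Finsupp.degree hx
    rw [show (x.1 + x.2).degree = x.1.degree + x.2.degree from map_add _ _ _] at this
    omega

variable {f₁ f₂ : MvPolynomial τ A} {d₁ d₂ : ℕ}

theorem exists_shiftedDegreeLT (a : MvPolynomial τ A) (d : ℕ) :
    ∃ N, ∀ k, N ≤ k → ShiftedDegreeLT a d k := by
  refine ⟨a.totalDegree + d + 1, fun k hk m hm => ?_⟩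
  have := le_totalDegree (mem_support_iff.2 hm)
  rw [show (m.sum fun _ e => e) = m.degree from rfl] at this
  omega

theorem exists_sub_mem_span (h₁ : ShiftedDegreeLT f₁ 0 (d₁ + 1))
    (h₂ : ShiftedDegreeLT f₂ 0 (d₂ + 1)) (D : ℕ) : ∀ u : MvPolynomial τ A,
    u ∉ Ideal.span {f₁, f₂} → ShiftedDegreeLT u 0 D →
    ∃ u' d, u - u' ∈ Ideal.span {f₁, f₂} ∧ ShiftedDegreeLT u' 0 (d + 1) ∧
      homogeneousComponent d u' ∉
        Ideal.span {homogeneousComponent d₁ f₁, homogeneousComponent d₂ f₂} := by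
  induction D with
  | zero =>
    intro u hu h
    rw [h.eq_zero le_rfl] at hu
    exact absurd (zero_mem _) hu
  | succ d ih =>
    intro u hu h
    by_cases hm : homogeneousComponent d u ∈
        Ideal.span {homogeneousComponent d₁ f₁, homogeneousComponent d₂ f₂}
    swap
    · exact ⟨u, d, by simp, h, hm⟩
    obtain ⟨a, b, hab⟩ := Ideal.mem_span_pair.1 hm
    have key : ∀ {f : MvPolynomial τ A} {e : ℕ} (a : MvPolynomial τ A),
        ShiftedDegreeLT f 0 (e + 1) → ∃ a', homogeneousComponent d (a * homogeneousComponent e f) =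
          a' * homogeneousComponent e f ∧
          ShiftedDegreeLT (a' * (f - homogeneousComponent e f)) 0 d := by
      intro f e a hf
      obtain ⟨a', ha', h'⟩ := exists_homogeneousComponent_mul_eq
        (homogeneousComponent_isHomogeneous e f) a d
      refine ⟨a', by rw [mul_comm a, ha', mul_comm], ?_⟩
      rcases h' with rfl | ⟨i, hi, h'⟩
      · rw [zero_mul]; exact ShiftedDegreeLT.zero
      · have := (ShiftedDegreeLT.of_isHomogeneous h' (d := 0) (N := i + 1) (by omega)).mul
          (hf.sub_homogeneousComponent (i := e) (by omega))
        rwa [hi] at this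
    obtain ⟨a', ha', ha''⟩ := key a h₁
    obtain ⟨b', hb', hb''⟩ := key b h₂
    have h3 : homogeneousComponent d u = a' * homogeneousComponent d₁ f₁ +
        b' * homogeneousComponent d₂ f₂ := by
      rw [← ha', ← hb', ← map_add, hab, homogeneousComponent_of_mem
        (homogeneousComponent_isHomogeneous d u), if_pos rfl]
    have hmem : a' * f₁ + b' * f₂ ∈ Ideal.span {f₁, f₂} := Ideal.mem_span_pair.2 ⟨a', b', rfl⟩
    obtain ⟨u', e, hu', h'⟩ := ih (u - (a' * f₁ + b' * f₂))
      (fun hc => hu (by simpa using add_mem hc hmem)) (by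
        rw [show u - (a' * f₁ + b' * f₂) = (u - homogeneousComponent d u) -
          (a' * (f₁ - homogeneousComponent d₁ f₁) + b' * (f₂ - homogeneousComponent d₂ f₂)) by
          rw [h3]; ring]
        exact (h.sub_homogeneousComponent (by omega)).sub (ha''.add hb''))
    refine ⟨u', e, ?_, h'⟩
    have := add_mem hu' hmem
    rwa [show u - (a' * f₁ + b' * f₂) - u' + (a' * f₁ + b' * f₂) = u - u' by ring] at this

variable [IsDomain A]

theorem homogeneousComponent_mem_span_of_rep (h₁ : ShiftedDegreeLT f₁ 0 (d₁ + 1))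
    (h₂ : ShiftedDegreeLT f₂ 0 (d₂ + 1)) (hp : Prime (homogeneousComponent d₁ f₁))
    (hnd : ¬ homogeneousComponent d₁ f₁ ∣ homogeneousComponent d₂ f₂) {d : ℕ} (k : ℕ) :
    ∀ a b : MvPolynomial τ A, ShiftedDegreeLT a d₁ (d + k + 1) → ShiftedDegreeLT b d₂ (d + k + 1) →
      ShiftedDegreeLT (a * f₁ + b * f₂) 0 (d + 1) →
      homogeneousComponent d (a * f₁ + b * f₂) ∈
        Ideal.span {homogeneousComponent d₁ f₁, homogeneousComponent d₂ f₂} := by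
  induction k with
  | zero =>
    intro a b ha hb _
    obtain ⟨a₀, ha₀, -⟩ := ha.exists_top h₁
    obtain ⟨b₀, hb₀, -⟩ := hb.exists_top h₂
    rw [map_add, ha₀, hb₀]
    exact Ideal.mem_span_pair.2 ⟨a₀, b₀, rfl⟩
  | succ k ih =>
    intro a b ha hb hab
    obtain ⟨a₀, ha₀, ha₁, -⟩ := ha.exists_top h₁
    obtain ⟨b₀, hb₀, hb₁, hb₂⟩ := hb.exists_top h₂
    have h0 : a₀ * homogeneousComponent d₁ f₁ + b₀ * homogeneousComponent d₂ f₂ = 0 := by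
      rw [← ha₀, ← hb₀, ← map_add]
      exact hab.homogeneousComponent_eq_zero (by omega)
    have hdvd : homogeneousComponent d₁ f₁ ∣ b₀ := by
      refine (hp.dvd_or_dvd ?_).resolve_right hnd
      exact ⟨-a₀, by linear_combination h0⟩
    obtain ⟨c, hc, hci⟩ : ∃ c, b₀ = homogeneousComponent d₁ f₁ * c ∧
        (c = 0 ∨ ∃ i, i + d₁ + d₂ = d + (k + 1) ∧ c.IsHomogeneous i) := by
      by_cases hz : b₀ = 0
      · exact ⟨0, by rw [hz, mul_zero], Or.inl rfl⟩
      obtain ⟨i, hi, hbi⟩ := hb₂ hz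
      obtain ⟨c, hc⟩ := hdvd
      obtain ⟨c₀, hc₀, hc₁⟩ := exists_homogeneousComponent_mul_eq
        (homogeneousComponent_isHomogeneous d₁ f₁) c i
      refine ⟨c₀, ?_, hc₁.imp_right ?_⟩
      · rw [← hc₀, ← hc, homogeneousComponent_of_mem hbi, if_pos rfl]
      · rintro ⟨j, hj, h⟩
        exact ⟨j, by omega, h⟩
    have ha0 : a₀ = - (c * homogeneousComponent d₂ f₂) := by
      refine mul_right_cancel₀ hp.ne_zero ?_
      rw [hc] at h0
      linear_combination h0
    have hsub : ∀ {f : MvPolynomial τ A} {e e' : ℕ}, ShiftedDegreeLT f 0 (e + 1) →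
        (e = d₁ ∧ e' = d₂ ∨ e = d₂ ∧ e' = d₁) →
        ShiftedDegreeLT (c * (f - homogeneousComponent e f)) e' (d + k + 1) := by
      intro f e e' hf he
      rcases hci with rfl | ⟨i, hi, hci⟩
      · rw [zero_mul]; exact ShiftedDegreeLT.zero
      · have h3 := ((ShiftedDegreeLT.of_isHomogeneous hci (d := 0) (N := i + 1) (by omega)).mul
          (hf.sub_homogeneousComponent (i := e) (by omega))).shift e'
        rw [zero_add] at h3
        rwa [show i + e + e' = d + k + 1 by omega] at h3
    have := ih (a + c * f₂) (b - c * f₁) ?_ ?_ ?_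
    · rwa [show (a + c * f₂) * f₁ + (b - c * f₁) * f₂ = a * f₁ + b * f₂ by ring] at this
    · rw [show a + c * f₂ = (a - a₀) + c * (f₂ - homogeneousComponent d₂ f₂) by rw [ha0]; ring]
      exact ha₁.add (hsub h₂ (Or.inr ⟨rfl, rfl⟩))
    · rw [show b - c * f₁ = (b - b₀) - c * (f₁ - homogeneousComponent d₁ f₁) by rw [hc]; ring]
      exact hb₁.sub (hsub h₁ (Or.inl ⟨rfl, rfl⟩))
    · rwa [show (a + c * f₂) * f₁ + (b - c * f₁) * f₂ = a * f₁ + b * f₂ by ring]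

theorem homogeneousComponent_mem_span (h₁ : ShiftedDegreeLT f₁ 0 (d₁ + 1))
    (h₂ : ShiftedDegreeLT f₂ 0 (d₂ + 1)) (hp : Prime (homogeneousComponent d₁ f₁))
    (hnd : ¬ homogeneousComponent d₁ f₁ ∣ homogeneousComponent d₂ f₂) {d : ℕ}
    {h : MvPolynomial τ A} (hh : h ∈ Ideal.span {f₁, f₂}) (hd : ShiftedDegreeLT h 0 (d + 1)) :
    homogeneousComponent d h ∈
        Ideal.span {homogeneousComponent d₁ f₁, homogeneousComponent d₂ f₂} := by
  obtain ⟨a, b, rfl⟩ := Ideal.mem_span_pair.1 hh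
  obtain ⟨N, hN⟩ := exists_shiftedDegreeLT a d₁
  obtain ⟨N', hN'⟩ := exists_shiftedDegreeLT b d₂
  exact homogeneousComponent_mem_span_of_rep h₁ h₂ hp hnd (N + N') a b (hN _ (by omega))
    (hN' _ (by omega)) hd

/-- If the leading forms of `f₁, f₂` form a regular sequence starting with a prime and generate a
prime ideal, then `f₁, f₂` generate a prime ideal. -/
theorem isPrime_span_pair_of_leadingForms (h₁ : ShiftedDegreeLT f₁ 0 (d₁ + 1))
    (h₂ : ShiftedDegreeLT f₂ 0 (d₂ + 1)) (hp : Prime (homogeneousComponent d₁ f₁))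
    (hnd : ¬ homogeneousComponent d₁ f₁ ∣ homogeneousComponent d₂ f₂)
    (hI : (Ideal.span {homogeneousComponent d₁ f₁, homogeneousComponent d₂ f₂}).IsPrime) :
    (Ideal.span {f₁, f₂}).IsPrime := by
  refine ⟨fun htop => ?_, fun {u v} huv => ?_⟩
  · have h1 : (1 : MvPolynomial τ A) ∈ Ideal.span {f₁, f₂} := htop ▸ Submodule.mem_top
    have := homogeneousComponent_mem_span h₁ h₂ hp hnd (d := 0) h1
      (ShiftedDegreeLT.of_isHomogeneous (isHomogeneous_one τ A) (by omega))
    rw [homogeneousComponent_of_mem (isHomogeneous_one τ A), if_pos rfl] at this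
    exact hI.ne_top ((Ideal.eq_top_iff_one _).2 this)
  · by_contra! hcon
    obtain ⟨N, hN⟩ := exists_shiftedDegreeLT u 0
    obtain ⟨N', hN'⟩ := exists_shiftedDegreeLT v 0
    obtain ⟨u', d, hu, hu', hu''⟩ := exists_sub_mem_span h₁ h₂ N u hcon.1 (hN _ le_rfl)
    obtain ⟨v', e, hv, hv', hv''⟩ := exists_sub_mem_span h₁ h₂ N' v hcon.2 (hN' _ le_rfl)
    have hmem : u' * v' ∈ Ideal.span {f₁, f₂} := by
      have := sub_mem huv (add_mem (Ideal.mul_mem_right v _ hu) (Ideal.mul_mem_left _ u' hv))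
      rwa [show u * v - ((u - u') * v + u' * (v - v')) = u' * v' by ring] at this
    have := homogeneousComponent_mem_span h₁ h₂ hp hnd (d := d + e) hmem (by
      have := hu'.mul hv'
      rwa [← add_assoc] at this)
    rw [hu'.homogeneousComponent_mul hv'] at this
    exact (hI.mem_or_mem this).elim hu'' hv''

end LeadingForms

section Segre

variable (A : Type*) [CommRing A]

/-- The parametrisation of the cone `x₀x₁ = x₂x₃` by `x₀ = u₀v₀`, `x₁ = u₁v₁`, `x₂ = u₀v₁`,
`x₃ = u₁v₀`, `x₄ = y`. -/
def segre : MvPolynomial (Fin 5) A →ₐ[A] MvPolynomial (Fin 5) A :=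
  aeval ![X 0 * X 2, X 1 * X 3, X 0 * X 3, X 1 * X 2, X 4]

/-- The equation `x₀x₁ - x₂x₃` of the Segre cone. -/
def segreQuadric : MvPolynomial (Fin 5) A := X 0 * X 1 - X 2 * X 3

variable {A}

theorem monomial_fin_five (m : Fin 5 →₀ ℕ) (a : A) : monomial m a =
    C a * (X 0 ^ m 0 * X 1 ^ m 1 * X 2 ^ m 2 * X 3 ^ m 3 * X 4 ^ m 4) := by
  rw [monomial_eq, Finsupp.prod_fintype _ _ fun _ => pow_zero _, Fin.prod_univ_five]

/-- The action of the Segre parametrisation on exponents. -/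
def segreExp (m : Fin 5 →₀ ℕ) : Fin 5 →₀ ℕ :=
  Finsupp.equivFunOnFinite.symm ![m 0 + m 2, m 1 + m 3, m 0 + m 3, m 1 + m 2, m 4]

theorem segre_monomial (m : Fin 5 →₀ ℕ) (a : A) :
    segre A (monomial m a) = monomial (segreExp m) a := by
  rw [monomial_fin_five m, monomial_fin_five (segreExp m)]
  simp [segre, segreExp, algebraMap_eq]
  ring

theorem segre_segreQuadric : segre A (segreQuadric A) = 0 := by
  simp [segre, segreQuadric]
  ring

/-- Exponents not divisible by `x₀x₁`. -/
def IsSegreReduced (p : MvPolynomial (Fin 5) A) : Prop :=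
  ∀ m, coeff m p ≠ 0 → m 0 = 0 ∨ m 1 = 0

theorem IsSegreReduced.add {p q : MvPolynomial (Fin 5) A} (hp : IsSegreReduced p)
    (hq : IsSegreReduced q) : IsSegreReduced (p + q) := by
  intro m hm
  by_cases h : coeff m p = 0
  · exact hq m fun h' => hm (by rw [coeff_add, h, h', add_zero])
  · exact hp m h

theorem exists_isSegreReduced (p : MvPolynomial (Fin 5) A) :
    ∃ p', IsSegreReduced p' ∧ segreQuadric A ∣ p - p' := by
  classical
  induction p using MvPolynomial.induction_on' with
  | add p q hp hq =>
    obtain ⟨p', hp', hp⟩ := hp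
    obtain ⟨q', hq', hq⟩ := hq
    refine ⟨p' + q', hp'.add hq', ?_⟩
    rw [add_sub_add_comm]
    exact dvd_add hp hq
  | monomial m a =>
    set k := min (m 0) (m 1) with hk
    refine ⟨monomial (Finsupp.equivFunOnFinite.symm
      ![m 0 - k, m 1 - k, m 2 + k, m 3 + k, m 4]) a, ?_, ?_⟩
    · intro m' hm'
      rw [coeff_monomial] at hm'
      obtain rfl : _ = m' := by
        by_contra h
        exact hm' (if_neg h)
      simp
      omega
    · have h0 : m 0 = (m 0 - k) + k := by omega
      have h1 : m 1 = (m 1 - k) + k := by omega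
      rw [monomial_fin_five m, monomial_fin_five]
      simp only [Finsupp.equivFunOnFinite_symm_apply_apply, Matrix.cons_val]
      have h : segreQuadric A ∣ (X 0 * X 1) ^ k - (X 2 * X 3) ^ k := sub_dvd_pow_sub_pow _ _ k
      have := h.mul_left (C a * (X 0 ^ (m 0 - k) * X 1 ^ (m 1 - k) * X 2 ^ m 2 * X 3 ^ m 3 *
        X 4 ^ m 4))
      convert this using 1
      conv_lhs => rw [h0, h1]
      simp only [Nat.add_sub_cancel]
      ring

theorem IsSegreReduced.eq_zero {p : MvPolynomial (Fin 5) A} (hp : IsSegreReduced p)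
    (h : segre A p = 0) : p = 0 := by
  classical
  by_contra hne
  obtain ⟨m, hm⟩ := MvPolynomial.ne_zero_iff.1 hne
  have h2 : coeff (segreExp m) (segre A p) = coeff m p := by
    conv_lhs => rw [p.as_sum, map_sum, coeff_sum]
    simp_rw [segre_monomial, coeff_monomial]
    rw [Finset.sum_eq_single m]
    · rw [if_pos rfl]
    · intro m' hm' hne
      refine if_neg fun he => hne ?_
      have h3 := hp m hm
      have h4 := hp m' (mem_support_iff.1 hm')
      have e : ∀ i, segreExp m' i = segreExp m i := fun i => by rw [he]
      have e0 := e 0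
      have e1 := e 1
      have e2 := e 2
      have e3 := e 3
      have e4 := e 4
      simp [segreExp] at e0 e1 e2 e3 e4
      ext i
      fin_cases i <;> simp <;> omega
    · intro hm'
      exact absurd (notMem_support_iff.1 hm') hm
  rw [h, coeff_zero] at h2
  exact hm h2.symm

theorem segre_eq_zero_iff {p : MvPolynomial (Fin 5) A} :
    segre A p = 0 ↔ segreQuadric A ∣ p := by
  constructor
  · intro h
    obtain ⟨p', hp', hd⟩ := exists_isSegreReduced p
    obtain ⟨c, hc⟩ := id hd
    have : segre A p' = 0 := by
      have h1 : p' = p - segreQuadric A * c := by rw [← hc]; ring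
      rw [h1, map_sub, map_mul, segre_segreQuadric, h, zero_mul, sub_zero]
    rw [hp'.eq_zero this, sub_zero] at hd
    exact hd
  · rintro ⟨c, rfl⟩
    rw [map_mul, segre_segreQuadric, zero_mul]

theorem prime_segreQuadric [IsDomain A] : Prime (segreQuadric A) := by
  refine ⟨?_, ?_, ?_⟩
  · intro h
    have h1 := congrArg (eval ![(1 : A), 1, 0, 0, 0]) h
    simp [segreQuadric] at h1
  · intro h
    have := segre_eq_zero_iff.2 (h.dvd : segreQuadric A ∣ 1)
    rw [map_one] at this
    exact one_ne_zero this
  · intro a b hab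
    rw [← segre_eq_zero_iff, map_mul] at hab
    rcases mul_eq_zero.1 hab with h | h
    · exact .inl (segre_eq_zero_iff.1 h)
    · exact .inr (segre_eq_zero_iff.1 h)

/-- The weights for which the image of the Segre parametrisation is the part of weight zero. -/
def segreWeight : Fin 5 → ℤ := ![1, 1, -1, -1, 0]

theorem weight_fin_five {M : Type*} [AddCommMonoid M] (w : Fin 5 → M) (m : Fin 5 →₀ ℕ) :
    Finsupp.weight w m = m 0 • w 0 + m 1 • w 1 + m 2 • w 2 + m 3 • w 3 + m 4 • w 4 := by
  rw [Finsupp.weight_apply, Finsupp.sum_fintype _ _ (by simp), Fin.sum_univ_five]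

theorem isWeightedHomogeneous_segre (p : MvPolynomial (Fin 5) A) :
    IsWeightedHomogeneous segreWeight (segre A p) 0 := by
  induction p using MvPolynomial.induction_on' with
  | add p q hp hq => rw [map_add]; exact hp.add hq
  | monomial m a =>
    rw [segre_monomial]
    apply isWeightedHomogeneous_monomial
    rw [weight_fin_five]
    simp [segreWeight, segreExp]
    ring

theorem exists_segre_eq {p : MvPolynomial (Fin 5) A} (hp : IsWeightedHomogeneous segreWeight p 0) :
    ∃ q, segre A q = p := by
  have key : ∀ m ∈ p.support, ∃ q, segre A q = monomial m (coeff m p) := by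
    intro m hm
    have h := hp (mem_support_iff.1 hm)
    rw [weight_fin_five] at h
    simp [segreWeight] at h
    refine ⟨monomial (Finsupp.equivFunOnFinite.symm
      ![min (m 0) (m 2), m 3 - (m 0 - min (m 0) (m 2)), m 0 - min (m 0) (m 2),
        m 2 - min (m 0) (m 2), m 4]) (coeff m p), ?_⟩
    rw [segre_monomial]
    refine congrArg (fun e => monomial e (coeff m p)) (Finsupp.ext fun i => ?_)
    fin_cases i <;> simp [segreExp] <;> omega
  choose! q hq using key
  refine ⟨∑ m ∈ p.support, q m, ?_⟩
  conv_rhs => rw [p.as_sum]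
  rw [map_sum]
  exact Finset.sum_congr rfl hq

theorem weightedHomogeneousComponent_mul_of_left {τ M : Type*} [AddCancelCommMonoid M]
    {w : τ → M} {a : MvPolynomial τ A} {i : M} (ha : IsWeightedHomogeneous w a i)
    (b : MvPolynomial τ A) (j : M) :
    weightedHomogeneousComponent w (i + j) (a * b) = a * weightedHomogeneousComponent w j b := by
  classical
  induction b using MvPolynomial.induction_on' with
  | add p q hp hq => rw [mul_add, map_add, hp, hq, map_add, mul_add]
  | monomial m c =>
    have hm := isWeightedHomogeneous_monomial w m c rfl
    rw [weightedHomogeneousComponent_of_mem (ha.mul hm), weightedHomogeneousComponent_of_mem hm]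
    by_cases h : j = Finsupp.weight w m
    · rw [if_pos h, if_pos (by rw [h])]
    · rw [if_neg h, if_neg fun h' => h (add_left_cancel h'), mul_zero]

theorem isPrime_span_segreQuadric [IsDomain A] {t : MvPolynomial (Fin 5) A}
    (ht : Prime (segre A t)) : (Ideal.span {segreQuadric A, t}).IsPrime := by
  have key : ∀ u, segre A t ∣ segre A u ↔ u ∈ Ideal.span {segreQuadric A, t} := by
    intro u
    rw [Ideal.mem_span_pair]
    constructor
    · rintro ⟨r, hr⟩
      obtain ⟨s, hs⟩ := exists_segre_eq
        (weightedHomogeneousComponent_isWeightedHomogeneous (w := segreWeight) 0 r)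
      have h1 := congrArg (weightedHomogeneousComponent segreWeight 0) hr
      rw [(isWeightedHomogeneous_segre u).weightedHomogeneousComponent_same,
        ← zero_add (0 : ℤ), weightedHomogeneousComponent_mul_of_left
          (isWeightedHomogeneous_segre t), ← hs, ← map_mul, ← sub_eq_zero, ← map_sub,
        segre_eq_zero_iff] at h1
      obtain ⟨c, hc⟩ := h1
      exact ⟨c, s, by rw [mul_comm c, ← hc]; ring⟩
    · rintro ⟨a, b, rfl⟩
      rw [map_add, map_mul, map_mul, segre_segreQuadric, mul_zero, zero_add]
      exact dvd_mul_left _ _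
  refine ⟨?_, ?_⟩
  · rw [Ideal.ne_top_iff_one, ← key, map_one]
    exact fun h => ht.not_isUnit (isUnit_of_dvd_one h)
  · intro a b hab
    rw [← key, map_mul] at hab
    rw [← key, ← key]
    exact ht.dvd_or_dvd hab

end Segre

section WeightedFactor

variable {τ A : Type*} [CommRing A]

/-- The substitution `xᵢ ↦ xᵢ T ^ wᵢ`. -/
def weightSubst (w : τ → ℕ) : MvPolynomial τ A →ₐ[A] Polynomial (MvPolynomial τ A) :=
  aeval fun i => Polynomial.C (X i) * Polynomial.X ^ w i

theorem weightSubst_monomial (w : τ → ℕ) (m : τ →₀ ℕ) (a : A) :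
    weightSubst w (monomial m a) =
      Polynomial.C (monomial m a) * Polynomial.X ^ Finsupp.weight w m := by
  rw [weightSubst, aeval_monomial, monomial_eq, Polynomial.C_mul, IsScalarTower.algebraMap_apply A
    (MvPolynomial τ A), mul_assoc]
  congr 1
  simp only [mul_pow, ← pow_mul, Finsupp.weight_apply]
  rw [Finsupp.prod_mul, Finsupp.prod, Finsupp.prod, Finsupp.prod, map_prod, Finsupp.sum,
    ← Finset.prod_pow_eq_pow_sum]
  simp_rw [map_pow, smul_eq_mul, mul_comm (w _)]

theorem coeff_weightSubst (w : τ → ℕ) (p : MvPolynomial τ A) (d : ℕ) :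
    (weightSubst w p).coeff d = weightedHomogeneousComponent w d p := by
  classical
  induction p using MvPolynomial.induction_on' with
  | add p q hp hq => rw [map_add, Polynomial.coeff_add, hp, hq, map_add]
  | monomial m a =>
    rw [weightSubst_monomial, Polynomial.coeff_C_mul_X_pow,
      weightedHomogeneousComponent_of_mem (isWeightedHomogeneous_monomial w m a rfl)]

theorem isWeightedHomogeneous_of_coeff_weightSubst {w : τ → ℕ} {p : MvPolynomial τ A} {d : ℕ}
    (h : ∀ e, (weightSubst w p).coeff e ≠ 0 → e = d) : IsWeightedHomogeneous w p d := by
  classical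
  intro m hm
  refine h _ fun h0 => hm ?_
  rw [coeff_weightSubst] at h0
  have := congrArg (coeff m) h0
  rwa [coeff_weightedHomogeneousComponent, if_pos rfl, coeff_zero] at this

theorem eq_of_coeff_weightSubst_ne_zero {w : τ → ℕ} {p : MvPolynomial τ A} {d e : ℕ}
    (hp : IsWeightedHomogeneous w p d) (he : (weightSubst w p).coeff e ≠ 0) : e = d := by
  by_contra h
  rw [coeff_weightSubst, hp.weightedHomogeneousComponent_ne e h] at he
  exact he rfl

theorem IsWeightedHomogeneous.exists_of_mul [IsDomain A] {w : τ → ℕ} {p q : MvPolynomial τ A}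
    {d : ℕ} (h : IsWeightedHomogeneous w (p * q) d) (h0 : p * q ≠ 0) :
    ∃ i j, i + j = d ∧ IsWeightedHomogeneous w p i ∧ IsWeightedHomogeneous w q j := by
  have hinj : ∀ p : MvPolynomial τ A, weightSubst w p = 0 → p = 0 := by
    intro p hp
    have : IsWeightedHomogeneous w p 0 :=
      isWeightedHomogeneous_of_coeff_weightSubst fun e he => by simp [hp] at he
    rw [← this.weightedHomogeneousComponent_same, ← coeff_weightSubst, hp, Polynomial.coeff_zero]
  have hne : weightSubst w (p * q) ≠ 0 := fun h' => h0 (hinj _ h')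
  have hP : weightSubst w p ≠ 0 := fun h' => hne (by rw [map_mul, h', zero_mul])
  have hQ : weightSubst w q ≠ 0 := fun h' => hne (by rw [map_mul, h', mul_zero])
  have h1 : (weightSubst w (p * q)).natDegree = d := by
    refine eq_of_coeff_weightSubst_ne_zero h ?_
    rw [Polynomial.coeff_natDegree]
    exact Polynomial.leadingCoeff_ne_zero.2 hne
  have h2 : (weightSubst w (p * q)).natTrailingDegree = d := by
    refine eq_of_coeff_weightSubst_ne_zero h ?_
    exact Polynomial.trailingCoeff_nonzero_iff_nonzero.2 hne
  rw [map_mul, Polynomial.natDegree_mul hP hQ] at h1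
  rw [map_mul, Polynomial.natTrailingDegree_mul hP hQ] at h2
  have h3 := (weightSubst w p).natTrailingDegree_le_natDegree
  have h4 := (weightSubst w q).natTrailingDegree_le_natDegree
  refine ⟨_, _, h1, isWeightedHomogeneous_of_coeff_weightSubst fun e he => ?_,
    isWeightedHomogeneous_of_coeff_weightSubst fun e he => ?_⟩
  all_goals
    have h5 := Polynomial.le_natDegree_of_ne_zero he
    have h6 := Polynomial.natTrailingDegree_le_of_ne_zero he
    omega

end WeightedFactor

section Bidegree

/-- The weights defining the first degree. -/
def segreWeight₁ : Fin 5 → ℕ := ![1, 1, 0, 0, 1]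

/-- The weights defining the second degree. -/
def segreWeight₂ : Fin 5 → ℕ := ![0, 0, 1, 1, 1]

variable {A : Type*} [CommRing A]

/-- Polynomials of bidegree `(i, j)`. -/
def IsBihomogeneous (p : MvPolynomial (Fin 5) A) (i j : ℕ) : Prop :=
  IsWeightedHomogeneous segreWeight₁ p i ∧ IsWeightedHomogeneous segreWeight₂ p j

/-- Exponents of bidegree `(i, j)`. -/
def biMonos (i j : ℕ) : Finset (Fin 5 →₀ ℕ) :=
  (monos (Fin 5) 0 (i + j)).filter fun m => m 0 + m 1 + m 4 = i ∧ m 2 + m 3 + m 4 = j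

theorem mem_biMonos {i j : ℕ} {m : Fin 5 →₀ ℕ} :
    m ∈ biMonos i j ↔ m 0 + m 1 + m 4 = i ∧ m 2 + m 3 + m 4 = j := by
  rw [biMonos, Finset.mem_filter, mem_monos, and_iff_right_iff_imp]
  rintro ⟨h1, h2⟩
  refine ⟨zero_le, ?_⟩
  rw [Finsupp.degree_eq_sum, Fin.sum_univ_five]
  omega

theorem isBihomogeneous_iff {p : MvPolynomial (Fin 5) A} {i j : ℕ} :
    IsBihomogeneous p i j ↔ ∀ m ∉ biMonos i j, coeff m p = 0 := by
  constructor
  · rintro ⟨h1, h2⟩ m hm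
    by_contra h
    have h1 := h1 h
    have h2 := h2 h
    rw [weight_fin_five] at h1 h2
    simp [segreWeight₁, segreWeight₂] at h1 h2
    exact hm (mem_biMonos.2 ⟨h1, h2⟩)
  · intro h
    constructor <;> intro m hm <;> rw [weight_fin_five] <;>
      have h2 := mem_biMonos.1 (not_imp_comm.1 (h m) hm) <;>
      simp [segreWeight₁, segreWeight₂] <;> omega

theorem isBihomogeneous_segre_monomial (m : Fin 5 →₀ ℕ) (a : A) :
    IsBihomogeneous (segre A (monomial m a)) m.degree m.degree := by
  rw [segre_monomial]
  constructor <;> apply isWeightedHomogeneous_monomial <;>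
    rw [weight_fin_five, Finsupp.degree_eq_sum, Fin.sum_univ_five] <;>
    simp [segreWeight₁, segreWeight₂, segreExp] <;> ring

theorem isBihomogeneous_segre {p : MvPolynomial (Fin 5) A} {d : ℕ} (hp : p.IsHomogeneous d) :
    IsBihomogeneous (segre A p) d d := by
  rw [p.as_sum, map_sum]
  have h : ∀ m ∈ p.support, IsBihomogeneous (segre A (monomial m (coeff m p))) d d := by
    intro m hm
    have hd : m.degree = d := by
      by_contra h
      exact mem_support_iff.1 hm (hp.coeff_eq_zero h)
    exact hd ▸ isBihomogeneous_segre_monomial m _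
  exact ⟨IsWeightedHomogeneous.sum _ _ _ fun m hm => (h m hm).1,
    IsWeightedHomogeneous.sum _ _ _ fun m hm => (h m hm).2⟩

/-- The bidegrees of the factors of a proper factorisation in bidegree `(d, d)`. -/
def properBidegrees (d : ℕ) : Finset (ℕ × ℕ) :=
  ((Finset.range (d + 1) ×ˢ Finset.range (d + 1)).erase (0, 0)).erase (d, d)

theorem mem_properBidegrees {d i j : ℕ} :
    (i, j) ∈ properBidegrees d ↔ i ≤ d ∧ j ≤ d ∧ ¬ (i = 0 ∧ j = 0) ∧ ¬ (i = d ∧ j = d) := by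
  simp only [properBidegrees, Finset.mem_erase, Finset.mem_product, Finset.mem_range, ne_eq,
    Prod.mk.injEq]
  omega

theorem IsBihomogeneous.isUnit {F : Type*} [Field F] {p : MvPolynomial (Fin 5) F} (hp : p ≠ 0)
    (h : IsBihomogeneous p 0 0) : IsUnit p := by
  have h1 : p = C (coeff 0 p) := by
    ext m
    rw [coeff_C]
    split_ifs with hm
    · rw [hm]
    · refine isBihomogeneous_iff.1 h m fun hm' => hm ?_
      rw [mem_biMonos] at hm'
      ext i
      fin_cases i <;> simp <;> omega
  rw [h1]
  refine (IsUnit.mk0 _ fun h0 => hp ?_).map C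
  rw [h1, h0, map_zero]

theorem IsBihomogeneous.exists_factors {F : Type*} [Field F] {p : MvPolynomial (Fin 5) F} {d : ℕ}
    (hd : d ≠ 0) (h : IsBihomogeneous p d d) (hp : ¬ Prime p) :
    ∃ i j, (i, j) ∈ properBidegrees d ∧ ∃ a b, IsBihomogeneous a i j ∧
      IsBihomogeneous b (d - i) (d - j) ∧ p = a * b := by
  by_cases h0 : p = 0
  · refine ⟨0, d, ?_, 0, 0, ?_, ?_, by rw [h0, zero_mul]⟩
    · rw [mem_properBidegrees]
      omega
    all_goals exact ⟨isWeightedHomogeneous_zero _ _ _, isWeightedHomogeneous_zero _ _ _⟩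
  have hfac : ∀ a b, p = a * b → ∃ i j, i ≤ d ∧ j ≤ d ∧ IsBihomogeneous a i j ∧
      IsBihomogeneous b (d - i) (d - j) := by
    rintro a b rfl
    obtain ⟨i, i', hi, ha, hb⟩ := IsWeightedHomogeneous.exists_of_mul h.1 h0
    obtain ⟨j, j', hj, ha', hb'⟩ := IsWeightedHomogeneous.exists_of_mul h.2 h0
    obtain rfl : i' = d - i := by omega
    obtain rfl : j' = d - j := by omega
    exact ⟨i, j, by omega, by omega, ⟨ha, ha'⟩, ⟨hb, hb'⟩⟩
  have hu : ¬ IsUnit p := by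
    rintro hu
    obtain ⟨b, hb⟩ := hu.exists_right_inv
    have h1 : IsWeightedHomogeneous segreWeight₁ (p * b) 0 := by
      rw [hb]
      exact isWeightedHomogeneous_one _ _
    obtain ⟨i, i', hi, ha, -⟩ := IsWeightedHomogeneous.exists_of_mul h1 (by rw [hb]; exact one_ne_zero)
    have := ha.inj_right h0 h.1
    omega
  rw [← irreducible_iff_prime, irreducible_iff] at hp
  push Not at hp
  obtain ⟨a, b, hab, ha, hb⟩ := hp hu
  obtain ⟨i, j, hi, hj, ha', hb'⟩ := hfac a b hab
  have ha0 : a ≠ 0 := fun h' => h0 (by rw [hab, h', zero_mul])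
  have hb0 : b ≠ 0 := fun h' => h0 (by rw [hab, h', mul_zero])
  refine ⟨i, j, mem_properBidegrees.2 ⟨hi, hj, ?_, ?_⟩, a, b, ha', hb', hab⟩
  · rintro ⟨rfl, rfl⟩
    exact ha (ha'.isUnit ha0)
  · rintro ⟨rfl, rfl⟩
    rw [Nat.sub_self] at hb'
    exact hb (hb'.isUnit hb0)

theorem card_biMonos {i j d : ℕ} (hi : i ≤ d) :
    (biMonos i j).card = ∑ e ∈ Finset.range (d + 1), (i + 1 - e) * (j + 1 - e) := by
  have h : ∀ e, (i + 1 - e) * (j + 1 - e) =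
      (Finset.range (i + 1 - e) ×ˢ Finset.range (j + 1 - e)).card := by
    intro e
    rw [Finset.card_product, Finset.card_range, Finset.card_range]
  simp_rw [h]
  rw [← Finset.card_sigma]
  refine Finset.card_nbij' (fun m => ⟨m 4, m 0, m 2⟩)
    (fun x => Finsupp.equivFunOnFinite.symm ![x.2.1, i - x.1 - x.2.1, x.2.2, j - x.1 - x.2.2, x.1])
    ?_ ?_ ?_ ?_
  · intro m hm
    have hm := mem_biMonos.1 hm
    simp
    omega
  · rintro ⟨e, a, b⟩ hx
    simp at hx
    refine mem_biMonos.2 ?_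
    simp
    omega
  · intro m hm
    have hm := mem_biMonos.1 hm
    ext k
    fin_cases k <;> simp <;> omega
  · rintro ⟨e, a, b⟩ hx
    simp

theorem sum_range_sub (d : ℕ) : 2 * ∑ e ∈ Finset.range d, (d - e) = d * (d + 1) := by
  induction d with
  | zero => rfl
  | succ d ih =>
    rw [Finset.sum_range_succ']
    simp only [Nat.add_sub_add_right, Nat.sub_zero, mul_add, ih]
    ring

theorem card_biMonos_add_le {n i j : ℕ} (hn : 5 ≤ n) (h : (i, j) ∈ properBidegrees (n + 1)) :
    n * 5 + ((biMonos i j).card + (biMonos (n + 1 - i) (n + 1 - j)).card) + 1 +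
      (n - 5) * (n - 4) / 2 ≤ (biMonos (n + 1) (n + 1)).card := by
  rw [mem_properBidegrees] at h
  obtain ⟨hi, hj, h0, h1⟩ := h
  rw [card_biMonos hi, card_biMonos (Nat.sub_le _ i), card_biMonos le_rfl]
  generalize hd : n + 1 = d at *
  have hterm : ∀ e < d, (i + 1 - (e + 1)) * (j + 1 - (e + 1)) +
      (d - i + 1 - (e + 1)) * (d - j + 1 - (e + 1)) + (d - e) ≤
        (d + 1 - (e + 1)) * (d + 1 - (e + 1)) := by
    intro e he
    obtain ⟨L, hL⟩ : ∃ L, d - e = L + 1 := ⟨d - e - 1, by omega⟩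
    have e1 : d + 1 - (e + 1) = L + 1 := by omega
    rw [hL, e1]
    generalize hA : i + 1 - (e + 1) = a
    generalize hB : j + 1 - (e + 1) = b
    generalize hA' : d - i + 1 - (e + 1) = a'
    generalize hB' : d - j + 1 - (e + 1) = b'
    suffices h : a * b + a' * b' ≤ (L + 1) * L by nlinarith
    have ha : a + a' ≤ L + 1 := by omega
    have hb : b + b' ≤ L + 1 := by omega
    by_cases hb1 : b ≤ L ∧ b' ≤ L
    · calc a * b + a' * b' ≤ a * L + a' * L := by gcongr <;> tauto
        _ = (a + a') * L := by ring
        _ ≤ _ := by gcongr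
    · by_cases hb2 : b ≤ L
      · have : b' = L + 1 := by omega
        have : b = 0 := by omega
        have : a' ≤ L := by omega
        subst b b'
        nlinarith
      · have : b = L + 1 := by omega
        have : b' = 0 := by omega
        have : a ≤ L := by omega
        subst b b'
        nlinarith
  have hzero : (i + 1) * (j + 1) + (d - i + 1) * (d - j + 1) + d ≤ (d + 1) * (d + 1) + 1 := by
    obtain ⟨i', rfl⟩ := Nat.exists_eq_add_of_le hi
    obtain ⟨j', hj'⟩ := Nat.exists_eq_add_of_le hj
    rw [Nat.add_sub_cancel_left, show i + i' - j = j' by omega]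
    suffices h : i + i' ≤ i * j' + i' * j by nlinarith
    rcases Nat.eq_zero_or_pos i with rfl | hi0
    · have : 1 ≤ j := by omega
      nlinarith
    rcases Nat.eq_zero_or_pos i' with rfl | hi1
    · have : 1 ≤ j' := by omega
      nlinarith
    nlinarith
  rw [Finset.sum_range_succ', Finset.sum_range_succ', Finset.sum_range_succ']
  have hsum : ∑ e ∈ Finset.range d, ((i + 1 - (e + 1)) * (j + 1 - (e + 1)) +
      (d - i + 1 - (e + 1)) * (d - j + 1 - (e + 1)) + (d - e)) ≤
        ∑ e ∈ Finset.range d, (d + 1 - (e + 1)) * (d + 1 - (e + 1)) :=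
    Finset.sum_le_sum fun e he => hterm e (Finset.mem_range.1 he)
  rw [Finset.sum_add_distrib, Finset.sum_add_distrib] at hsum
  have h2 := sum_range_sub d
  have h3 : (n - 5) * (n - 4) / 2 * 2 ≤ (n - 5) * (n - 4) := Nat.div_mul_le_self _ _
  obtain ⟨r, rfl⟩ := Nat.exists_eq_add_of_le hn
  rw [show 5 + r - 5 = r by omega, show 5 + r - 4 = r + 1 by omega] at *
  simp only [Nat.sub_zero]
  subst d
  nlinarith

end Bidegree

section NormalForm

/-- The coordinate change with linear part `ψ` and shift `ℓ`. -/
def shiftedSubst {σ κ : Type*} (ψ : σ → Fin 5 → ℂ) (ℓ : σ → MvPolynomial κ ℂ) :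
    MvPolynomial σ ℂ →ₐ[ℂ] MvPolynomial (Fin 5) (MvPolynomial κ ℂ) :=
  aeval fun i => ∑ k, C (C (ψ i k)) * X k + C (ℓ i)

/-- The linear substitution with matrix `ψ`. -/
def linearSubst {σ : Type*} (ψ : σ → Fin 5 → ℂ) :
    MvPolynomial σ ℂ →ₐ[ℂ] MvPolynomial (Fin 5) ℂ :=
  aeval fun i => ∑ k, C (ψ i k) * X k

theorem isLinearSubst_linearSubst {σ : Type*} (ψ : σ → Fin 5 → ℂ) :
    IsLinearSubst (linearSubst ψ) := by
  intro i
  rw [linearSubst, aeval_X]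
  exact isHomogeneous_sum_C_mul_X _

theorem exists_isotropic (a b : ℂ) : ∃ s t s' t' : ℂ, a * s ^ 2 + b * t ^ 2 = 0 ∧
    s * t' - s' * t = 1 := by
  by_cases h : a = 0
  · exact ⟨1, 0, 0, 1, by simp [h], by simp⟩
  · obtain ⟨s, hs⟩ := IsAlgClosed.exists_pow_nat_eq (-b / a) (n := 2) two_pos
    refine ⟨s, 1, -1, 0, ?_, by simp⟩
    rw [hs]
    field_simp
    ring

theorem exists_half_inv {a : ℂ} (ha : a ≠ 0) : ∃ x y : ℂ, 2 * (x * y) = 1 ∧ a * x ^ 2 * 4 = 1 := by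
  obtain ⟨y, hy⟩ := IsAlgClosed.exists_pow_nat_eq a (n := 2) two_pos
  have hy0 : y ≠ 0 := by
    rintro rfl
    exact ha (by rw [← hy]; simp)
  refine ⟨1 / (2 * y), y, by field_simp, ?_⟩
  rw [← hy]
  field_simp
  norm_num

theorem exists_splitting_sum (k : ℕ) (w : Fin 6 ⊕ Fin k → ℂ)
    (h0 : w (.inl 0) ≠ 0) (h1 : w (.inl 1) ≠ 0) (h2 : w (.inl 2) ≠ 0) (h3 : w (.inl 3) ≠ 0) :
    ∃ (ψ : Fin 6 ⊕ Fin k → Fin 5 → ℂ) (ℓ : Fin 6 ⊕ Fin k → MvPolynomial (Fin (k + 1)) ℂ)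
      (T : MvPolynomial (Fin 5) (MvPolynomial (Fin (k + 1)) ℂ) →+* MvPolynomial (Fin 6 ⊕ Fin k) ℂ),
      (∀ f, T (shiftedSubst ψ ℓ f) = f) ∧
      linearSubst ψ (∑ i, C (w i) * X i ^ 2) = segreQuadric ℂ ∧
      ∃ S : MvPolynomial (Fin 5) ℂ →ₐ[ℂ] MvPolynomial (Fin 6 ⊕ Fin k) ℂ,
        IsLinearSubst S ∧ ∀ g, linearSubst ψ (S g) = g := by
  obtain ⟨a0, b0, e0, f0⟩ := exists_half_inv h0
  obtain ⟨a1, b1, e1, f1⟩ := exists_half_inv (neg_ne_zero.2 h1)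
  obtain ⟨a2, b2, e2, f2⟩ := exists_half_inv h2
  obtain ⟨a3, b3, e3, f3⟩ := exists_half_inv (neg_ne_zero.2 h3)
  obtain ⟨s, t, s', t', hst, hD⟩ := exists_isotropic (w (.inl 4)) (w (.inl 5))
  set ψ : Fin 6 ⊕ Fin k → Fin 5 → ℂ := Sum.elim
    ![![a0, a0, 0, 0, 0], ![a1, -a1, 0, 0, 0], ![0, 0, a2, -a2, 0], ![0, 0, a3, a3, 0],
      ![0, 0, 0, 0, s], ![0, 0, 0, 0, t]] 0 with hψ
  set ℓ : Fin 6 ⊕ Fin k → MvPolynomial (Fin (k + 1)) ℂ := Sum.elim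
    ![0, 0, 0, 0, C s' * X 0, C t' * X 0] (fun j => X j.succ) with hℓ
  let x : Fin 6 → MvPolynomial (Fin 6 ⊕ Fin k) ℂ := fun i => X (.inl i)
  let T : MvPolynomial (Fin 5) (MvPolynomial (Fin (k + 1)) ℂ) →+* MvPolynomial (Fin 6 ⊕ Fin k) ℂ :=
    eval₂Hom (aeval (R := ℂ) (Fin.cons (C s * x 5 - C t * x 4) fun j => X (.inr j)) :
        MvPolynomial (Fin (k + 1)) ℂ →ₐ[ℂ] MvPolynomial (Fin 6 ⊕ Fin k) ℂ).toRingHom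
      ![C b0 * x 0 + C b1 * x 1, C b0 * x 0 - C b1 * x 1, C b2 * x 2 + C b3 * x 3,
        C b3 * x 3 - C b2 * x 2, C t' * x 4 - C s' * x 5]
  have hTX : ∀ i, T (X i) = ![C b0 * x 0 + C b1 * x 1, C b0 * x 0 - C b1 * x 1,
      C b2 * x 2 + C b3 * x 3, C b3 * x 3 - C b2 * x 2, C t' * x 4 - C s' * x 5] i :=
    fun i => eval₂Hom_X' _ _ _
  have hTC : ∀ p, T (C p) = aeval (R := ℂ) (Fin.cons (C s * x 5 - C t * x 4)
      fun j => X (.inr j)) p := fun p => eval₂Hom_C _ _ _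
  have hTCC : ∀ c, T (C (C c)) = C c := fun c => by rw [hTC, aeval_C, algebraMap_eq]
  have hTZ0 : T (C (X 0)) = C s * x 5 - C t * x 4 := by rw [hTC, aeval_X, Fin.cons_zero]
  have hTZ : ∀ j : Fin k, T (C (X j.succ)) = X (.inr j) := fun j => by
    rw [hTC, aeval_X, Fin.cons_succ]
  have toC : ∀ {a b : ℂ}, a = b → (C a : MvPolynomial (Fin 6 ⊕ Fin k) ℂ) = C b := fun h => by rw [h]
  have toC' : ∀ {a b : ℂ}, a = b → (C a : MvPolynomial (Fin 5) ℂ) = C b := fun h => by rw [h]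
  refine ⟨ψ, ℓ, T, ?_, ?_, ?_⟩
  · intro f
    have h : (T.comp (shiftedSubst ψ ℓ).toRingHom) = RingHom.id _ := by
      apply MvPolynomial.ringHom_ext
      · intro c
        change T (shiftedSubst ψ ℓ (C c)) = C c
        rw [shiftedSubst, aeval_C]
        exact hTCC c
      · intro i
        change T (shiftedSubst ψ ℓ (X i)) = X i
        rw [shiftedSubst, aeval_X, map_add, map_sum]
        simp_rw [map_mul, hTX, hTCC]
        rw [Fin.sum_univ_five]
        have g0 := toC e0
        have g1 := toC e1
        have g2 := toC e2
        have g3 := toC e3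
        have g4 := toC hD
        simp only [map_mul, map_sub, map_one, map_ofNat] at g0 g1 g2 g3 g4
        rcases i with i | j
        · fin_cases i <;> simp [hψ, hℓ, x, hTCC, hTZ0]
          · linear_combination X (.inl 0) * g0
          · linear_combination X (.inl 1) * g1
          · linear_combination X (.inl 2) * g2
          · linear_combination X (.inl 3) * g3
          · linear_combination X (.inl 4) * g4
          · linear_combination X (.inl 5) * g4
        · simp [hψ, hℓ, hTZ]
    exact DFunLike.congr_fun h f
  · rw [map_sum, Fintype.sum_sum_type, Fin.sum_univ_six]
    simp only [linearSubst, map_mul, map_pow, aeval_X, aeval_C, algebraMap_eq, Fin.sum_univ_five]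
    simp [hψ]
    have g0 := toC' f0
    have g1 := toC' f1
    have g2 := toC' f2
    have g3 := toC' f3
    have g4 := toC' hst
    have g5 := toC' (show (1 / 4 : ℂ) * 4 = 1 by norm_num)
    simp only [map_mul, map_add, map_neg, map_zero, map_pow, map_one, map_ofNat] at g0 g1 g2 g3 g4 g5
    rw [segreQuadric]
    linear_combination (C (1 / 4) * (X 0 + X 1) ^ 2) * g0 - (C (1 / 4) * (X 0 - X 1) ^ 2) * g1 +
      (C (1 / 4) * (X 2 - X 3) ^ 2) * g2 - (C (1 / 4) * (X 2 + X 3) ^ 2) * g3 + X 4 ^ 2 * g4 +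
      (X 0 * X 1 - X 2 * X 3 - C (w (.inl 0)) * C a0 ^ 2 * (X 0 + X 1) ^ 2 -
        C (w (.inl 1)) * C a1 ^ 2 * (X 0 - X 1) ^ 2 - C (w (.inl 2)) * C a2 ^ 2 * (X 2 - X 3) ^ 2 -
        C (w (.inl 3)) * C a3 ^ 2 * (X 2 + X 3) ^ 2) * g5
  · refine ⟨aeval ![C b0 * x 0 + C b1 * x 1, C b0 * x 0 - C b1 * x 1,
      C b2 * x 2 + C b3 * x 3, C b3 * x 3 - C b2 * x 2, C t' * x 4 - C s' * x 5], ?_, ?_⟩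
    · intro i
      have hx : ∀ c i, (C c * x i).IsHomogeneous 1 := fun c i => isHomogeneous_C_mul_X _ _
      rw [aeval_X]
      fin_cases i
      · exact (hx b0 0).add (hx b1 1)
      · exact (hx b0 0).sub (hx b1 1)
      · exact (hx b2 2).add (hx b3 3)
      · exact (hx b3 3).sub (hx b2 2)
      · exact (hx t' 4).sub (hx s' 5)
    · intro g
      have h : (linearSubst ψ).comp (aeval ![C b0 * x 0 + C b1 * x 1, C b0 * x 0 - C b1 * x 1,
          C b2 * x 2 + C b3 * x 3, C b3 * x 3 - C b2 * x 2, C t' * x 4 - C s' * x 5]) =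
            AlgHom.id ℂ _ := by
        apply MvPolynomial.algHom_ext
        intro i
        have g0 := toC' e0
        have g1 := toC' e1
        have g2 := toC' e2
        have g3 := toC' e3
        have g4 := toC' hD
        have g5 := toC' (show (1 / 2 : ℂ) * 2 = 1 by norm_num)
        simp only [map_mul, map_sub, map_one, map_ofNat] at g0 g1 g2 g3 g4 g5
        rw [AlgHom.comp_apply, aeval_X, AlgHom.id_apply]
        fin_cases i <;> simp [linearSubst, x, hψ, Fin.sum_univ_five, algebraMap_eq]
        · linear_combination C (1 / 2) * ((X 0 + X 1) * g0 + (X 0 - X 1) * g1) +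
            (X 0 - C b0 * C a0 * (X 0 + X 1) - C b1 * C a1 * (X 0 - X 1)) * g5
        · linear_combination C (1 / 2) * ((X 0 + X 1) * g0 - (X 0 - X 1) * g1) +
            (X 1 - C b0 * C a0 * (X 0 + X 1) + C b1 * C a1 * (X 0 - X 1)) * g5
        · linear_combination C (1 / 2) * ((X 2 - X 3) * g2 + (X 2 + X 3) * g3) +
            (X 2 - C b2 * C a2 * (X 2 - X 3) - C b3 * C a3 * (X 2 + X 3)) * g5
        · linear_combination C (1 / 2) * ((X 2 + X 3) * g3 - (X 2 - X 3) * g2) +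
            (X 3 + C b2 * C a2 * (X 2 - X 3) - C b3 * C a3 * (X 2 + X 3)) * g5
        · linear_combination X 4 * g4
      exact DFunLike.congr_fun h g
end NormalForm

section TopForm

theorem exists_equiv_of_four_le_card {m : ℕ} (hm : 6 ≤ m) (s : Finset (Fin m)) (hs : 4 ≤ s.card) :
    ∃ (k : ℕ) (e : Fin m ≃ Fin 6 ⊕ Fin k), ∀ i : Fin 6, i.val < 4 → e.symm (.inl i) ∈ s := by
  obtain ⟨k, rfl⟩ := Nat.exists_eq_add_of_le hm
  obtain ⟨t, hts, ht⟩ := Finset.exists_subset_card_eq hs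
  have hcard : Fintype.card {i // i ∈ t} = Fintype.card {i : Fin (6 + k) // i.val < 4} := by
    rw [Fintype.card_coe, ht, Fintype.card_subtype, Fin.card_filter_val_lt]
    omega
  let e₀ := Fintype.equivOfCardEq hcard
  let e₁ := Equiv.extendSubtype e₀
  refine ⟨k, e₁.trans finSumFinEquiv.symm, fun i hi => hts ?_⟩
  by_contra h
  have h1 := Equiv.extendSubtype_not_mem e₀ _ h
  apply h1
  change ((e₁ ((e₁.trans finSumFinEquiv.symm).symm (.inl i)))).val < 4
  simp
  exact hi

theorem exists_splitting {m : ℕ} (hm : 6 ≤ m) (w : Fin m → ℂ)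
    (hw : 4 ≤ (Finset.univ.filter fun i => w i ≠ 0).card) :
    ∃ (κ : Type) (ψ : Fin m → Fin 5 → ℂ) (ℓ : Fin m → MvPolynomial κ ℂ)
      (T : MvPolynomial (Fin 5) (MvPolynomial κ ℂ) →+* MvPolynomial (Fin m) ℂ),
      (∀ f, T (shiftedSubst ψ ℓ f) = f) ∧
      linearSubst ψ (∑ i, C (w i) * X i ^ 2) = segreQuadric ℂ ∧
      ∃ S : MvPolynomial (Fin 5) ℂ →ₐ[ℂ] MvPolynomial (Fin m) ℂ,
        IsLinearSubst S ∧ ∀ g, linearSubst ψ (S g) = g := by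
  obtain ⟨k, e, he⟩ := exists_equiv_of_four_le_card hm _ hw
  have he' : ∀ i : Fin 6, i.val < 4 → w (e.symm (.inl i)) ≠ 0 := fun i hi =>
    (Finset.mem_filter.1 (he i hi)).2
  obtain ⟨ψ, ℓ, T, h1, h2, S, h3, h4⟩ := exists_splitting_sum k (w ∘ e.symm) (he' 0 (by decide))
    (he' 1 (by decide)) (he' 2 (by decide)) (he' 3 (by decide))
  refine ⟨Fin (k + 1), ψ ∘ e, ℓ ∘ e, (rename e.symm : _ →ₐ[ℂ] _).toRingHom.comp T, ?_, ?_,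
    (rename e.symm).comp S, fun i => (h3 i).rename_isHomogeneous, fun g => ?_⟩
  · intro f
    have h3 : shiftedSubst (ψ ∘ e) (ℓ ∘ e) f = shiftedSubst ψ ℓ (rename e f) := by
      rw [shiftedSubst, shiftedSubst, aeval_rename]
      rfl
    change rename e.symm (T _) = f
    rw [h3, h1, rename_rename]
    simp
  · rw [← h2, map_sum, map_sum, ← e.symm.sum_comp]
    refine Finset.sum_congr rfl fun i _ => ?_
    simp [linearSubst]
  · have h5 : linearSubst (ψ ∘ e) (rename e.symm (S g)) = linearSubst ψ (S g) := by
      rw [linearSubst, linearSubst, aeval_rename]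
      simp [Function.comp_def]
    exact h5.trans (h4 g)

variable {τ A : Type*} [CommRing A]

/-- `p` is homogeneous of degree `d` and `a - p` has smaller degree. -/
def IsTopForm (a p : MvPolynomial τ A) (d : ℕ) : Prop :=
  p.IsHomogeneous d ∧ ShiftedDegreeLT (a - p) 0 d

namespace IsTopForm

variable {a b p q : MvPolynomial τ A} {d e : ℕ}

theorem shiftedDegreeLT (h : IsTopForm a p d) : ShiftedDegreeLT a 0 (d + 1) := by
  have h1 : ShiftedDegreeLT (a - p) 0 (d + 1) := fun m hm => (h.2 m hm).trans (Nat.lt_succ_self d)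
  have h2 := h1.add (ShiftedDegreeLT.of_isHomogeneous h.1 (Nat.lt_succ_self d) :
    ShiftedDegreeLT p 0 (d + 1))
  rwa [sub_add_cancel] at h2

theorem homogeneousComponent_eq (h : IsTopForm a p d) : homogeneousComponent d a = p := by
  have h1 := h.2.homogeneousComponent_eq_zero le_rfl
  rw [map_sub, sub_eq_zero, homogeneousComponent_of_mem h.1, if_pos rfl] at h1
  exact h1

theorem mul (ha : IsTopForm a p d) (hb : IsTopForm b q e) : IsTopForm (a * b) (p * q) (d + e) := by
  refine ⟨ha.1.mul hb.1, ?_⟩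
  rw [show a * b - p * q = b * (a - p) + p * (b - q) by ring]
  refine ShiftedDegreeLT.add ?_ ?_
  · rw [add_comm]
    exact hb.shiftedDegreeLT.mul ha.2
  · exact ShiftedDegreeLT.mul (ShiftedDegreeLT.of_isHomogeneous ha.1 (Nat.lt_succ_self d)) hb.2

theorem C (c : A) : IsTopForm (MvPolynomial.C c : MvPolynomial τ A) (MvPolynomial.C c) 0 :=
  ⟨isHomogeneous_C _ _, by rw [sub_self]; exact .zero⟩

theorem pow (ha : IsTopForm a p d) (n : ℕ) : IsTopForm (a ^ n) (p ^ n) (d * n) := by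
  induction n with
  | zero => simpa using IsTopForm.C (1 : A)
  | succ n ih => exact ih.mul ha

theorem sum {ι : Type*} (s : Finset ι) {a p : ι → MvPolynomial τ A}
    (h : ∀ i ∈ s, IsTopForm (a i) (p i) d) : IsTopForm (∑ i ∈ s, a i) (∑ i ∈ s, p i) d := by
  refine ⟨IsHomogeneous.sum _ _ _ fun i hi => (h i hi).1, ?_⟩
  rw [← Finset.sum_sub_distrib]
  refine Finset.sum_induction _ (fun x => ShiftedDegreeLT x 0 d) (fun _ _ => .add) .zero
    fun i hi => (h i hi).2

theorem of_lt (ha : IsTopForm a p e) (he : e < d) : IsTopForm a 0 d := by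
  refine ⟨isHomogeneous_zero _ _ _, ?_⟩
  rw [sub_zero]
  exact fun m hm => (ha.shiftedDegreeLT m hm).trans_le he

end IsTopForm

theorem isTopForm_shiftedSubst_monomial {σ κ : Type*} (ψ : σ → Fin 5 → ℂ)
    (ℓ : σ → MvPolynomial κ ℂ) (m : σ →₀ ℕ) (c : ℂ) :
    IsTopForm (shiftedSubst ψ ℓ (monomial m c))
      (MvPolynomial.map C (linearSubst ψ (monomial m c))) m.degree := by
  have key : IsTopForm (shiftedSubst ψ ℓ (monomial m 1))
      (MvPolynomial.map C (linearSubst ψ (monomial m 1))) m.degree := by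
    induction m using Finsupp.induction_linear with
    | zero =>
      rw [map_zero, show monomial (0 : σ →₀ ℕ) (1 : ℂ) = 1 from rfl, map_one, map_one, map_one]
      simpa using IsTopForm.C (1 : MvPolynomial κ ℂ)
    | add m m' h h' =>
      rw [show monomial (m + m') (1 : ℂ) = monomial m 1 * monomial m' 1 by
        rw [monomial_mul, one_mul], map_mul, map_mul, map_mul, map_add]
      exact h.mul h'
    | single i n =>
      rw [← X_pow_eq_monomial, map_pow, map_pow, map_pow, Finsupp.degree_single]
      conv => arg 3; rw [← one_mul n]
      refine IsTopForm.pow ?_ n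
      rw [shiftedSubst, linearSubst, aeval_X, aeval_X]
      refine ⟨(isHomogeneous_sum_C_mul_X (ψ i)).map _, ?_⟩
      simp only [map_sum, map_mul, map_C, map_X, add_sub_cancel_left]
      exact ShiftedDegreeLT.of_isHomogeneous (isHomogeneous_C _ _) zero_lt_one
  have h := (IsTopForm.C (C c : MvPolynomial κ ℂ)).mul key
  rw [zero_add] at h
  rw [← mul_one c, ← C_mul_monomial, map_mul, map_mul, map_mul]
  simpa [shiftedSubst, linearSubst, algebraMap_eq, MvPolynomial.algebraMap_apply] using h

theorem isTopForm_shiftedSubst {σ κ : Type*} (ψ : σ → Fin 5 → ℂ)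
    (ℓ : σ → MvPolynomial κ ℂ) {f : MvPolynomial σ ℂ} {d : ℕ} (hf : f.totalDegree ≤ d) :
    IsTopForm (shiftedSubst ψ ℓ f)
      (MvPolynomial.map C (linearSubst ψ (homogeneousComponent d f))) d := by
  have h : ∀ m ∈ f.support, IsTopForm (shiftedSubst ψ ℓ (monomial m (coeff m f)))
      (MvPolynomial.map C (linearSubst ψ (homogeneousComponent d (monomial m (coeff m f))))) d := by
    intro m hm
    have hmd : m.degree ≤ d := (le_totalDegree hm).trans hf
    have h1 := isTopForm_shiftedSubst_monomial ψ ℓ m (coeff m f)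
    rw [homogeneousComponent_of_mem (isHomogeneous_monomial _ rfl)]
    split_ifs with h2
    · rw [h2]
      exact h1
    · rw [map_zero, map_zero]
      exact h1.of_lt (lt_of_le_of_ne hmd (Ne.symm h2))
  have := IsTopForm.sum _ h
  rwa [← map_sum, ← map_sum, ← map_sum, ← map_sum, ← f.as_sum] at this

theorem segre_map {κ : Type*} (p : MvPolynomial (Fin 5) ℂ) :
    segre (MvPolynomial κ ℂ) (MvPolynomial.map C p) = MvPolynomial.map C (segre ℂ p) := by
  induction p using MvPolynomial.induction_on' with
  | add p q hp hq => simp only [map_add, hp, hq]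
  | monomial m a => rw [map_monomial, segre_monomial, segre_monomial, map_monomial]

theorem map_segreQuadric {κ : Type*} :
    MvPolynomial.map C (segreQuadric ℂ) = segreQuadric (MvPolynomial κ ℂ) := by
  simp [segreQuadric]

theorem Prime.map_C {σ κ : Type*} {p : MvPolynomial σ ℂ} (hp : Prime p) :
    Prime (MvPolynomial.map (C : ℂ →+* MvPolynomial κ ℂ) p) := by
  rw [← commAlgEquiv_C, MulEquiv.prime_iff (commAlgEquiv ℂ κ σ)]
  exact (MvPolynomial.prime_C_iff κ).2 hp

theorem Ideal.IsPrime.of_leftInverse {R S : Type*} [CommRing R] [CommRing S] {f : R →+* S}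
    {g : S →+* R} (h : ∀ x, g (f x) = x) {a b : R} {a' b' : S} (ha : f a = a')
    (hb : f b = b') (hp : (Ideal.span {a', b'}).IsPrime) : (Ideal.span {a, b}).IsPrime := by
  subst ha hb
  have : Ideal.span {a, b} = (Ideal.span {f a, f b}).comap f := by
    ext z
    rw [Ideal.mem_comap, Ideal.mem_span_pair, Ideal.mem_span_pair]
    constructor
    · rintro ⟨x, y, rfl⟩
      exact ⟨f x, f y, by simp⟩
    · rintro ⟨x, y, hxy⟩
      have := congrArg g hxy
      simp only [map_add, map_mul, h] at this
      exact ⟨g x, g y, this⟩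
  rw [this]
  exact hp.comap f

theorem IsTopForm.isPrime_span [IsDomain A] {f g t : MvPolynomial (Fin 5) A} {d : ℕ}
    (hf : IsTopForm f (segreQuadric A) 2) (hg : IsTopForm g t d) (ht : Prime (segre A t)) :
    (Ideal.span {f, g}).IsPrime := by
  apply isPrime_span_pair_of_leadingForms hf.shiftedDegreeLT hg.shiftedDegreeLT
  · rw [hf.homogeneousComponent_eq]
    exact prime_segreQuadric
  · rw [hf.homogeneousComponent_eq, hg.homogeneousComponent_eq, ← segre_eq_zero_iff]
    exact ht.ne_zero
  · rw [hf.homogeneousComponent_eq, hg.homogeneousComponent_eq]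
    exact isPrime_span_segreQuadric ht

theorem isPrime_of_comp {R S : Type*} [CommRing R] [CommRing S] [Algebra ℂ R] [Algebra ℂ S]
    {τ τ' : R →ₐ[ℂ] R} {φ : R →ₐ[ℂ] S} {T : S →+* R} (h₁ : ∀ f, τ' (τ f) = f) (h₂ : ∀ f, T (φ f) = f)
    {a b : R} (hp : (Ideal.span {φ (τ a), φ (τ b)}).IsPrime) : (Ideal.span {a, b}).IsPrime :=
  Ideal.IsPrime.of_leftInverse (f := φ.toRingHom.comp τ.toRingHom) (g := τ'.toRingHom.comp T)
    (fun x => (congrArg τ' (h₂ (τ x))).trans (h₁ x)) rfl rfl hp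

theorem four_le_card_weights {m : ℕ} {Q : MvPolynomial (Fin m) ℂ} (hr : ¬ RankLE Q 3)
    {τ τ' : MvPolynomial (Fin m) ℂ →ₐ[ℂ] MvPolynomial (Fin m) ℂ} (hτ' : IsLinearSubst τ')
    (h2 : ∀ f, τ' (τ f) = f) {w : Fin m → ℂ} (hw : τ Q = ∑ i, C (w i) * X i ^ 2) :
    4 ≤ (Finset.univ.filter fun i => w i ≠ 0).card := by
  by_contra hlt
  apply hr
  have h3 := (rankLE_sum_smul_sq (Finset.univ.filter fun i => w i ≠ 0) (fun i => X i)
    (fun i => isHomogeneous_X _ i) w).mono (by omega : _ ≤ 3)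
  have h4 := h3.map hτ'
  have h5 : ∑ i with w i ≠ 0, C (w i) * X i ^ 2 =
      ∑ i, (C (w i) * X i ^ 2 : MvPolynomial (Fin m) ℂ) := by
    refine Finset.sum_filter_of_ne fun i _ hi h0 => hi ?_
    rw [h0, map_zero, zero_mul]
  rw [h5, ← hw, h2] at h4
  exact h4

theorem exists_linearSubst_isPrime {m d : ℕ} (hm : 6 ≤ m) {Q : MvPolynomial (Fin m) ℂ}
    (hQ : Q.IsHomogeneous 2) (hr : ¬ RankLE Q 3) {G : MvPolynomial (Fin m) ℂ}
    (hG : G.totalDegree ≤ d) :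
    ∃ Ψ : MvPolynomial (Fin m) ℂ →ₐ[ℂ] MvPolynomial (Fin 5) ℂ, IsLinearSubst Ψ ∧
      (∃ S : MvPolynomial (Fin 5) ℂ →ₐ[ℂ] MvPolynomial (Fin m) ℂ,
        IsLinearSubst S ∧ ∀ g, Ψ (S g) = g) ∧
      (Prime (segre ℂ (Ψ (homogeneousComponent d G))) → (Ideal.span {Q, G}).IsPrime) := by
  obtain ⟨τ, τ', w, hτ, hτ', h1, h2, hw⟩ := exists_diagonalisation hQ
  have hcard := four_le_card_weights hr hτ' h2 hw
  obtain ⟨κ, ψ, ℓ, T, hT, hN, S, hS, hS'⟩ := exists_splitting hm w hcard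
  refine ⟨(linearSubst ψ).comp τ, (isLinearSubst_linearSubst ψ).comp hτ,
    ⟨τ'.comp S, hτ'.comp hS, fun g => ?_⟩, fun hp => ?_⟩
  · rw [AlgHom.comp_apply, AlgHom.comp_apply, h1, hS']
  have t1 := isTopForm_shiftedSubst ψ ℓ ((hτ.totalDegree_le Q).trans hQ.totalDegree_le)
  have t2 := isTopForm_shiftedSubst ψ ℓ ((hτ.totalDegree_le G).trans hG)
  rw [homogeneousComponent_of_mem (hτ.isHomogeneous hQ), if_pos rfl, hw, hN,
    map_segreQuadric] at t1
  rw [hτ.homogeneousComponent] at t2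
  have hp' := Prime.map_C (κ := κ) hp
  rw [← segre_map] at hp'
  have h3 := t1.isPrime_span t2 hp'
  rw [← hw] at h3
  exact isPrime_of_comp h2 hT h3

end TopForm

theorem IsHyperplaneRestriction.ne_zero_of_notMem_span {k : ℕ} {l p : MvPolynomial (Fin (k + 1)) ℂ}
    {ι : MvPolynomial (Fin (k + 1)) ℂ →ₐ[ℂ] MvPolynomial (Fin k) ℂ}
    {σ : MvPolynomial (Fin k) ℂ →ₐ[ℂ] MvPolynomial (Fin (k + 1)) ℂ}
    (h : IsHyperplaneRestriction l ι σ) (hl : l.IsHomogeneous 1) (hp : p.IsHomogeneous 1)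
    (hpl : p ∉ Submodule.span ℂ {l}) : ι p ≠ 0 := by
  intro h0
  obtain ⟨c, rfl⟩ := Ideal.mem_span_singleton'.1 (h.ker_eq ▸ (RingHom.mem_ker.2 h0))
  apply hpl
  have h1 : homogeneousComponent 1 (l * c) = l * homogeneousComponent 0 c :=
    homogeneousComponent_mul_of_left hl c 0
  rw [mul_comm l c, homogeneousComponent_of_mem hp, if_pos rfl,
    homogeneousComponent_zero] at h1
  rw [h1, mul_comm, ← MvPolynomial.smul_eq_C_mul]
  exact Submodule.smul_mem _ _ (Submodule.mem_span_singleton_self l)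

theorem exists_linearSubst_of_not_condR13 {m d : ℕ} (hm : 6 ≤ m)
    {q₁ : MvPolynomial (Fin (m + 2)) ℂ}
    {ι : MvPolynomial (Fin (m + 2)) ℂ →ₐ[ℂ] MvPolynomial (Fin (m + 1)) ℂ}
    {σ : MvPolynomial (Fin (m + 1)) ℂ →ₐ[ℂ] MvPolynomial (Fin (m + 2)) ℂ}
    (h : IsHyperplaneRestriction q₁ ι σ) (hq : q₁.IsHomogeneous 1)
    {f : MvPolynomial (Fin (m + 2)) ℂ} (hf : f.totalDegree ≤ d)
    (hr : ¬ RankLE (homogeneousComponent 2 (ι f)) 5) (hbad : ¬ CondR13 q₁ f) :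
    ∃ Ψ : MvPolynomial (Fin (m + 1)) ℂ →ₐ[ℂ] MvPolynomial (Fin 5) ℂ, IsLinearSubst Ψ ∧
      (∃ S : MvPolynomial (Fin 5) ℂ →ₐ[ℂ] MvPolynomial (Fin (m + 1)) ℂ,
        IsLinearSubst S ∧ ∀ g, Ψ (S g) = g) ∧
      ¬ Prime (segre ℂ (Ψ (homogeneousComponent d (ι f)))) := by
  unfold CondR13 at hbad
  push Not at hbad
  obtain ⟨p, hp, hpq, hbad⟩ := hbad
  have hp0 := h.ne_zero_of_notMem_span hq hp hpq
  have hp1 : (ι p).IsHomogeneous 1 := h.linear.isHomogeneous hp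
  obtain ⟨ι', σ', h'⟩ := exists_isHyperplaneRestriction hp1 hp0
  have hQ := homogeneousComponent_isHomogeneous 2 (ι f)
  have hdeg : (ι' (ι f)).totalDegree ≤ d :=
    (h'.linear.totalDegree_le _).trans ((h.linear.totalDegree_le _).trans hf)
  obtain ⟨Ψ, hΨ, ⟨S, hS, hS'⟩, hprime⟩ := exists_linearSubst_isPrime hm
    (h'.linear.isHomogeneous hQ) (fun h3 => hr (RankLE.of_restriction h' hp1 hQ h3)) hdeg
  refine ⟨Ψ.comp ι', hΨ.comp h'.linear, ⟨σ'.comp S, h'.linear_section.comp hS, fun g => ?_⟩,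
    fun hpr => hbad ?_⟩
  · rw [AlgHom.comp_apply, AlgHom.comp_apply, h'.right_inv, hS']
  rw [AlgHom.comp_apply, ← h'.linear.homogeneousComponent] at hpr
  have hJ := hprime hpr
  convert hJ.comap (ι'.comp ι)
  have hι : ∀ g, g ∈ Ideal.span {q₁} ↔ ι g = 0 := fun g => by
    rw [← h.ker_eq]; exact RingHom.mem_ker
  have hι' : ∀ g, g ∈ Ideal.span {ι p} ↔ ι' g = 0 := fun g => by
    rw [← h'.ker_eq]; exact RingHom.mem_ker
  have hp' : ι' (ι p) = 0 := (hι' _).1 (Ideal.mem_span_singleton_self _)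
  have hq' : ι q₁ = 0 := h.apply_self
  have hFQ : ι (homogeneousComponent 2 f) = homogeneousComponent 2 (ι f) :=
    (h.linear.homogeneousComponent 2 f).symm
  apply le_antisymm
  · rw [Ideal.span_le]
    rintro x (rfl | rfl | rfl | rfl)
    · simp [hp']
    · simp [hq']
    · simp only [SetLike.mem_coe, Ideal.mem_comap, AlgHom.comp_apply, hFQ]
      exact Ideal.subset_span (by simp)
    · simp only [SetLike.mem_coe, Ideal.mem_comap, AlgHom.comp_apply, map_add, hq', map_zero,
        zero_add]
      exact Ideal.subset_span (by simp)
  · intro g hg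
    rw [Ideal.mem_comap, AlgHom.comp_apply, Ideal.mem_span_pair] at hg
    obtain ⟨a, b, hab⟩ := hg
    obtain ⟨a, rfl⟩ : ∃ a', ι' (ι a') = a := ⟨σ (σ' a), by rw [h.right_inv, h'.right_inv]⟩
    obtain ⟨b, rfl⟩ : ∃ b', ι' (ι b') = b := ⟨σ (σ' b), by rw [h.right_inv, h'.right_inv]⟩
    rw [← hFQ] at hab
    have h1 : ι g - ι a * ι (homogeneousComponent 2 f) - ι b * ι f ∈ Ideal.span {ι p} := by
      rw [hι']
      simp only [map_sub, map_mul, ← hab]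
      ring
    obtain ⟨c, hc⟩ := Ideal.mem_span_singleton'.1 h1
    rw [← h.right_inv c] at hc
    have h2 : g - a * homogeneousComponent 2 f - b * (q₁ + f) - σ c * p ∈ Ideal.span {q₁} := by
      rw [hι]
      simp only [map_sub, map_mul, map_add, hq', hc]
      ring
    obtain ⟨e, he⟩ := Ideal.mem_span_singleton'.1 h2
    have h3 : g = σ c * p + e * q₁ + a * homogeneousComponent 2 f + b * (q₁ + f) := by
      rw [he]; ring
    rw [h3]
    refine Ideal.add_mem _ (Ideal.add_mem _ (Ideal.add_mem _ ?_ ?_) ?_) ?_ <;>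
      exact Ideal.mul_mem_left _ _ (Ideal.subset_span (by simp))

section ReducibleForms

/-- The composition of the linear substitution with coefficients `c` and the Segre map. -/
def segreSubst {n : ℕ} {R : Type*} [CommRing R] (c : Fin n → Fin 5 → R) :
    MvPolynomial (Fin n) R →ₐ[R] MvPolynomial (Fin 5) R :=
  aeval fun x => ∑ k, C (c x k) * segre R (X k)

theorem map_segreSubst_monomial {n : ℕ} {R R' : Type*} [CommRing R] [CommRing R'] (φ : R →+* R')
    (c : Fin n → Fin 5 → R) (m : Fin n →₀ ℕ) :
    map φ (segreSubst c (monomial m 1)) = segreSubst (fun x k => φ (c x k)) (monomial m 1) := by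
  have h : ∀ k, map φ (segre R (X k)) = segre R' (X k) := fun k => by
    fin_cases k <;> simp [segre]
  simp only [segreSubst, aeval_monomial, Finsupp.prod, map_one, one_mul, map_prod, map_pow,
    map_sum, map_mul, map_C, h]

theorem IsLinearSubst.segre_apply {n : ℕ} {Ψ : MvPolynomial (Fin n) ℂ →ₐ[ℂ] MvPolynomial (Fin 5) ℂ}
    (hΨ : IsLinearSubst Ψ) (f : MvPolynomial (Fin n) ℂ) :
    segre ℂ (Ψ f) = segreSubst (fun x k => coeff (Finsupp.single k 1) (Ψ (X x))) f := by
  suffices h : (segre ℂ).comp Ψ =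
      segreSubst (fun x k => coeff (Finsupp.single k 1) (Ψ (X x))) from DFunLike.congr_fun h f
  refine MvPolynomial.algHom_ext fun x => ?_
  rw [AlgHom.comp_apply, segreSubst, aeval_X]
  conv_lhs => rw [(hΨ x).eq_sum_of_one]
  simp [algebraMap_eq]

theorem exists_segreExp_eq {d : ℕ} {k : Fin 5 →₀ ℕ} (hk : k ∈ biMonos d d) :
    ∃ m : Fin 5 →₀ ℕ, m.degree = d ∧ segreExp m = k := by
  rw [mem_biMonos] at hk
  refine ⟨Finsupp.equivFunOnFinite.symm
      ![min (k 0) (k 2), k 3 - (k 0 - min (k 0) (k 2)), k 0 - min (k 0) (k 2),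
        k 2 - min (k 0) (k 2), k 4], ?_, Finsupp.ext fun i => ?_⟩
  · rw [Finsupp.degree_eq_sum, Fin.sum_univ_five]
    simp
    omega
  · fin_cases i <;> simp [segreExp] <;> omega

theorem LinearMap.apply_eq_sum_coeff {τ : Type*} (θ : MvPolynomial τ ℂ →ₗ[ℂ] ℂ)
    {s : Finset (τ →₀ ℕ)} {f : MvPolynomial τ ℂ} (hf : ∀ m ∉ s, coeff m f = 0) :
    θ f = ∑ j : s, θ (monomial j 1) * coeff j f := by
  conv_lhs => rw [← polyOf_coeff hf, polyOf, map_sum]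
  refine Finset.sum_congr rfl fun j _ => ?_
  rw [show monomial (j : τ →₀ ℕ) (coeff j f) = coeff (j : τ →₀ ℕ) f • monomial (j : τ →₀ ℕ) (1 : ℂ) by
    rw [smul_monomial, smul_eq_mul, mul_one], map_smul, smul_eq_mul, mul_comm]

variable {n : ℕ} {q₁ : MvPolynomial (Fin (n + 1)) ℂ}
  {ι : MvPolynomial (Fin (n + 1)) ℂ →ₐ[ℂ] MvPolynomial (Fin n) ℂ}
  {σ : MvPolynomial (Fin n) ℂ →ₐ[ℂ] MvPolynomial (Fin (n + 1)) ℂ}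

theorem hasCodimGE_segre_eq_mul (hn : 5 ≤ n) (h : IsHyperplaneRestriction q₁ ι σ) {i j : ℕ}
    (hij : (i, j) ∈ properBidegrees (n + 1)) :
    HasCodimGE {f : Psing (n + 1) |
      ∃ Ψ : MvPolynomial (Fin n) ℂ →ₐ[ℂ] MvPolynomial (Fin 5) ℂ, IsLinearSubst Ψ ∧
        (∃ S : MvPolynomial (Fin 5) ℂ →ₐ[ℂ] MvPolynomial (Fin n) ℂ,
          IsLinearSubst S ∧ ∀ g, Ψ (S g) = g) ∧
        ∃ a b, IsBihomogeneous a i j ∧ IsBihomogeneous b (n + 1 - i) (n + 1 - j) ∧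
          segre ℂ (Ψ (homogeneousComponent (n + 1) (ι f))) = a * b}
      ((n - 5) * (n - 4) / 2) := by
  classical
  refine hasCodimGE_of_linear_system (coeffMap ι) (coeffMap_surjective h)
    (P := (Fin n × Fin 5) ⊕ biMonos i j ⊕ biMonos (n + 1 - i) (n + 1 - j))
    (K := biMonos (n + 1) (n + 1))
    (fun k m => if (m : Fin n →₀ ℕ).degree = n + 1 then
      coeff k (segreSubst (fun x k => X (Sum.inl (x, k))) (monomial m 1)) else 0)
    (fun k => coeff k (polyOf (biMonos i j) (fun m => X (Sum.inr (Sum.inl m))) *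
      polyOf (biMonos (n + 1 - i) (n + 1 - j)) fun m => X (Sum.inr (Sum.inr m)))) ?_ ?_
  · rintro f ⟨Ψ, hΨ, ⟨S, hS, hS'⟩, a, b, ha, hb, hab⟩
    rw [isBihomogeneous_iff] at ha hb
    obtain ⟨w, hw⟩ : ∃ w : (Fin n × Fin 5) ⊕ biMonos i j ⊕ biMonos (n + 1 - i) (n + 1 - j) → ℂ,
      w = Sum.elim (fun p : Fin n × Fin 5 => coeff (Finsupp.single p.2 1) (Ψ (X p.1)))
        (Sum.elim (fun m : biMonos i j => coeff (m : Fin 5 →₀ ℕ) a)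
          fun m : biMonos (n + 1 - i) (n + 1 - j) => coeff (m : Fin 5 →₀ ℕ) b) := ⟨_, rfl⟩
    refine ⟨w, ?_⟩
    obtain ⟨θ, hθ⟩ : ∃ θ : (Fin 5 →₀ ℕ) → MvPolynomial (Fin n) ℂ →ₗ[ℂ] ℂ, ∀ k g,
        θ k g = coeff k (segre ℂ (Ψ (homogeneousComponent (n + 1) g))) :=
      ⟨fun k => (lcoeff ℂ k).comp ((segre ℂ).toLinearMap.comp (Ψ.toLinearMap.comp
        (homogeneousComponent (n + 1)))), fun k g => rfl⟩
    have hL : ∀ (k : Fin 5 →₀ ℕ) (m : Fin n →₀ ℕ),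
        eval w (if m.degree = n + 1 then
          coeff k (segreSubst (fun x k => X (Sum.inl (x, k))) (monomial m 1)) else 0) =
        θ k (monomial m 1) := by
      intro k m
      rw [hθ, homogeneousComponent_of_mem (isHomogeneous_monomial (1 : ℂ) rfl)]
      by_cases hm : m.degree = n + 1
      · rw [if_pos hm, if_pos hm.symm, hΨ.segre_apply, ← coeff_map, map_segreSubst_monomial]
        simp [hw]
      · rw [if_neg hm, if_neg fun h => hm h.symm]
        simp
    simp only [hL]
    constructor
    · rw [eq_top_iff, ← (Pi.basisFun ℂ (biMonos (n + 1) (n + 1))).span_eq, Submodule.span_le]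
      rintro _ ⟨k, rfl⟩
      obtain ⟨m, hm, hmk⟩ := exists_segreExp_eq k.2
      have hF : (S (monomial m 1)).IsHomogeneous (n + 1) :=
        hS.isHomogeneous (isHomogeneous_monomial _ hm)
      have key : Pi.basisFun ℂ (biMonos (n + 1) (n + 1)) k =
          ∑ j : monos (Fin n) 2 (n + 1), coeff (j : Fin n →₀ ℕ) (S (monomial m 1)) •
            fun k : biMonos (n + 1) (n + 1) => θ k (monomial j 1) := by
        funext k'
        rw [Finset.sum_apply]
        simp only [Pi.smul_apply, smul_eq_mul, mul_comm (coeff _ _)]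
        rw [← LinearMap.apply_eq_sum_coeff, hθ, homogeneousComponent_of_mem hF, if_pos rfl, hS',
          segre_monomial, hmk, coeff_monomial, Pi.basisFun_apply, Pi.single_apply]
        · simp only [Subtype.ext_iff, eq_comm]
        · intro m' hm'
          refine hF.coeff_eq_zero fun h' => hm' (mem_monos.2 ?_)
          omega
      rw [key]
      exact Submodule.sum_mem _ fun j _ => Submodule.smul_mem _ _ (Submodule.subset_span ⟨j, rfl⟩)
    · intro k
      simp only [coeffMap_apply]
      rw [← LinearMap.apply_eq_sum_coeff _ fun m hm => coeff_restriction_eq_zero h.linear f hm, hθ,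
        hab, ← coeff_map, map_mul, map_polyOf, map_polyOf]
      simp only [eval_X, hw, Sum.elim_inl, Sum.elim_inr]
      rw [polyOf_coeff ha, polyOf_coeff hb]
  · have := card_biMonos_add_le hn hij
    simp only [Fintype.card_sum, Fintype.card_prod, Fintype.card_fin, Fintype.card_coe]
    exact this

theorem hasCodimGE_not_prime_segre (hn : 5 ≤ n) (h : IsHyperplaneRestriction q₁ ι σ) :
    HasCodimGE {f : Psing (n + 1) |
      ∃ Ψ : MvPolynomial (Fin n) ℂ →ₐ[ℂ] MvPolynomial (Fin 5) ℂ, IsLinearSubst Ψ ∧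
        (∃ S : MvPolynomial (Fin 5) ℂ →ₐ[ℂ] MvPolynomial (Fin n) ℂ,
          IsLinearSubst S ∧ ∀ g, Ψ (S g) = g) ∧
        ¬ Prime (segre ℂ (Ψ (homogeneousComponent (n + 1) (ι f))))}
      ((n - 5) * (n - 4) / 2) := by
  refine HasCodimGE.mono (HasCodimGE.iUnion (le_finrank_Psing h hn)
    fun p : properBidegrees (n + 1) => hasCodimGE_segre_eq_mul hn h p.2) ?_
  rintro f ⟨Ψ, hΨ, hS, hp⟩
  obtain ⟨i, j, hij, a, b, ha, hb, hab⟩ := IsBihomogeneous.exists_factors (Nat.succ_ne_zero n)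
    (isBihomogeneous_segre (hΨ.isHomogeneous (homogeneousComponent_isHomogeneous _ _))) hp
  exact Set.mem_iUnion.2 ⟨⟨(i, j), hij⟩, Ψ, hΨ, hS, a, b, ha, hb, hab⟩

end ReducibleForms

theorem hasCodimGE_not_condR13 {n : ℕ} {q₁ : MvPolynomial (Fin (n + 1)) ℂ}
    {ι : MvPolynomial (Fin (n + 1)) ℂ →ₐ[ℂ] MvPolynomial (Fin n) ℂ}
    {σ : MvPolynomial (Fin n) ℂ →ₐ[ℂ] MvPolynomial (Fin (n + 1)) ℂ} (hn : 7 ≤ n)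
    (h : IsHyperplaneRestriction q₁ ι σ) (hq : q₁.IsHomogeneous 1) :
    HasCodimGE {f : Psing (n + 1) | ¬ CondR13 q₁ (f : MvPolynomial (Fin (n + 1)) ℂ)}
      ((n - 5) * (n - 4) / 2) := by
  refine HasCodimGE.mono ((hasCodimGE_rankLE h (by omega)).union (le_finrank_Psing h (by omega))
    (hasCodimGE_not_prime_segre (by omega) h)) ?_
  intro f hf
  by_cases hr : RankLE (homogeneousComponent 2 (ι (f : MvPolynomial (Fin (n + 1)) ℂ))) 5
  · exact Or.inl hr
  · right
    obtain ⟨m, rfl⟩ : ∃ m, n = m + 1 := ⟨n - 1, by omega⟩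
    exact exists_linearSubst_of_not_condR13 (by omega) h hq
      ((mem_restrictTotalDegree _ _ _).1 f.2.1) hr hf

theorem HasCodimGE.zdim_le {V : Type} [AddCommGroup V] [Module ℂ V] {S T : Set V} {c : ℕ}
    (hS : HasCodimGE S c)
    (hT : zdim (zclosure T) + (c : ℕ∞) = ((Module.finrank ℂ V : ℕ∞) : WithBot ℕ∞)) :
    zdim (zclosure S) ≤ zdim (zclosure T) := by
  rw [HasCodimGE, ← hT] at hS
  generalize zdim (zclosure S) = a at hS ⊢
  generalize zdim (zclosure T) = b at hS hT ⊢
  induction b with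
  | bot => simp at hT
  | coe b =>
    induction a with
    | bot => exact bot_le
    | coe a =>
      rw [← WithBot.coe_add, ← WithBot.coe_add, WithBot.coe_le_coe] at hS
      exact WithBot.coe_le_coe.2 ((ENat.add_le_add_iff_right (ENat.natCast_ne_top c)).1 hS)

theorem codim_nonregular_of_restriction {r : ℕ} (hr : 2 ≤ r)
    {q₁ : MvPolynomial (Fin (5 + r + 1)) ℂ}
    {ι : MvPolynomial (Fin (5 + r + 1)) ℂ →ₐ[ℂ] MvPolynomial (Fin (5 + r)) ℂ}
    {σ : MvPolynomial (Fin (5 + r)) ℂ →ₐ[ℂ] MvPolynomial (Fin (5 + r + 1)) ℂ}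
    (h : IsHyperplaneRestriction q₁ ι σ) (hq : q₁.IsHomogeneous 1) (hq0 : q₁ ≠ 0) :
    zdim (zclosure {f : Psing (5 + r + 1) | ¬ CondR12 q₁ (f : MvPolynomial (Fin (5 + r + 1)) ℂ)})
        + ((r * (r + 1) / 2 : ℕ) : ℕ∞)
      = ((Module.finrank ℂ (Psing (5 + r + 1)) : ℕ∞) : WithBot ℕ∞) ∧
    zdim (zclosure {f : Psing (5 + r + 1) | ¬ CondR11 q₁ (f : MvPolynomial (Fin (5 + r + 1)) ℂ)})
      ≤ zdim (zclosure
        {f : Psing (5 + r + 1) | ¬ CondR12 q₁ (f : MvPolynomial (Fin (5 + r + 1)) ℂ)}) ∧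
    zdim (zclosure {f : Psing (5 + r + 1) | ¬ CondR13 q₁ (f : MvPolynomial (Fin (5 + r + 1)) ℂ)})
      ≤ zdim (zclosure
        {f : Psing (5 + r + 1) | ¬ CondR12 q₁ (f : MvPolynomial (Fin (5 + r + 1)) ℂ)}) := by
  have hc : (5 + r - 5) * (5 + r - 4) / 2 = r * (r + 1) / 2 := by
    rw [show 5 + r - 5 = r by omega, show 5 + r - 4 = r + 1 by omega]
  have hle := le_finrank_Psing h (by omega)
  have h1 := hasCodimGE_not_condR11 (by omega) h
  have h3 := hasCodimGE_not_condR13 (by omega) h hq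
  have h2 : HasCodimGE {f : Psing (5 + r + 1) |
      ¬ CondR12 q₁ (f : MvPolynomial (Fin (5 + r + 1)) ℂ)} _ :=
    ((hasCodimGE_rankLE h (by omega)).union hle (hasCodimGE_cubic_relation h (by omega))).mono
      fun f hf => or_iff_not_imp_left.2 fun h' => exists_cubic_relation h hq hq0 hf h'
  rw [hc] at hle h1 h2 h3
  have hlow := finrank_le_zdim_rankLE h (by omega)
  have heq := le_antisymm h2 (hlow.trans
    (add_le_add_left (zdim_zclosure_mono fun f hf => not_condR12_of_rankLE h hf) _))
  exact ⟨heq, h1.zdim_le heq, h3.zdim_le heq⟩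

/-- Proposition 2.4: fix a non-zero linear form `q₁` on `ℂ^M`,
`M ≥ 8`, and consider the affine space `q₁ + 𝒫^sing` of polynomials
`q₁ + q₂ + ⋯ + q_M`, parametrised by `f = q₂ + ⋯ + q_M ∈ 𝒫^sing`. Let `𝒫ᵢ` be the
Zariski closure of the locus violating condition (R1.i) and `cᵢ` its codimension.
Then `min {c₁, c₂, c₃} = c₂ = (M−6)(M−5)/2`; equivalently, `𝒫₂` has codimension
exactly `(M−6)(M−5)/2` and `𝒫₁`, `𝒫₃` have dimension at most that of `𝒫₂`. -/
theorem codim_nonregular_at_nonsingular_point (M : ℕ) (hM : 8 ≤ M)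
    (q₁ : MvPolynomial (Fin M) ℂ) (hq₁ : q₁.IsHomogeneous 1) (hq₁0 : q₁ ≠ 0) :
    zdim (zclosure {f : ↥(Psing M) | ¬ CondR12 q₁ (f : MvPolynomial (Fin M) ℂ)})
        + (((M - 6) * (M - 5) / 2 : ℕ) : ℕ∞)
      = ((Module.finrank ℂ ↥(Psing M) : ℕ∞) : WithBot ℕ∞) ∧
    zdim (zclosure {f : ↥(Psing M) | ¬ CondR11 q₁ (f : MvPolynomial (Fin M) ℂ)})
      ≤ zdim (zclosure {f : ↥(Psing M) | ¬ CondR12 q₁ (f : MvPolynomial (Fin M) ℂ)}) ∧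
    zdim (zclosure {f : ↥(Psing M) | ¬ CondR13 q₁ (f : MvPolynomial (Fin M) ℂ)})
      ≤ zdim (zclosure {f : ↥(Psing M) | ¬ CondR12 q₁ (f : MvPolynomial (Fin M) ℂ)}) := by
  obtain ⟨r, rfl⟩ : ∃ r, M = 5 + r + 1 := ⟨M - 6, by omega⟩
  obtain ⟨ι, σ, h⟩ := exists_isHyperplaneRestriction hq₁ hq₁0
  rw [show 5 + r + 1 - 6 = r by omega, show 5 + r + 1 - 5 = r + 1 by omega]
  exact codim_nonregular_of_restriction (by omega) h hq₁ hq₁0
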